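/- There exists a function B₄ : ℕ × ℕ → ℕ with the following property: for all d, ℓ ∈ ℕ and every nonzero polynomial f(x, y) ∈ ℂ[x, y] which, when written as a polynomial in x with coefficients in ℂ[y], has at most ℓ nonzero coefficients, and whose degree in y is at most d, if g ∈ ℂ(x) is a rational function satisfying f(x, g(x)) = 0 identically, then N#(g) ≤ B₄(d, ℓ). -/

import Mathlib

open Polynomial

/-- `N#(g)`: the minimal total number of nonzero terms over all representations
`g = p/q` with `p, q ∈ ℂ[x]`, `q ≠ 0` (not necessarily coprime). -/
noncomputable def Nsharp (g : RatFunc ℂ) : ℕ :=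
  sInf {n : ℕ | ∃ p q : Polynomial ℂ, q ≠ 0 ∧
    g = algebraMap (Polynomial ℂ) (RatFunc ℂ) p / algebraMap (Polynomial ℂ) (RatFunc ℂ) q ∧
    n = p.support.card + q.support.card}

section LeadingTerms

variable {Q : Type*} [NormedField Q]

/-- `W` is a multiplicative group of "terms" whose elements of norm one are exactly the nonzero
elements of the coefficient field `κ`. -/
structure IsTermGroup (κ : Subfield Q) (W : Set Q) : Prop where
  ne_zero : ∀ w ∈ W, w ≠ 0
  mul_mem : ∀ w ∈ W, ∀ w' ∈ W, w * w' ∈ W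
  inv_mem : ∀ w ∈ W, w⁻¹ ∈ W
  const_mem : ∀ c ∈ κ, c ≠ 0 → c ∈ W
  mem_const : ∀ w ∈ W, ‖w‖ = 1 → w ∈ κ
  norm_const : ∀ c ∈ κ, c ≠ 0 → ‖c‖ = 1

variable {κ : Subfield Q} {W : Set Q}

namespace IsTermGroup

theorem one_mem (h : IsTermGroup κ W) : (1 : Q) ∈ W := h.const_mem 1 κ.one_mem one_ne_zero

theorem const_mul_mem (h : IsTermGroup κ W) {c w : Q} (hc : c ∈ κ) (hc0 : c ≠ 0) (hw : w ∈ W) :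
    c * w ∈ W := h.mul_mem _ (h.const_mem c hc hc0) _ hw

theorem neg_mem (h : IsTermGroup κ W) {w : Q} (hw : w ∈ W) : -w ∈ W := by
  simpa using h.const_mul_mem (κ.neg_mem κ.one_mem) (by simp) hw

theorem div_mem_const (h : IsTermGroup κ W) {w w' : Q} (hw : w ∈ W) (hw' : w' ∈ W)
    (hn : ‖w‖ = ‖w'‖) : w / w' ∈ κ := by
  rw [div_eq_mul_inv]
  refine h.mem_const _ (h.mul_mem _ hw _ (h.inv_mem _ hw')) ?_
  rw [norm_mul, norm_inv, hn, mul_inv_cancel₀]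
  exact norm_ne_zero_iff.2 (h.ne_zero _ hw')

theorem add_mem_of_norm_eq (h : IsTermGroup κ W) {w w' : Q} (hw : w ∈ W) (hw' : w' ∈ W)
    (hn : ‖w‖ = ‖w'‖) (h0 : w + w' ≠ 0) : w + w' ∈ W ∧ ‖w + w'‖ = ‖w'‖ := by
  have hw0 := h.ne_zero _ hw'
  have e : w + w' = (w / w' + 1) * w' := by field_simp
  have hc : w / w' + 1 ∈ κ := κ.add_mem (h.div_mem_const hw hw' hn) κ.one_mem
  have hc0 : w / w' + 1 ≠ 0 := by
    intro h1; rw [e, h1, zero_mul] at h0; exact h0 rfl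
  rw [e]
  exact ⟨h.const_mul_mem hc hc0 hw', by rw [norm_mul, h.norm_const _ hc hc0, one_mul]⟩

theorem norm_const_le (h : IsTermGroup κ W) {c : Q} (hc : c ∈ κ) : ‖c‖ ≤ 1 := by
  by_cases h0 : c = 0
  · simp [h0]
  · exact (h.norm_const c hc h0).le

end IsTermGroup

/-- In an ultrametric group, a nonempty finite sum of elements with pairwise distinct norms has
a dominating summand. -/
theorem exists_norm_sum_sub_lt {ι G : Type*} [SeminormedAddCommGroup G] [IsUltrametricDist G]
    (s : Finset ι) (hs : s.Nonempty) (f : ι → G)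
    (h0 : ∀ i ∈ s, 0 < ‖f i‖) (hinj : Set.InjOn (fun i => ‖f i‖) s) :
    ∃ j ∈ s, ‖(∑ i ∈ s, f i) - f j‖ < ‖f j‖ ∧ ∀ i ∈ s, ‖f i‖ ≤ ‖f j‖ := by
  classical
  obtain ⟨j, hj, hmax⟩ := s.exists_max_image (fun i => ‖f i‖) hs
  refine ⟨j, hj, ?_, hmax⟩
  rw [← Finset.add_sum_erase s f hj, add_sub_cancel_left]
  rcases (s.erase j).eq_empty_or_nonempty with he | hne
  · simp [he, h0 j hj]
  · obtain ⟨i, hi, hle⟩ := IsUltrametricDist.exists_norm_finsetSum_le_of_nonempty hne f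
    refine hle.trans_lt (lt_of_le_of_ne (hmax i (Finset.mem_of_mem_erase hi)) fun he => ?_)
    exact Finset.ne_of_mem_erase hi (hinj (Finset.mem_of_mem_erase hi) hj he)

theorem norm_eq_of_norm_sub_lt {G : Type*} [SeminormedAddCommGroup G] [IsUltrametricDist G]
    {a b : G} (h : ‖a - b‖ < ‖b‖) : ‖a‖ = ‖b‖ := by
  have := IsUltrametricDist.norm_add_eq_max_of_norm_ne_norm h.ne
  rw [sub_add_cancel, max_eq_right h.le] at this
  exact this

theorem norm_eq_of_norm_sub_lt' {G : Type*} [SeminormedAddCommGroup G] [IsUltrametricDist G]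
    {a b : G} (h : ‖a - b‖ < ‖a‖) : ‖a‖ = ‖b‖ :=
  (norm_eq_of_norm_sub_lt (by rwa [norm_sub_rev])).symm

theorem norm_add_lt_of_lt {G : Type*} [SeminormedAddCommGroup G] [IsUltrametricDist G]
    {a b : G} {r : ℝ} (ha : ‖a‖ < r) (hb : ‖b‖ < r) : ‖a + b‖ < r :=
  (IsUltrametricDist.norm_add_le_max _ _).trans_lt (max_lt ha hb)

theorem IsTermGroup.exists_sum_eq_add (h : IsTermGroup κ W) (s : Finset Q) (hs : ∀ x ∈ s, x ∈ W)
    (hinj : Set.InjOn (fun x : Q => ‖x‖) s) (w : Q) (hw : w ∈ W) :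
    ∃ s' : Finset Q, (∀ x ∈ s', x ∈ W) ∧ Set.InjOn (fun x : Q => ‖x‖) s' ∧
      ∑ x ∈ s', x = w + ∑ x ∈ s, x := by
  classical
  have key : ∀ (s : Finset Q), (∀ x ∈ s, x ∈ W) → Set.InjOn (fun x : Q => ‖x‖) s → ∀ w ∈ W,
      (∀ x ∈ s, ‖x‖ ≠ ‖w‖) → (∀ x ∈ insert w s, x ∈ W) ∧
        Set.InjOn (fun x : Q => ‖x‖) (insert w s : Finset Q) ∧
        ∑ x ∈ insert w s, x = w + ∑ x ∈ s, x := by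
    intro s hs hinj w hw hne
    have hws : w ∉ s := fun hws => hne w hws rfl
    refine ⟨?_, ?_, Finset.sum_insert hws⟩
    · intro x hx
      rcases Finset.mem_insert.1 hx with rfl | hx
      exacts [hw, hs x hx]
    · rw [Finset.coe_insert, Set.injOn_insert (by simpa using hws)]
      refine ⟨hinj, ?_⟩
      rintro ⟨x, hx, he⟩
      exact hne x hx he
  by_cases hx : ∃ x ∈ s, ‖x‖ = ‖w‖
  · obtain ⟨x, hxs, hxw⟩ := hx
    have hs1 : ∀ y ∈ s.erase x, y ∈ W := fun y hy => hs y (Finset.mem_of_mem_erase hy)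
    have hi1 : Set.InjOn (fun x : Q => ‖x‖) (s.erase x : Finset Q) :=
      hinj.mono (by simp)
    have e : w + ∑ x ∈ s, x = (w + x) + ∑ y ∈ s.erase x, y := by
      rw [← Finset.add_sum_erase s _ hxs]; ring
    rw [e]
    by_cases h0 : w + x = 0
    · exact ⟨s.erase x, hs1, hi1, by rw [h0, zero_add]⟩
    · obtain ⟨h1, h2⟩ := h.add_mem_of_norm_eq hw (hs x hxs) hxw.symm h0
      refine ⟨_, key _ hs1 hi1 _ h1 ?_⟩
      intro y hy he
      exact Finset.ne_of_mem_erase hy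
        (hinj (Finset.mem_of_mem_erase hy) hxs (he.trans h2))
  · push Not at hx
    exact ⟨_, key s hs hinj w hw hx⟩

theorem IsTermGroup.exists_sum_eq (h : IsTermGroup κ W) {r : Q} (hr : r ∈ AddSubgroup.closure W) :
    ∃ s : Finset Q, (∀ x ∈ s, x ∈ W) ∧ Set.InjOn (fun x : Q => ‖x‖) s ∧ ∑ x ∈ s, x = r := by
  classical
  induction hr using AddSubgroup.closure_induction with
  | mem x hx => exact ⟨{x}, by simpa using hx, by simp, by simp⟩
  | zero => exact ⟨∅, by simp, by simp, by simp⟩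
  | neg x _ ih =>
    obtain ⟨s, h1, h2, h3⟩ := ih
    refine ⟨s.map (Equiv.neg Q).toEmbedding, ?_, ?_, ?_⟩
    · intro y hy
      obtain ⟨z, hz, rfl⟩ := Finset.mem_map.1 hy
      exact h.neg_mem (h1 z hz)
    · intro y hy z hz hyz
      obtain ⟨y, hy', rfl⟩ := Finset.mem_map.1 hy
      obtain ⟨z, hz', rfl⟩ := Finset.mem_map.1 hz
      have : y = z := h2 hy' hz' (by simpa using hyz)
      rw [this]
    · rw [← h3, Finset.sum_map]
      exact Finset.sum_neg_distrib _
  | add x y _ _ ihx ihy =>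
    obtain ⟨s, h1, h2, h3⟩ := ihx
    obtain ⟨t, k1, k2, k3⟩ := ihy
    rw [← h3, ← k3]
    clear h2 h3
    induction s using Finset.induction_on with
    | empty => exact ⟨t, k1, k2, by simp⟩
    | insert a s ha ih =>
      obtain ⟨u, u1, u2, u3⟩ := ih (fun x hx => h1 x (Finset.mem_insert_of_mem hx))
      obtain ⟨v, v1, v2, v3⟩ := h.exists_sum_eq_add u u1 u2 a (h1 a (Finset.mem_insert_self _ _))
      exact ⟨v, v1, v2, by rw [v3, u3, Finset.sum_insert ha]; ring⟩

theorem IsTermGroup.mul_mem_closure (h : IsTermGroup κ W) {a b : Q}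
    (ha : a ∈ AddSubgroup.closure W) (hb : b ∈ AddSubgroup.closure W) :
    a * b ∈ AddSubgroup.closure W := by
  induction ha using AddSubgroup.closure_induction with
  | mem x hx =>
    induction hb using AddSubgroup.closure_induction with
    | mem y hy => exact AddSubgroup.subset_closure (h.mul_mem _ hx _ hy)
    | zero => simp
    | neg y _ ih => rw [mul_neg]; exact (AddSubgroup.closure W).neg_mem ih
    | add y z _ _ i1 i2 => rw [mul_add]; exact add_mem i1 i2
  | zero => simp
  | neg y _ ih => rw [neg_mul]; exact (AddSubgroup.closure W).neg_mem ih
  | add y z _ _ i1 i2 => rw [add_mul]; exact add_mem i1 i2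

variable [IsUltrametricDist Q]

theorem IsTermGroup.exists_leading (h : IsTermGroup κ W) {a : Q}
    (ha : a ∈ (AddSubgroup.closure W).topologicalClosure) (ha0 : a ≠ 0) :
    ∃ w ∈ W, ‖a - w‖ < ‖a‖ := by
  have hpos := norm_pos_iff.2 ha0
  obtain ⟨r, hr, hra⟩ := Metric.mem_closure_iff.1 ha ‖a‖ hpos
  rw [dist_eq_norm] at hra
  have hn := norm_eq_of_norm_sub_lt' hra
  obtain ⟨s, h1, h2, h3⟩ := h.exists_sum_eq hr
  have hne : s.Nonempty := by
    rw [Finset.nonempty_iff_ne_empty]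
    rintro rfl
    rw [Finset.sum_empty] at h3
    rw [← h3, norm_zero] at hn
    exact hpos.ne' hn
  obtain ⟨j, hj, hlt, -⟩ := exists_norm_sum_sub_lt s hne (fun x => x)
    (fun i hi => norm_pos_iff.2 (h.ne_zero _ (h1 i hi))) h2
  rw [h3] at hlt
  refine ⟨j, h1 j hj, ?_⟩
  have hj' := norm_eq_of_norm_sub_lt hlt
  rw [← sub_add_sub_cancel a r j]
  exact norm_add_lt_of_lt hra (by rw [hn, hj']; exact hlt)

/-- The closure of the additive span of the terms, as a subfield. -/
def IsTermGroup.subfield [CompleteSpace Q] (h : IsTermGroup κ W) : Subfield Q :=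
  { (AddSubgroup.closure W).topologicalClosure with
    mul_mem' := by
      intro a b ha hb
      exact map_mem_closure₂ continuous_mul ha hb fun a ha b hb => h.mul_mem_closure ha hb
    one_mem' := AddSubgroup.le_topologicalClosure _ (AddSubgroup.subset_closure h.one_mem)
    inv_mem' := by
      intro a ha
      change a⁻¹ ∈ (AddSubgroup.closure W).topologicalClosure
      have ha' : a ∈ (AddSubgroup.closure W).topologicalClosure := ha
      by_cases ha0 : a = 0
      · rw [ha0, inv_zero]; exact zero_mem _
      have hmul : ∀ x ∈ (AddSubgroup.closure W).topologicalClosure,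
          ∀ y ∈ (AddSubgroup.closure W).topologicalClosure,
          x * y ∈ (AddSubgroup.closure W).topologicalClosure := by
        intro a ha b hb
        exact map_mem_closure₂ continuous_mul ha hb fun a ha b hb => h.mul_mem_closure ha hb
      have hsub : ∀ w ∈ W, w ∈ (AddSubgroup.closure W).topologicalClosure := fun w hw =>
        AddSubgroup.le_topologicalClosure _ (AddSubgroup.subset_closure hw)
      obtain ⟨w, hw, hlt⟩ := h.exists_leading ha' ha0
      have hw0 := h.ne_zero w hw
      set u : Q := (w - a) * w⁻¹ with hu
      have hu1 : ‖u‖ < 1 := by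
        rw [hu, norm_mul, norm_inv, ← norm_eq_of_norm_sub_lt' hlt, norm_sub_rev,
          ← div_eq_mul_inv, div_lt_one (norm_pos_iff.2 ha0)]
        exact hlt
      have huA : u ∈ (AddSubgroup.closure W).topologicalClosure :=
        hmul _ (sub_mem (hsub w hw) ha') _ (hsub _ (h.inv_mem w hw))
      have hpow : ∀ n : ℕ, u ^ n ∈ (AddSubgroup.closure W).topologicalClosure := by
        intro n
        induction n with
        | zero => rw [pow_zero]; exact hsub _ h.one_mem
        | succ n ih => rw [pow_succ]; exact hmul _ ih _ huA
      have hsum := (hasSum_geometric_of_norm_lt_one hu1).tendsto_sum_nat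
      have hinv : (1 - u)⁻¹ ∈ (AddSubgroup.closure W).topologicalClosure :=
        (AddSubgroup.isClosed_topologicalClosure _).mem_of_tendsto hsum
          (Filter.Eventually.of_forall fun n => sum_mem fun i _ => hpow i)
      have e : a⁻¹ = w⁻¹ * (1 - u)⁻¹ := by
        rw [← mul_inv, hu]; congr 1; field_simp; ring
      rw [e]
      exact hmul _ (hsub _ (h.inv_mem w hw)) _ hinv }

theorem IsTermGroup.subset_subfield [CompleteSpace Q] (h : IsTermGroup κ W) {w : Q} (hw : w ∈ W) :
    w ∈ h.subfield :=
  AddSubgroup.le_topologicalClosure _ (AddSubgroup.subset_closure hw)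

end LeadingTerms

section Henselian

theorem norm_nextCoeff_minpoly_le {Q : Type*} [NormedField Q] [IsUltrametricDist Q] (A : Subfield Q)
    [CompleteSpace A] (hA : ∃ x : A, x ≠ 0 ∧ ‖x‖ ≠ 1) {y : Q} (hy : IsAlgebraic A y) :
    ‖(minpoly A y).nextCoeff‖ ≤ ‖y‖ := by
  let _ : NontriviallyNormedField A := NontriviallyNormedField.ofNormNeOne hA
  let L := algebraicClosure A Q
  have : IsUltrametricDist A := ⟨fun x y z => IsUltrametricDist.dist_triangle_max (x : Q) y z⟩
  let f : AbsoluteValue L ℝ :=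
    { toFun := fun x => ‖(x : Q)‖
      map_mul' := fun x y => norm_mul _ _
      nonneg' := fun x => norm_nonneg _
      eq_zero' := fun x => by simp
      add_le' := fun x y => norm_add_le _ _ }
  let z : L := ⟨y, mem_algebraicClosure_iff.2 hy⟩
  have hz := spectralNorm_unique_field_norm_ext (K := A) (L := L) (f := f) (fun x => rfl) z
  have hm : minpoly A z = minpoly A y := (minpoly.algebraMap_eq (B' := Q) (algebraMap L Q).injective z).symm
  have hd : 0 < (minpoly A y).natDegree := minpoly.natDegree_pos hy.isIntegral
  rw [Polynomial.nextCoeff_of_natDegree_pos hd]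
  have h1 : spectralValueTerms (minpoly A y) ((minpoly A y).natDegree - 1) ≤
      spectralValue (minpoly A y) :=
    le_ciSup (spectralValueTerms_bddAbove (minpoly A y)) _
  have h2 : spectralValueTerms (minpoly A y) ((minpoly A y).natDegree - 1) =
      ‖(minpoly A y).coeff ((minpoly A y).natDegree - 1)‖ := by
    rw [spectralValueTerms, if_pos (Nat.sub_lt hd one_pos), Nat.cast_sub hd]
    simp
  rw [← h2]
  refine h1.trans (le_of_eq ?_)
  change _ = f z
  rw [hz, spectralNorm, hm]

theorem nextCoeff_comp_X_add_C {R : Type*} [CommRing R] [IsDomain R] {p : R[X]} (hp : p.Monic)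
    (hd : 0 < p.natDegree) (a : R) :
    (p.comp (X + C a)).nextCoeff = p.nextCoeff + p.natDegree * a := by
  have hd' : (p.comp (X + C a)).natDegree = p.natDegree := by
    rw [natDegree_comp, natDegree_X_add_C, mul_one]
  rw [nextCoeff_of_natDegree_pos (by rwa [hd']), nextCoeff_of_natDegree_pos hd, hd',
    ← Polynomial.taylor_apply, taylor_coeff]
  have hlt : (hasseDeriv (p.natDegree - 1) p).natDegree < 2 :=
    (natDegree_hasseDeriv_le _ _).trans_lt (by omega)
  rw [eval_eq_sum_range' hlt, Finset.sum_range_succ, Finset.sum_range_one, hasseDeriv_coeff,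
    hasseDeriv_coeff]
  have e : 1 + (p.natDegree - 1) = p.natDegree := by omega
  rw [e, zero_add, Nat.choose_self, hp.coeff_natDegree,
    Nat.choose_symm_of_eq_add (show p.natDegree = (p.natDegree - 1) + 1 by omega), Nat.choose_one_right]
  ring

variable {Q : Type*} [NormedField Q] [IsUltrametricDist Q]

theorem exists_lift_norm_le_one {q : Q[X]} (hq : ∀ i, ‖q.coeff i‖ ≤ 1) :
    ∃ (O : Subring Q) (q₀ : O[X]), (∀ x : Q, x ∈ O ↔ ‖x‖ ≤ 1) ∧ q₀.map O.subtype = q := by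
  let O : Subring Q :=
    { carrier := {x | ‖x‖ ≤ 1}
      mul_mem' := fun {a b} ha hb => by
        simp only [Set.mem_ofPred_eq, norm_mul] at *
        exact mul_le_one₀ ha (norm_nonneg _) hb
      one_mem' := by simp
      add_mem' := fun {a b} ha hb => (IsUltrametricDist.norm_add_le_max a b).trans (max_le ha hb)
      zero_mem' := by simp
      neg_mem' := fun {a} ha => by simpa using ha }
  have : q ∈ lifts O.subtype := by
    rw [lifts_iff_coeff_lifts]
    exact fun n => ⟨⟨q.coeff n, hq n⟩, rfl⟩
  obtain ⟨q₀, h⟩ := (mem_lifts q).1 this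
  exact ⟨O, q₀, fun x => Iff.rfl, h⟩

theorem norm_eval_le_one {q : Q[X]} (hq : ∀ i, ‖q.coeff i‖ ≤ 1) {x : Q} (hx : ‖x‖ ≤ 1) :
    ‖q.eval x‖ ≤ 1 := by
  obtain ⟨O, q₀, hO, rfl⟩ := exists_lift_norm_le_one hq
  lift x to O using (hO x).2 hx
  rw [show (x : Q) = O.subtype x from rfl, eval_map_apply]
  exact (hO _).1 (q₀.eval x).2

theorem norm_eval_sub_eval_le {q : Q[X]} (hq : ∀ i, ‖q.coeff i‖ ≤ 1) {x y : Q} (hx : ‖x‖ ≤ 1)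
    (hy : ‖y‖ ≤ 1) : ‖q.eval x - q.eval y‖ ≤ ‖x - y‖ := by
  obtain ⟨O, q₀, hO, rfl⟩ := exists_lift_norm_le_one hq
  lift x to O using (hO x).2 hx
  lift y to O using (hO y).2 hy
  rw [show (x : Q) = O.subtype x from rfl, show (y : Q) = O.subtype y from rfl,
    eval_map_apply, eval_map_apply]
  obtain ⟨z, hz⟩ := evalSubFactor q₀ x y
  rw [← map_sub, hz, map_mul, norm_mul, map_sub]
  exact mul_le_of_le_one_left (norm_nonneg _) ((hO _).1 z.2)

theorem norm_eval_sub_eval_sub_le {q : Q[X]} (hq : ∀ i, ‖q.coeff i‖ ≤ 1) {x y : Q} (hx : ‖x‖ ≤ 1)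
    (hy : ‖y‖ ≤ 1) : ‖q.eval x - q.eval y - q.derivative.eval y * (x - y)‖ ≤ ‖x - y‖ ^ 2 := by
  obtain ⟨O, q₀, hO, rfl⟩ := exists_lift_norm_le_one hq
  lift x to O using (hO x).2 hx
  lift y to O using (hO y).2 hy
  rw [show (x : Q) = O.subtype x from rfl, show (y : Q) = O.subtype y from rfl,
    derivative_map, eval_map_apply, eval_map_apply, eval_map_apply]
  obtain ⟨z, hz⟩ := binomExpansion q₀ y (x - y)
  rw [add_sub_cancel] at hz
  rw [← map_sub, ← map_sub, ← map_mul, ← map_sub, hz]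
  have e : eval y q₀ + eval y (derivative q₀) * (x - y) + z * (x - y) ^ 2 - eval y q₀ -
      eval y (derivative q₀) * (x - y) = z * (x - y) ^ 2 := by ring
  rw [e, map_mul, norm_mul, map_pow, norm_pow]
  exact mul_le_of_le_one_left (by positivity) ((hO _).1 z.2)

theorem norm_coeff_derivative_le {q : Q[X]} (hq : ∀ i, ‖q.coeff i‖ ≤ 1) (i : ℕ) :
    ‖q.derivative.coeff i‖ ≤ 1 := by
  obtain ⟨O, q₀, hO, rfl⟩ := exists_lift_norm_le_one hq
  rw [derivative_map, coeff_map]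
  exact (hO _).1 (coeff (derivative q₀) i).2

theorem exists_root_of_norm_eval_lt [CompleteSpace Q] {q : Q[X]} (hq : ∀ i, ‖q.coeff i‖ ≤ 1)
    {u : Q} (hu : ‖u‖ ≤ 1) (h1 : ‖q.eval u‖ < 1) (h2 : ‖q.derivative.eval u‖ = 1) :
    ∃ c, q.eval c = 0 ∧ ‖u - c‖ < 1 := by
  set r := ‖q.eval u‖ with hr
  set d := q.derivative.eval u with hd
  have hd0 : d ≠ 0 := by rw [← norm_ne_zero_iff, h2]; exact one_ne_zero
  let s : Set Q := Metric.closedBall u r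
  have hs1 : ∀ x ∈ s, ‖x‖ ≤ 1 := by
    intro x hx
    rw [mem_closedBall_iff_norm] at hx
    rw [← sub_add_cancel x u]
    exact (IsUltrametricDist.norm_add_le_max _ _).trans (max_le (hx.trans h1.le) hu)
  have hmaps : Set.MapsTo (fun x => x - q.eval x / d) s s := by
    intro x hx
    have hx1 := hs1 x hx
    rw [mem_closedBall_iff_norm] at hx ⊢
    have e : x - eval x q / d - u = (x - u) + -(eval x q / d) := by ring
    rw [e]
    refine (IsUltrametricDist.norm_add_le_max _ _).trans (max_le hx ?_)
    rw [norm_neg, norm_div, h2, div_one, ← sub_add_cancel (eval x q) (eval u q)]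
    exact (IsUltrametricDist.norm_add_le_max _ _).trans
      (max_le ((norm_eval_sub_eval_le hq hx1 hu).trans hx) le_rfl)
  have hcontr : ContractingWith ⟨r, norm_nonneg _⟩ (hmaps.restrict _ s s) := by
    refine ⟨h1, LipschitzWith.of_dist_le_mul ?_⟩
    rintro ⟨x, hx⟩ ⟨y, hy⟩
    have hx1 := hs1 x hx
    have hy1 := hs1 y hy
    rw [mem_closedBall_iff_norm] at hx hy
    rw [Subtype.dist_eq, Subtype.dist_eq, Set.MapsTo.val_restrict_apply,
      Set.MapsTo.val_restrict_apply, dist_eq_norm, dist_eq_norm]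
    change ‖x - eval x q / d - (y - eval y q / d)‖ ≤ r * ‖x - y‖
    have e : x - eval x q / d - (y - eval y q / d) =
      ((d - q.derivative.eval y) * (x - y) -
        (q.eval x - q.eval y - q.derivative.eval y * (x - y))) / d := by
      field_simp; ring
    rw [e, norm_div, h2, div_one, sub_eq_add_neg]
    refine (IsUltrametricDist.norm_add_le_max _ _).trans (max_le ?_ ?_)
    · rw [norm_mul]
      refine mul_le_mul_of_nonneg_right ?_ (norm_nonneg _)
      refine (norm_eval_sub_eval_le (norm_coeff_derivative_le hq) hu hy1).trans ?_
      rwa [norm_sub_rev]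
    · rw [norm_neg]
      refine (norm_eval_sub_eval_sub_le hq hx1 hy1).trans ?_
      rw [pow_two]
      refine mul_le_mul_of_nonneg_right ?_ (norm_nonneg _)
      rw [← sub_sub_sub_cancel_right x y u, sub_eq_add_neg]
      exact (IsUltrametricDist.norm_add_le_max _ _).trans (max_le hx (by rwa [norm_neg]))
  obtain ⟨c, hc, hfix, -⟩ := ContractingWith.exists_fixedPoint'
    (Metric.isClosed_closedBall.isComplete) hmaps hcontr
    (x := u) (Metric.mem_closedBall_self (norm_nonneg _)) (edist_ne_top _ _)
  refine ⟨c, ?_, ?_⟩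
  · have : c - eval c q / d = c := hfix
    have h3 : eval c q / d = 0 := by linear_combination -this
    rcases div_eq_zero_iff.1 h3 with h | h
    exacts [h, absurd h hd0]
  · rw [mem_closedBall_iff_norm] at hc
    rw [norm_sub_rev]
    exact hc.trans_lt h1

end Henselian

section AlgebraicallyClosed

variable {Q : Type*} [NormedField Q] [IsUltrametricDist Q] {κ : Subfield Q} {W : Set Q}

theorem aeval_eq_sum_support_coe {E : Type*} [Field E] {A : Subfield E} (p : A[X]) (y : E) :
    aeval y p = ∑ i ∈ p.support, (p.coeff i : E) * y ^ i := by
  rw [aeval_def, eval₂_eq_sum, Polynomial.sum]; rfl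

theorem IsTermGroup.exists_const_norm_sub_lt (h : IsTermGroup κ W) {a : Q}
    (ha : a ∈ (AddSubgroup.closure W).topologicalClosure) (ha1 : ‖a‖ ≤ 1) :
    ∃ c ∈ κ, ‖a - c‖ < 1 := by
  rcases ha1.lt_or_eq with h1 | h1
  · exact ⟨0, κ.zero_mem, by simpa⟩
  · obtain ⟨w, hw, hlt⟩ := h.exists_leading ha (by rw [← norm_ne_zero_iff, h1]; exact one_ne_zero)
    exact ⟨w, h.mem_const w hw (by rw [← norm_eq_of_norm_sub_lt' hlt, h1]), h1 ▸ hlt⟩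

theorem IsTermGroup.norm_aeval_le_one (h : IsTermGroup κ W) (q : κ[X]) {u : Q} (hu : ‖u‖ ≤ 1) :
    ‖aeval u q‖ ≤ 1 := by
  rw [aeval_def, ← eval_map]
  refine norm_eval_le_one (fun i => ?_) hu
  rw [coeff_map]
  exact h.norm_const_le (q.coeff i).2

theorem IsTermGroup.exists_const_of_norm_aeval_lt [CompleteSpace Q] [CharZero Q]
    (h : IsTermGroup κ W)
    (hκ : ∀ y : Q, IsAlgebraic κ y → y ∈ κ) {u : Q} (hu : ‖u‖ = 1) (q : κ[X]) :
    q ≠ 0 → ‖aeval u q‖ < 1 → ∃ c ∈ κ, ‖u - c‖ < 1 := by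
  induction q using UniqueFactorizationMonoid.induction_on_prime with
  | h₁ => exact fun h0 => absurd rfl h0
  | h₂ x hx =>
    intro _ hlt
    obtain ⟨c, hc, rfl⟩ := Polynomial.isUnit_iff.1 hx
    rw [aeval_C] at hlt
    have : ‖(c : Q)‖ = 1 := h.norm_const _ c.2 (by simpa using hc.ne_zero)
    exact absurd this hlt.ne
  | h₃ a p ha hp ih =>
    intro _ hlt
    by_cases hp1 : ‖aeval u p‖ < 1
    · obtain ⟨a, b, hab⟩ := hp.irreducible.separable
      have h1 := congrArg (aeval u) hab
      simp only [map_add, map_mul, map_one] at h1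
      have h2 : ‖aeval u (derivative p)‖ = 1 := by
        refine le_antisymm (h.norm_aeval_le_one _ hu.le) ?_
        by_contra! hlt'
        have h3 : ‖(1 : Q)‖ < 1 := by
          rw [← h1]
          refine norm_add_lt_of_lt ?_ ?_
          · rw [norm_mul]
            exact mul_lt_one_of_nonneg_of_lt_one_right (h.norm_aeval_le_one _ hu.le)
              (norm_nonneg _) hp1
          · rw [norm_mul]
            exact mul_lt_one_of_nonneg_of_lt_one_right (h.norm_aeval_le_one _ hu.le)
              (norm_nonneg _) hlt'
        rw [norm_one] at h3
        exact lt_irrefl _ h3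
      rw [aeval_def, ← eval_map] at hp1 h2
      rw [← derivative_map] at h2
      obtain ⟨c, hc, hlt⟩ := exists_root_of_norm_eval_lt (q := p.map (algebraMap κ Q))
        (fun i => by rw [coeff_map]; exact h.norm_const_le (p.coeff i).2) hu.le hp1 h2
      refine ⟨c, hκ c ⟨p, hp.ne_zero, ?_⟩, hlt⟩
      rwa [aeval_def, ← eval_map]
    · refine ih ha ?_
      rw [map_mul, norm_mul] at hlt
      push Not at hp1
      exact lt_of_le_of_lt (le_mul_of_one_le_left (norm_nonneg _) hp1) hlt

theorem IsTermGroup.exists_const_norm_sub_lt_of_isAlgebraic [CompleteSpace Q] [CharZero Q]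
    (h : IsTermGroup κ W) (hκ : ∀ y : Q, IsAlgebraic κ y → y ∈ κ) {u : Q} (hu : ‖u‖ = 1)
    (halg : IsAlgebraic h.subfield u) : ∃ c ∈ κ, ‖u - c‖ < 1 := by
  obtain ⟨p, hp0, hp⟩ := halg
  obtain ⟨m, hm, hmax⟩ := p.support.exists_max_image (fun i => ‖p.coeff i‖)
    (nonempty_support_iff.2 hp0)
  have hm0 : p.coeff m ≠ 0 := mem_support_iff.1 hm
  have hmpos : 0 < ‖p.coeff m‖ := norm_pos_iff.2 hm0
  have hle : ∀ i, ‖((p.coeff i / p.coeff m : h.subfield) : Q)‖ ≤ 1 := by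
    intro i
    change ‖p.coeff i / p.coeff m‖ ≤ 1
    rw [norm_div, div_le_one hmpos]
    by_cases hi : p.coeff i = 0
    · simp [hi]
    · exact hmax i (mem_support_iff.2 hi)
  choose c hc hclt using fun i => h.exists_const_norm_sub_lt
    (p.coeff i / p.coeff m : h.subfield).2 (hle i)
  let q : κ[X] := ∑ i ∈ p.support, monomial i (⟨c i, hc i⟩ : κ)
  have hqm : q.coeff m = ⟨c m, hc m⟩ := by
    simp only [q, finsetSum_coeff, coeff_monomial]
    rw [Finset.sum_ite_eq' p.support m, if_pos hm]
  refine h.exists_const_of_norm_aeval_lt hκ hu q ?_ ?_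
  · intro hq
    rw [hq, coeff_zero] at hqm
    have hcm : c m = 0 := congrArg Subtype.val hqm.symm
    have := hclt m
    rw [hcm, div_self hm0] at this
    simp at this
  · have e1 : aeval u q = ∑ i ∈ p.support, c i * u ^ i := by
      simp only [q, map_sum, aeval_monomial]
      rfl
    have e2 : ∑ i ∈ p.support, ((p.coeff i / p.coeff m : h.subfield) : Q) * u ^ i = 0 := by
      rw [aeval_eq_sum_support_coe] at hp
      rw [← zero_div (p.coeff m : Q), ← hp, Finset.sum_div]
      refine Finset.sum_congr rfl fun i _ => ?_
      push_cast
      ring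
    have e3 : aeval u q = -∑ i ∈ p.support,
        (((p.coeff i / p.coeff m : h.subfield) : Q) - c i) * u ^ i := by
      simp only [sub_mul, Finset.sum_sub_distrib, e2, e1]
      ring
    rw [e3, norm_neg]
    obtain ⟨j, -, hj⟩ := IsUltrametricDist.exists_norm_finsetSum_le p.support (fun i =>
      (((p.coeff i / p.coeff m : h.subfield) : Q) - c i) * u ^ i)
    refine hj.trans_lt ?_
    rw [norm_mul, norm_pow, hu, one_pow, mul_one]
    exact hclt j

theorem exists_norm_pow_eq {A : Subfield Q} {y : Q} (hy0 : y ≠ 0) (hy : IsAlgebraic A y) :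
    ∃ n : ℕ, 0 < n ∧ ∃ a : A, a ≠ 0 ∧ ‖y‖ ^ n = ‖a‖ := by
  obtain ⟨p, hp0, hp⟩ := hy
  by_contra! hne
  have hs : ∀ i ∈ p.support, (p.coeff i : Q) * y ^ i ≠ 0 := fun i hi =>
    mul_ne_zero (by simpa using mem_support_iff.1 hi) (pow_ne_zero _ hy0)
  have key : ∀ i ∈ p.support, ∀ j ∈ p.support, i < j →
      ‖(p.coeff i : Q) * y ^ i‖ ≠ ‖(p.coeff j : Q) * y ^ j‖ := by
    intro i hi j hj hij he
    refine hne (j - i) (by omega) (p.coeff i / p.coeff j)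
      (div_ne_zero (mem_support_iff.1 hi) (mem_support_iff.1 hj)) ?_
    rw [norm_mul, norm_mul, norm_pow, norm_pow] at he
    have hyn : ‖y‖ ≠ 0 := norm_ne_zero_iff.2 hy0
    have hj' : ‖(p.coeff j : Q)‖ ≠ 0 := norm_ne_zero_iff.2 (by simpa using mem_support_iff.1 hj)
    rw [norm_div]
    change _ = ‖(p.coeff i : Q)‖ / ‖(p.coeff j : Q)‖
    rw [eq_div_iff hj', pow_sub₀ _ hyn hij.le, ← div_eq_mul_inv, div_mul_eq_mul_div,
      div_eq_iff (pow_ne_zero _ hyn), he]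
    ring
  have hinj : Set.InjOn (fun i => ‖(p.coeff i : Q) * y ^ i‖) p.support := by
    intro i hi j hj he
    rcases lt_trichotomy i j with h | h | h
    exacts [absurd he (key i hi j hj h), h, absurd he.symm (key j hj i hi h)]
  obtain ⟨j, hj, hlt, -⟩ := exists_norm_sum_sub_lt p.support (nonempty_support_iff.2 hp0)
    (fun i => (p.coeff i : Q) * y ^ i) (fun i hi => norm_pos_iff.2 (hs i hi)) hinj
  rw [← aeval_eq_sum_support_coe, hp, zero_sub, norm_neg] at hlt
  exact lt_irrefl _ hlt

theorem IsTermGroup.mem_subfield_of_isAlgebraic [CompleteSpace Q] [CharZero Q]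
    (h : IsTermGroup κ W) (hκ : ∀ y : Q, IsAlgebraic κ y → y ∈ κ)
    (hdiv : ∀ y : Q, y ≠ 0 → ∀ n : ℕ, 0 < n → ∀ w ∈ W, ‖y‖ ^ n = ‖w‖ → ∃ w' ∈ W, ‖w'‖ = ‖y‖)
    (hnt : ∃ w ∈ W, ‖w‖ ≠ 1) {y : Q} (hy : IsAlgebraic h.subfield y) : y ∈ h.subfield := by
  set A := h.subfield with hA
  have : CompleteSpace A :=
    (AddSubgroup.isClosed_topologicalClosure (AddSubgroup.closure W)).completeSpace_coe
  have hnt' : ∃ x : A, x ≠ 0 ∧ ‖x‖ ≠ 1 := by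
    obtain ⟨w, hw, hw1⟩ := hnt
    exact ⟨⟨w, h.subset_subfield hw⟩, fun h0 => h.ne_zero w hw (congrArg Subtype.val h0), hw1⟩
  by_contra hyA
  have hcon : ∀ a : A, y - a ∉ A := fun a ha => hyA (by
    have := A.add_mem ha a.2
    rwa [sub_add_cancel] at this)
  set n := (minpoly A y).natDegree with hn
  have hn0 : 0 < n := minpoly.natDegree_pos hy.isIntegral
  have hmonic := minpoly.monic hy.isIntegral
  have hnn : (n : Q) ≠ 0 := Nat.cast_ne_zero.2 hn0.ne'
  have hn1 : ‖(n : Q)‖ = 1 := h.norm_const _ (natCast_mem κ n) hnn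
  have hnA : (n : A) ≠ 0 := fun h0 => hnn (by simpa using congrArg Subtype.val h0)
  have htr : ∀ a : A, ‖(minpoly A y).nextCoeff + n * a‖ ≤ ‖y - a‖ := by
    intro a
    rw [← nextCoeff_comp_X_add_C hmonic hn0, ← minpoly.sub_algebraMap]
    exact norm_nextCoeff_minpoly_le A hnt' (hy.sub (isAlgebraic_algebraMap a))
  set a₀ : A := -((minpoly A y).nextCoeff / n) with ha₀
  set z := y - a₀ with hz
  have hzA : z ∉ A := hcon a₀
  have hz0 : z ≠ 0 := fun h0 => hzA (h0 ▸ A.zero_mem)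
  have hzalg : IsAlgebraic A z := hy.sub (isAlgebraic_algebraMap a₀)
  have htr' : ∀ b : A, ‖b‖ ≤ ‖z - b‖ := by
    intro b
    have h1 := htr (a₀ + b)
    have e : (minpoly A y).nextCoeff + n * (a₀ + b) = n * b := by
      rw [ha₀]; field_simp; ring
    rw [e, norm_mul] at h1
    have h2 : ‖(n : A)‖ = 1 := by
      change ‖((n : A) : Q)‖ = 1
      simpa using hn1
    rw [h2, one_mul] at h1
    refine h1.trans (le_of_eq ?_)
    rw [hz]; push_cast; congr 1; ring
  obtain ⟨m, hm, a, ha, hma⟩ := exists_norm_pow_eq hz0 hzalg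
  obtain ⟨w, hw, hlt⟩ := h.exists_leading a.2 (by simpa using ha)
  obtain ⟨w', hw', hwn⟩ := hdiv z hz0 m hm w hw (hma.trans (norm_eq_of_norm_sub_lt' hlt))
  have hw0 := h.ne_zero w' hw'
  have hwA : w' ∈ A := h.subset_subfield hw'
  have hu1 : ‖z / w'‖ = 1 := by
    rw [norm_div, hwn, div_self (norm_ne_zero_iff.2 hz0)]
  have hualg : IsAlgebraic A (z / w') := by
    rw [div_eq_mul_inv]
    exact hzalg.mul (isAlgebraic_algebraMap (⟨w', hwA⟩ : A)).inv
  obtain ⟨c, hc, hclt⟩ := h.exists_const_norm_sub_lt_of_isAlgebraic hκ hu1 hualg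
  have hlt' : ‖z - c * w'‖ < ‖z‖ := by
    have e : z - c * w' = (z / w' - c) * w' := by field_simp
    rw [e, norm_mul, hwn]
    exact mul_lt_of_lt_one_left (norm_pos_iff.2 hz0) hclt
  have hcA : c ∈ A := by
    by_cases hc0 : c = 0
    · rw [hc0]; exact A.zero_mem
    · exact h.subset_subfield (h.const_mem c hc hc0)
  have h3 := htr' ⟨c * w', A.mul_mem hcA hwA⟩
  change ‖c * w'‖ ≤ ‖z - c * w'‖ at h3
  rw [← norm_eq_of_norm_sub_lt' hlt'] at h3
  exact absurd h3 hlt'.not_ge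

end AlgebraicallyClosed

section DifferentialOperators

variable {Q : Type*} [NormedField Q]

/-- The value at `h` of the differential operator `∑ i ≤ n, p i * Θ ^ i`. -/
def diffOp (Θ : Derivation ℤ Q Q) (n : ℕ) (p : ℕ → Q) (h : Q) : Q :=
  ∑ i ∈ Finset.range (n + 1), p i * Θ^[i] h

theorem diffOp_sub (Θ : Derivation ℤ Q Q) (n : ℕ) (p : ℕ → Q) (a b : Q) :
    diffOp Θ n p (a - b) = diffOp Θ n p a - diffOp Θ n p b := by
  simp only [diffOp, iterate_map_sub, mul_sub, Finset.sum_sub_distrib]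

theorem norm_iterate_le {Θ : Derivation ℤ Q Q} (hΘ : ∀ h, ‖Θ h‖ ≤ ‖h‖) (i : ℕ) (h : Q) :
    ‖Θ^[i] h‖ ≤ ‖h‖ := by
  induction i with
  | zero => simp
  | succ i ih => rw [Function.iterate_succ', Function.comp_apply]; exact (hΘ _).trans ih

theorem exists_diffOp_eq_zero {Θ : Derivation ℤ Q Q} {F : Subfield Q} (V : Submodule F Q)
    [FiniteDimensional F V] (hV : ∀ v ∈ V, Θ v ∈ V) {v : Q} (hv : v ∈ V) :
    ∃ (n : ℕ) (p : ℕ → Q), (∀ i, p i ∈ F) ∧ p n ≠ 0 ∧ diffOp Θ n p v = 0 := by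
  classical
  have hit : ∀ i, Θ^[i] v ∈ V := by
    intro i
    induction i with
    | zero => exact hv
    | succ i ih => rw [Function.iterate_succ', Function.comp_apply]; exact hV _ ih
  set d := Module.finrank F V with hd
  have hdep : ¬ LinearIndependent F (fun i : Fin (d + 1) => (⟨Θ^[i] v, hit i⟩ : V)) := by
    intro hli
    have := hli.fintype_card_le_finrank
    rw [Fintype.card_fin] at this
    omega
  rw [Fintype.not_linearIndependent_iff] at hdep
  obtain ⟨c, hc, i₀, hi₀⟩ := hdep
  obtain ⟨n, hn, hmax⟩ := (Finset.univ.filter fun i => c i ≠ 0).exists_max_image id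
    ⟨i₀, by simpa using hi₀⟩
  have hcn : c n ≠ 0 := (Finset.mem_filter.1 hn).2
  set p : ℕ → Q := fun i => if h : i < d + 1 then (c ⟨i, h⟩ : Q) else 0 with hp
  refine ⟨n, p, ?_, ?_, ?_⟩
  · intro i
    simp only [hp]
    split_ifs
    exacts [(c _).2, F.zero_mem]
  · have : (n : ℕ) < d + 1 := n.2
    simp only [hp, this, dif_pos, ne_eq, ZeroMemClass.coe_eq_zero]
    exact hcn
  · have h1 := congrArg Subtype.val hc
    rw [diffOp]
    have h2 : ∑ i ∈ Finset.range (d + 1), p i * Θ^[i] v = 0 := by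
      rw [Finset.sum_range]
      rw [← show ((0 : V) : Q) = 0 from rfl, ← h1]
      push_cast
      refine Finset.sum_congr rfl fun i _ => ?_
      simp only [hp, i.2, dif_pos]
      rfl
    rw [← h2]
    refine Finset.sum_subset (Finset.range_subset_range.2 (by have := n.2; omega)) ?_
    intro i hi hin
    have hi' := Finset.mem_range.1 hi
    have : c ⟨i, hi'⟩ = 0 := by
      by_contra h0
      have := hmax ⟨i, hi'⟩ (by simpa using h0)
      rw [Finset.mem_range] at hin
      simp only [id, Fin.le_def] at this
      omega
    simp [hp, this]

variable [IsUltrametricDist Q]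

theorem norm_diffOp_le {Θ : Derivation ℤ Q Q} (hΘ : ∀ h, ‖Θ h‖ ≤ ‖h‖) (n : ℕ) {p : ℕ → Q}
    (hp : ∀ i, ‖p i‖ ≤ 1) (h : Q) : ‖diffOp Θ n p h‖ ≤ ‖h‖ := by
  refine IsUltrametricDist.norm_sum_le_of_forall_le_of_nonneg (norm_nonneg _) fun i _ => ?_
  rw [norm_mul]
  exact (mul_le_of_le_one_left (norm_nonneg _) (hp i)).trans (norm_iterate_le hΘ i h)

theorem sum_ne_zero_of_injOn_norm {s : Finset Q} (hs : s.Nonempty) (f : Q → Q)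
    (h0 : ∀ x ∈ s, f x ≠ 0) (hinj : Set.InjOn (fun x => ‖f x‖) s) : ∑ x ∈ s, f x ≠ 0 := by
  intro h
  obtain ⟨j, hj, hlt, -⟩ := exists_norm_sum_sub_lt s hs f (fun i hi => norm_pos_iff.2 (h0 i hi)) hinj
  rw [h, zero_sub, norm_neg] at hlt
  exact lt_irrefl _ hlt

theorem no_wronskian_relation {Θ : Derivation ℤ Q Q} (hconst : ∀ h, Θ h = 0 → h ≠ 0 → ‖h‖ = 1)
    {n : ℕ} {p : ℕ → Q} (hpn : p n ≠ 0) (m : ℕ) : ∀ (t : Finset Q) (a : Q → Q), t.card = m →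
    t.Nonempty → (∀ x ∈ t, x ≠ 0) → Set.InjOn (fun x : Q => ‖x‖) t →
    (∀ x ∈ t, diffOp Θ n p x = 0) → (∀ x ∈ t, a x ≠ 0) →
    (∀ i < n, ∑ x ∈ t, a x * Θ^[i] x = 0) → False := by
  classical
  induction m using Nat.strong_induction_on with
  | _ m ih =>
  intro t a htm ht ht0 hinj hop ha hrel
  obtain ⟨x₀, hx₀⟩ := ht
  rcases Nat.eq_zero_or_pos n with rfl | hn
  · have := hop x₀ hx₀
    simp only [diffOp, zero_add, Finset.range_one, Finset.sum_singleton, Function.iterate_zero,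
      id] at this
    exact mul_ne_zero hpn (ht0 x₀ hx₀) this
  set b : Q → Q := fun x => a x / a x₀ with hb
  have hb0 : ∀ x ∈ t, b x ≠ 0 := fun x hx => div_ne_zero (ha x hx) (ha x₀ hx₀)
  have hrelb : ∀ i < n, ∑ x ∈ t, b x * Θ^[i] x = 0 := by
    intro i hi
    have : ∑ x ∈ t, b x * Θ^[i] x = (∑ x ∈ t, a x * Θ^[i] x) / a x₀ := by
      rw [Finset.sum_div]
      exact Finset.sum_congr rfl fun x _ => by rw [hb]; ring
    rw [this, hrel i hi, zero_div]
  have hrelb' : ∑ x ∈ t, b x * Θ^[n] x = 0 := by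
    have h1 : ∑ x ∈ t, b x * diffOp Θ n p x = 0 :=
      Finset.sum_eq_zero fun x hx => by rw [hop x hx, mul_zero]
    simp only [diffOp, Finset.mul_sum] at h1
    rw [Finset.sum_comm, Finset.sum_range_succ] at h1
    have h2 : ∀ i, ∑ x ∈ t, b x * (p i * Θ^[i] x) = p i * ∑ x ∈ t, b x * Θ^[i] x := by
      intro i
      rw [Finset.mul_sum]
      exact Finset.sum_congr rfl fun x _ => by ring
    rw [Finset.sum_eq_zero fun i hi => by
      rw [h2, hrelb i (Finset.mem_range.1 hi), mul_zero], zero_add, h2] at h1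
    exact (mul_eq_zero.1 h1).resolve_left hpn
  have hder : ∀ i < n, ∑ x ∈ t, Θ (b x) * Θ^[i] x = 0 := by
    intro i hi
    have h1 := congrArg Θ (hrelb i hi)
    have h2 : ∑ x ∈ t, b x * Θ^[i + 1] x = 0 := by
      rcases Nat.lt_or_ge (i + 1) n with h | h
      · exact hrelb _ h
      · rwa [show i + 1 = n by omega]
    simp only [map_sum, Derivation.leibniz, map_zero, Finset.sum_add_distrib, smul_eq_mul] at h1
    simp only [Function.iterate_succ', Function.comp_apply] at h2
    rw [h2, zero_add] at h1
    rw [← h1]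
    exact Finset.sum_congr rfl fun x _ => mul_comm _ _
  by_cases hall : ∀ x ∈ t, Θ (b x) = 0
  · refine sum_ne_zero_of_injOn_norm ⟨x₀, hx₀⟩ (fun x => b x * x)
      (fun x hx => mul_ne_zero (hb0 x hx) (ht0 x hx)) ?_ (hrelb 0 hn)
    intro x hx y hy he
    simp only [norm_mul, hconst _ (hall x hx) (hb0 x hx), hconst _ (hall y hy) (hb0 y hy),
      one_mul] at he
    exact hinj hx hy he
  · push Not at hall
    obtain ⟨x₁, hx₁, hx₁'⟩ := hall
    set t' := t.filter fun x => Θ (b x) ≠ 0 with ht'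
    have hsub : t' ⊆ t := Finset.filter_subset _ _
    have hx₀' : x₀ ∉ t' := by
      intro h
      refine (Finset.mem_filter.1 h).2 ?_
      rw [hb]
      simp only
      rw [div_self (ha x₀ hx₀), Derivation.map_one_eq_zero]
    have hlt : t'.card < m := htm ▸ Finset.card_lt_card
      (Finset.ssubset_iff_subset_ne.2 ⟨hsub, fun h => hx₀' (h ▸ hx₀)⟩)
    refine ih _ hlt t' (fun x => Θ (b x)) rfl ⟨x₁, Finset.mem_filter.2 ⟨hx₁, hx₁'⟩⟩
      (fun x hx => ht0 x (hsub hx)) (hinj.mono (by exact_mod_cast hsub))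
      (fun x hx => hop x (hsub hx)) (fun x hx => (Finset.mem_filter.1 hx).2) ?_
    intro i hi
    refine Eq.trans ?_ (hder i hi)
    rw [ht', Finset.sum_filter]
    refine Finset.sum_congr rfl fun x _ => ?_
    split_ifs with h
    · rfl
    · push Not at h; rw [h, zero_mul]

theorem card_le_of_diffOp_eq_zero {Θ : Derivation ℤ Q Q}
    (hconst : ∀ h, Θ h = 0 → h ≠ 0 → ‖h‖ = 1) {n : ℕ} {p : ℕ → Q} (hpn : p n ≠ 0) {s : Finset Q}
    (hs0 : ∀ x ∈ s, x ≠ 0) (hinj : Set.InjOn (fun x : Q => ‖x‖) s)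
    (hop : ∀ x ∈ s, diffOp Θ n p x = 0) : s.card ≤ n := by
  classical
  by_contra! hlt
  have hdep : ¬ LinearIndependent Q (fun (x : s) (i : Fin n) => Θ^[i] (x : Q)) := by
    intro hli
    have := hli.fintype_card_le_finrank
    simp at this
    omega
  rw [Fintype.not_linearIndependent_iff] at hdep
  obtain ⟨c, hc, ⟨x₁, hx₁⟩, hcx⟩ := hdep
  set a : Q → Q := fun x => if h : x ∈ s then c ⟨x, h⟩ else 0 with ha
  have hrel : ∀ i < n, ∑ x ∈ s, a x * Θ^[i] x = 0 := by
    intro i hi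
    have h1 := congrFun hc ⟨i, hi⟩
    simp only [Finset.sum_apply, Pi.smul_apply, smul_eq_mul, Pi.zero_apply] at h1
    rw [← h1, ← Finset.sum_coe_sort]
    refine Finset.sum_congr rfl fun x _ => ?_
    simp [ha]
  refine no_wronskian_relation hconst hpn _ (s.filter fun x => a x ≠ 0) a rfl
    ⟨x₁, ?_⟩ (fun x hx => hs0 x (Finset.filter_subset _ _ hx))
    (hinj.mono (by exact_mod_cast Finset.filter_subset _ _))
    (fun x hx => hop x (Finset.filter_subset _ _ hx)) (fun x hx => (Finset.mem_filter.1 hx).2) ?_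
  · rw [Finset.mem_filter]
    refine ⟨hx₁, ?_⟩
    simp only [ha, hx₁, dif_pos]
    exact hcx
  · intro i hi
    refine Eq.trans ?_ (hrel i hi)
    rw [Finset.sum_filter]
    refine Finset.sum_congr rfl fun x _ => ?_
    split_ifs with h
    · rfl
    · push Not at h; rw [h, zero_mul]

end DifferentialOperators

section FiniteExpansion

variable {Q : Type*} [NormedField Q] {κ : Subfield Q} {W : Set Q}

theorem exists_stable_submodule_of_mem_closure {Θ : Derivation ℤ Q Q}
    {F : Subfield Q}
    (hfin : ∀ w ∈ W, ∃ V : Submodule F Q, FiniteDimensional F V ∧ w ∈ V ∧ ∀ v ∈ V, Θ v ∈ V)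
    {r : Q} (hr : r ∈ AddSubgroup.closure W) :
    ∃ V : Submodule F Q, FiniteDimensional F V ∧ r ∈ V ∧ ∀ v ∈ V, Θ v ∈ V := by
  induction hr using AddSubgroup.closure_induction with
  | mem x hx => exact hfin x hx
  | zero => exact ⟨⊥, inferInstance, zero_mem _, by simp⟩
  | neg x _ ih =>
    obtain ⟨V, h1, h2, h3⟩ := ih
    exact ⟨V, h1, V.neg_mem h2, h3⟩
  | add x y _ _ ihx ihy =>
    obtain ⟨V, h1, h2, h3⟩ := ihx
    obtain ⟨V', h1', h2', h3'⟩ := ihy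
    refine ⟨V ⊔ V', inferInstance, Submodule.add_mem_sup h2 h2', ?_⟩
    intro v hv
    obtain ⟨a, ha, b, hb, rfl⟩ := Submodule.mem_sup.1 hv
    rw [map_add]
    exact Submodule.add_mem_sup (h3 a ha) (h3' b hb)

theorem IsTermGroup.diffOp_mem (h : IsTermGroup κ W) {Θ : Derivation ℤ Q Q}
    (hΘW : ∀ w ∈ W, ∃ c ∈ κ, Θ w = c * w) (n : ℕ) {p : ℕ → Q} (hp : ∀ i, p i ∈ κ) {w : Q}
    (hw : w ∈ W) : ∃ c ∈ κ, diffOp Θ n p w = c * w := by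
  have hκ : ∀ c ∈ κ, Θ c ∈ κ := by
    intro c hc
    by_cases h0 : c = 0
    · rw [h0, map_zero]; exact κ.zero_mem
    · obtain ⟨c', hc', he⟩ := hΘW c (h.const_mem c hc h0)
      rw [he]; exact κ.mul_mem hc' hc
  obtain ⟨c, hc, he⟩ := hΘW w hw
  have hit : ∀ i, ∃ b ∈ κ, Θ^[i] w = b * w := by
    intro i
    induction i with
    | zero => exact ⟨1, κ.one_mem, by simp⟩
    | succ i ih =>
      obtain ⟨b, hb, hbe⟩ := ih
      refine ⟨b * c + Θ b, κ.add_mem (κ.mul_mem hb hc) (hκ b hb), ?_⟩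
      rw [Function.iterate_succ', Function.comp_apply, hbe, Derivation.leibniz, he, smul_eq_mul,
        smul_eq_mul]
      ring
  choose b hb hbe using hit
  refine ⟨∑ i ∈ Finset.range (n + 1), p i * b i, sum_mem fun i _ => κ.mul_mem (hp i) (hb i), ?_⟩
  rw [diffOp, Finset.sum_mul]
  exact Finset.sum_congr rfl fun i _ => by rw [hbe]; ring

variable [IsUltrametricDist Q]

theorem IsTermGroup.mem_closure_of_mem_stable (h : IsTermGroup κ W) {Θ : Derivation ℤ Q Q}
    (hΘ : ∀ h, ‖Θ h‖ ≤ ‖h‖) (hconst : ∀ h, Θ h = 0 → h ≠ 0 → ‖h‖ = 1) {F : Subfield Q}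
    (hF : F ≤ κ) (hΘW : ∀ w ∈ W, ∃ c ∈ κ, Θ w = c * w)
    (hfin : ∀ w ∈ W, ∃ V : Submodule F Q, FiniteDimensional F V ∧ w ∈ V ∧ ∀ v ∈ V, Θ v ∈ V)
    (U : Submodule F Q) (hU : ∀ u ∈ U, Θ u ∈ U) {ε : ℝ} (hε : 0 < ε)
    (hUε : ∀ u ∈ U, u ≠ 0 → ε ≤ ‖u‖) {g : Q}
    (hg : g ∈ (AddSubgroup.closure W).topologicalClosure) (hgU : g ∈ U) :
    g ∈ AddSubgroup.closure W := by
  classical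
  obtain ⟨g₀, hg₀, hlt⟩ := Metric.mem_closure_iff.1 hg ε hε
  rw [dist_eq_norm] at hlt
  obtain ⟨V, hVfin, hg₀V, hV⟩ := exists_stable_submodule_of_mem_closure hfin hg₀
  obtain ⟨n, p, hpF, hpn, hop⟩ := exists_diffOp_eq_zero V hV hg₀V
  have hp1 : ∀ i, ‖p i‖ ≤ 1 := fun i => h.norm_const_le (hF (hpF i))
  have hopU : diffOp Θ n p g ∈ U := by
    refine U.sum_mem fun i _ => U.smul_mem (⟨p i, hpF i⟩ : F) ?_
    induction i with
    | zero => exact hgU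
    | succ i ih => rw [Function.iterate_succ', Function.comp_apply]; exact hU _ (ih (by grind))
  have hopg : diffOp Θ n p g = 0 := by
    by_contra h0
    have h1 := hUε _ hopU h0
    have h2 := diffOp_sub Θ n p g g₀
    rw [hop, sub_zero] at h2
    rw [← h2] at h1
    exact absurd (h1.trans (norm_diffOp_le hΘ n hp1 _)) hlt.not_ge
  by_contra hgR
  have key : ∀ k : ℕ, ∃ s : Finset Q, s.card = k ∧ (∀ x ∈ s, x ∈ W) ∧
      Set.InjOn (fun x : Q => ‖x‖) s ∧ (∀ x ∈ s, diffOp Θ n p x = 0) ∧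
      ∀ x ∈ s, ‖g - ∑ x ∈ s, x‖ < ‖x‖ := by
    intro k
    induction k with
    | zero => exact ⟨∅, by simp⟩
    | succ k ih =>
      obtain ⟨s, hcard, hsW, hinj, hsop, hslt⟩ := ih
      set f := g - ∑ x ∈ s, x with hf
      have hsum : ∑ x ∈ s, x ∈ AddSubgroup.closure W :=
        sum_mem fun x hx => AddSubgroup.subset_closure (hsW x hx)
      have hf0 : f ≠ 0 := by
        intro h0
        rw [hf, sub_eq_zero] at h0
        exact hgR (h0 ▸ hsum)
      have hfA : f ∈ (AddSubgroup.closure W).topologicalClosure :=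
        sub_mem hg (AddSubgroup.le_topologicalClosure _ hsum)
      obtain ⟨w, hw, hwlt⟩ := h.exists_leading hfA hf0
      have hwn := norm_eq_of_norm_sub_lt' hwlt
      have hne : ∀ x ∈ s, ‖x‖ ≠ ‖w‖ := fun x hx => (hwn ▸ hslt x hx).ne'
      have hws : w ∉ s := fun hws => hne w hws rfl
      have hopf : diffOp Θ n p f = 0 := by
        have : ∀ t : Finset Q, (∀ x ∈ t, diffOp Θ n p x = 0) →
            diffOp Θ n p (g - ∑ x ∈ t, x) = 0 := by
          intro t
          induction t using Finset.induction_on with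
          | empty => intro _; simpa using hopg
          | insert a t hat ih =>
            intro ht
            rw [Finset.sum_insert hat, add_comm, ← sub_sub, diffOp_sub,
              ih fun x hx => ht x (Finset.mem_insert_of_mem hx),
              ht a (Finset.mem_insert_self _ _), sub_zero]
        exact this s hsop
      have hopw : diffOp Θ n p w = 0 := by
        obtain ⟨c, hc, hce⟩ := h.diffOp_mem hΘW n (fun i => hF (hpF i)) hw
        by_contra h0
        have hc0 : c ≠ 0 := by rintro rfl; rw [zero_mul] at hce; exact h0 hce
        have h1 : ‖diffOp Θ n p w‖ = ‖w‖ := by rw [hce, norm_mul, h.norm_const c hc hc0, one_mul]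
        have h2 := diffOp_sub Θ n p f w
        rw [hopf, zero_sub] at h2
        have h3 := norm_diffOp_le hΘ n hp1 (f - w)
        rw [h2, norm_neg, h1, ← hwn] at h3
        exact absurd h3 hwlt.not_ge
      refine ⟨insert w s, by rw [Finset.card_insert_of_notMem hws, hcard], ?_, ?_, ?_, ?_⟩
      · intro x hx
        rcases Finset.mem_insert.1 hx with rfl | hx
        exacts [hw, hsW x hx]
      · rw [Finset.coe_insert, Set.injOn_insert (by simpa using hws)]
        refine ⟨hinj, ?_⟩
        rintro ⟨x, hx, he⟩
        exact hne x hx he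
      · intro x hx
        rcases Finset.mem_insert.1 hx with rfl | hx
        exacts [hopw, hsop x hx]
      · rw [Finset.sum_insert hws]
        have e : g - (w + ∑ x ∈ s, x) = f - w := by rw [hf]; ring
        rw [e]
        intro x hx
        rcases Finset.mem_insert.1 hx with rfl | hx
        exacts [hwn ▸ hwlt, hwlt.trans (hslt x hx)]
  obtain ⟨s, hcard, hsW, hinj, hsop, -⟩ := key (n + 1)
  have := card_le_of_diffOp_eq_zero hconst hpn (fun x hx => h.ne_zero x (hsW x hx)) hinj hsop
  omega

end FiniteExpansion

section Descent

theorem derivation_mem_adjoin {Q : Type*} [Field Q] [CharZero Q] (Θ : Derivation ℤ Q Q)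
    {F : Subfield Q} (hF : ∀ c ∈ F, Θ c ∈ F) {b : Q} (hb : IsAlgebraic F b) :
    Θ b ∈ IntermediateField.adjoin F {b} := by
  set L := IntermediateField.adjoin F {b} with hL
  have hbL : b ∈ L := IntermediateField.mem_adjoin_simple_self F b
  have hFL : ∀ c ∈ F, c ∈ L := fun c hc => L.algebraMap_mem ⟨c, hc⟩
  have haev : ∀ p : F[X], aeval b p ∈ L := fun p => by
    rw [aeval_eq_sum_support_coe]
    exact sum_mem fun i _ => L.mul_mem (hFL _ (p.coeff i).2) (pow_mem hbL i)
  have key : ∀ p : F[X], ∃ r ∈ L, Θ (aeval b p) = r + aeval b (derivative p) * Θ b := by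
    intro p
    induction p using Polynomial.induction_on' with
    | add p q hp hq =>
      obtain ⟨r, hr, h1⟩ := hp
      obtain ⟨s, hs, h2⟩ := hq
      exact ⟨r + s, L.add_mem hr hs, by simp only [map_add, h1, h2]; ring⟩
    | monomial n a =>
      refine ⟨Θ (a : Q) * b ^ n, L.mul_mem (hFL _ (hF _ a.2)) (pow_mem hbL n), ?_⟩
      rw [aeval_monomial, derivative_monomial, aeval_monomial, Derivation.leibniz,
        Derivation.leibniz_pow]
      simp only [smul_eq_mul, nsmul_eq_mul, map_mul, map_natCast]
      change (a : Q) * _ + _ = _ + (a : Q) * _ * _ * _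
      change (a : Q) * _ + _ * Θ (a : Q) = _ 
      ring
  obtain ⟨r, hr, h1⟩ := key (minpoly F b)
  rw [minpoly.aeval, map_zero] at h1
  have hne : aeval b (derivative (minpoly F b)) ≠ 0 :=
    (minpoly.irreducible hb.isIntegral).separable.aeval_derivative_ne_zero (minpoly.aeval F b)
  have e : Θ b = -r / aeval b (derivative (minpoly F b)) := by
    rw [eq_div_iff hne]; linear_combination -h1
  rw [e]
  exact L.div_mem (L.neg_mem hr) (haev _)

theorem eq_zero_of_sum_mul_pow_eq_zero {Q : Type*} [Field Q] [CharZero Q] {F M : Subfield Q}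
    (hFM : F ≤ M) (hcl : ∀ y ∈ M, IsAlgebraic F y → y ∈ F) {θ : Q} (hθ : IsAlgebraic F θ)
    (p : M[X]) (hp : aeval θ p = 0) (hdeg : p.degree < (minpoly F θ).degree) : p = 0 := by
  by_contra hp0
  let _ : Algebra F M := (Subfield.inclusion hFM).toAlgebra
  have : IsScalarTower F M Q := IsScalarTower.of_algebraMap_eq fun _ => rfl
  have hθM : IsIntegral M θ := hθ.isIntegral.tower_top
  have hlift : minpoly M θ ∈ lifts (algebraMap F M) := by
    have h1 := integralClosure.mem_lifts_of_monic_of_dvd_map M (minpoly.monic hθ.isIntegral)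
      (minpoly.monic hθM) (minpoly.dvd_map_of_isScalarTower F M θ)
    rw [lifts_iff_coeff_lifts] at h1 ⊢
    intro n
    obtain ⟨y, hy⟩ := h1 n
    have hy' : IsAlgebraic F ((y : M) : Q) := (y.2.map (IsScalarTower.toAlgHom F M Q)).isAlgebraic
    exact ⟨⟨_, hcl _ (y : M).2 hy'⟩, by rw [← hy]; rfl⟩
  obtain ⟨q, hq⟩ := (mem_lifts _).1 hlift
  have hqθ : aeval θ q = 0 := by
    rw [← aeval_map_algebraMap M, hq, minpoly.aeval]
  have hq0 : q ≠ 0 := by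
    rintro rfl
    rw [Polynomial.map_zero] at hq
    exact minpoly.ne_zero hθM hq.symm
  have h1 := minpoly.degree_le_of_ne_zero F θ hq0 hqθ
  have h2 := minpoly.degree_le_of_ne_zero M θ hp0 hp
  rw [← hq, degree_map] at h2
  exact absurd (h1.trans h2) hdeg.not_ge

theorem mem_of_mem_closure_mul {Q : Type*} [Field Q] [CharZero Q] {F M : Subfield Q}
    (hFM : F ≤ M) (hcl : ∀ y ∈ M, IsAlgebraic F y → y ∈ F) (S : Submodule F Q)
    (hS : ∀ s ∈ S, s ∈ M) {r : Q} (hrM : r ∈ M)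
    (hr : r ∈ AddSubgroup.closure {x | ∃ c, IsAlgebraic F c ∧ ∃ s ∈ S, x = c * s}) : r ∈ S := by
  have h1 : ∃ L : IntermediateField F Q, FiniteDimensional F L ∧
      r ∈ AddSubgroup.closure {x | ∃ c ∈ L, ∃ s ∈ S, x = c * s} := by
    clear hrM
    induction hr using AddSubgroup.closure_induction with
    | mem x hx =>
      obtain ⟨c, hc, s, hs, rfl⟩ := hx
      exact ⟨IntermediateField.adjoin F {c}, IntermediateField.adjoin.finiteDimensional hc.isIntegral,
        AddSubgroup.subset_closure ⟨c, IntermediateField.mem_adjoin_simple_self F c, s, hs, rfl⟩⟩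
    | zero => exact ⟨⊥, inferInstance, zero_mem _⟩
    | neg x _ ih =>
      obtain ⟨L, h1, h2⟩ := ih
      exact ⟨L, h1, AddSubgroup.neg_mem _ h2⟩
    | add x y _ _ ihx ihy =>
      obtain ⟨L, h1, h2⟩ := ihx
      obtain ⟨L', h1', h2'⟩ := ihy
      refine ⟨L ⊔ L', inferInstance, AddSubgroup.add_mem _
        (AddSubgroup.closure_mono ?_ h2) (AddSubgroup.closure_mono ?_ h2')⟩
      · rintro x ⟨c, hc, hx⟩
        exact ⟨c, (le_sup_left : L ≤ L ⊔ L') hc, hx⟩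
      · rintro x ⟨c, hc, hx⟩
        exact ⟨c, (le_sup_right : L' ≤ L ⊔ L') hc, hx⟩
  obtain ⟨L, hL, hrL⟩ := h1
  obtain ⟨θ, hθ⟩ := Field.exists_primitive_element F L
  have hθalg : IsAlgebraic F (θ : Q) := (Algebra.IsAlgebraic.isAlgebraic (R := F) θ).algebraMap
  have hθint := hθalg.isIntegral
  set d := (minpoly F (θ : Q)).natDegree with hd
  have hd0 : 0 < d := minpoly.natDegree_pos hθint
  have hrep : ∀ c ∈ L, ∃ f : F[X], f.natDegree < d ∧ c = aeval (θ : Q) f := by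
    intro c hc
    have h2 : (⟨c, hc⟩ : L) ∈ IntermediateField.adjoin F {θ} := hθ ▸ IntermediateField.mem_top
    have h3 : (⟨c, hc⟩ : L) ∈ Algebra.adjoin F {θ} := by
      rw [← IntermediateField.adjoin_simple_toSubalgebra_of_isAlgebraic
        (Algebra.IsAlgebraic.isAlgebraic θ)]
      exact h2
    obtain ⟨f, hf⟩ := (Algebra.adjoin_singleton_eq_range_aeval F θ ▸ h3 :
      (⟨c, hc⟩ : L) ∈ (aeval θ).range)
    have hmonic := minpoly.monic hθint
    refine ⟨f %ₘ minpoly F (θ : Q), natDegree_modByMonic_lt _ hmonic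
      (minpoly.ne_one F (θ : Q)), ?_⟩
    have h4 : c = aeval (θ : Q) f := by
      have h5 := congrArg (algebraMap L Q) hf
      exact h5.symm.trans (aeval_algebraMap_apply Q θ f).symm
    rw [h4]
    conv_lhs => rw [← modByMonic_add_div f (minpoly F (θ : Q))]
    rw [map_add, map_mul, minpoly.aeval, zero_mul, add_zero]
  have h2 : ∃ m : ℕ → Q, (∀ i, m i ∈ S) ∧ r = ∑ i ∈ Finset.range d, m i * (θ : Q) ^ i := by
    clear hrM hr
    induction hrL using AddSubgroup.closure_induction with
    | mem x hx =>
      obtain ⟨c, hc, s, hs, rfl⟩ := hx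
      obtain ⟨f, hf, rfl⟩ := hrep c hc
      refine ⟨fun i => (f.coeff i : Q) * s, fun i => S.smul_mem (f.coeff i) hs, ?_⟩
      rw [aeval_eq_sum_range' hf, Finset.sum_mul]
      refine Finset.sum_congr rfl fun i _ => ?_
      change (f.coeff i : Q) * _ * _ = _
      ring
    | zero => exact ⟨fun _ => 0, fun _ => zero_mem _, by simp⟩
    | neg x _ ih =>
      obtain ⟨m, h1, h2⟩ := ih
      exact ⟨fun i => -m i, fun i => S.neg_mem (h1 i), by rw [h2]; simp⟩
    | add x y _ _ ihx ihy =>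
      obtain ⟨m, h1, h2⟩ := ihx
      obtain ⟨m', h1', h2'⟩ := ihy
      exact ⟨fun i => m i + m' i, fun i => S.add_mem (h1 i) (h1' i), by
        rw [h2, h2']; simp [add_mul, Finset.sum_add_distrib]⟩
  obtain ⟨m, hmS, hrm⟩ := h2
  let p : M[X] := C ⟨r, hrM⟩ - ∑ i ∈ Finset.range d, C ⟨m i, hS _ (hmS i)⟩ * X ^ i
  have hpe : aeval (θ : Q) p = 0 := by
    simp only [p, map_sub, map_sum, map_mul, map_pow, aeval_C, aeval_X]
    rw [sub_eq_zero]
    exact hrm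
  have hp0 : p = 0 := by
    refine eq_zero_of_sum_mul_pow_eq_zero hFM hcl hθalg p hpe ?_
    rw [degree_eq_natDegree (minpoly.ne_zero hθint), ← hd]
    refine (degree_sub_le _ _).trans_lt (max_lt ?_ ?_)
    · exact degree_C_le.trans_lt (by exact_mod_cast hd0)
    · refine (degree_sum_le _ _).trans_lt ((Finset.sup_lt_iff (by exact_mod_cast WithBot.bot_lt_coe d)).2 ?_)
      intro i hi
      exact (degree_C_mul_X_pow_le _ _).trans_lt (by exact_mod_cast Finset.mem_range.1 hi)
  have h3 := congrArg (fun q => ((q.coeff 0 : M) : Q)) hp0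
  simp only [p, coeff_sub, coeff_C_zero, finsetSum_coeff, coeff_C_mul, coeff_X_pow,
    coeff_zero, mul_ite, mul_one, mul_zero] at h3
  rw [Finset.sum_ite_eq (Finset.range d) 0, if_pos (Finset.mem_range.2 hd0)] at h3
  have h4 : r - m 0 = 0 := h3
  rw [sub_eq_zero.1 h4]
  exact hmS 0

end Descent

section DenseSubfield

theorem isAlgebraic_of_isAlgebraic_algebraicClosure {Q : Type*} [Field Q] {F κ : Subfield Q}
    (hκ : ∀ y, y ∈ κ ↔ IsAlgebraic F y) {y : Q} (hy : IsAlgebraic κ y) : IsAlgebraic F y := by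
  have hF : F ≤ κ := fun c hc => (hκ c).2 (isAlgebraic_algebraMap (⟨c, hc⟩ : F))
  let _ : Algebra F κ := (Subfield.inclusion hF).toAlgebra
  have : IsScalarTower F κ Q := IsScalarTower.of_algebraMap_eq fun _ => rfl
  have : Algebra.IsAlgebraic F κ := ⟨fun x => by
    have h1 : IsAlgebraic F (algebraMap κ Q x) := (hκ _).1 x.2
    exact (isAlgebraic_algebraMap_iff (algebraMap κ Q).injective).1 h1⟩
  exact hy.restrictScalars F

theorem IsAlgebraic.mono_subfield {Q : Type*} [Field Q] {F κ : Subfield Q} (hF : F ≤ κ) {y : Q}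
    (hy : IsAlgebraic F y) : IsAlgebraic κ y := by
  let _ : Algebra F κ := (Subfield.inclusion hF).toAlgebra
  have : IsScalarTower F κ Q := IsScalarTower.of_algebraMap_eq fun _ => rfl
  exact hy.tower_top κ

theorem derivation_mem_adjoin_of_mem {Q : Type*} [Field Q] [CharZero Q] (Θ : Derivation ℤ Q Q)
    {F : Subfield Q} (hF : ∀ c ∈ F, Θ c ∈ F) {b : Q} (hb : IsAlgebraic F b) {x : Q}
    (hx : x ∈ IntermediateField.adjoin F {b}) : Θ x ∈ IntermediateField.adjoin F {b} := by
  have hfd := IntermediateField.adjoin.finiteDimensional hb.isIntegral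
  have hx' : IsAlgebraic F x :=
    (Algebra.IsAlgebraic.isAlgebraic (R := F) (⟨x, hx⟩ : IntermediateField.adjoin F {b})).algebraMap
  have h1 := derivation_mem_adjoin Θ hF hx'
  exact (IntermediateField.adjoin_simple_le_iff.2 hx) h1

theorem exists_mem_norm_sub_lt {Q : Type*} [NormedField Q] {M : Subfield Q}
    (hM : Dense (M : Set Q)) {y : Q} (hy : y ≠ 0) :
    ∃ m ∈ M, ‖m - y‖ < ‖y‖ := by
  obtain ⟨m, hm, hlt⟩ := Metric.mem_closure_iff.1 (hM y) ‖y‖ (norm_pos_iff.2 hy)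
  exact ⟨m, hm, by rwa [dist_eq_norm, norm_sub_rev] at hlt⟩

variable {Q : Type*} [NormedField Q] [IsUltrametricDist Q]

theorem norm_eq_one_of_isAlgebraic {F : Subfield Q} (hF1 : ∀ c ∈ F, c ≠ 0 → ‖c‖ = 1) {y : Q}
    (hy0 : y ≠ 0) (hy : IsAlgebraic F y) : ‖y‖ = 1 := by
  obtain ⟨n, hn, a, ha, h⟩ := exists_norm_pow_eq hy0 hy
  have h1 : ‖a‖ = 1 := hF1 a a.2 (by simpa using ha)
  rw [h1] at h
  exact (pow_eq_one_iff_of_nonneg (norm_nonneg y) hn.ne').1 h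

theorem mem_span_of_isAlgebraic_of_dense [CompleteSpace Q] [CharZero Q] (Θ : Derivation ℤ Q Q)
    (hΘ : ∀ h, ‖Θ h‖ ≤ ‖h‖) {M F : Subfield Q} (hM : Dense (M : Set Q))
    (hΘM : ∀ h ∈ M, ‖h‖ ≠ 1 → ‖Θ h‖ = ‖h‖) (hFM : F ≤ M) (hF1 : ∀ c ∈ F, c ≠ 0 → ‖c‖ = 1)
    (hΘF : ∀ c ∈ F, Θ c ∈ F) (hcl : ∀ y ∈ M, IsAlgebraic F y → y ∈ F) {T : Set Q}
    (hTM : ∀ t ∈ T, t ∈ M) (hT0 : ∀ t ∈ T, t ≠ 0) (hT1 : 1 ∈ T)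
    (hTmul : ∀ t ∈ T, ∀ t' ∈ T, t * t' ∈ T) (hTinv : ∀ t ∈ T, t⁻¹ ∈ T)
    (hTΘ : ∀ t ∈ T, ∃ c ∈ F, Θ t = c * t) (hTF : ∀ t ∈ T, ‖t‖ = 1 → t ∈ F)
    (hdiv : ∀ y ∈ M, y ≠ 0 → ∀ n : ℕ, 0 < n → ∀ t ∈ T, ‖y‖ ^ n = ‖t‖ → ∃ t' ∈ T, ‖t'‖ = ‖y‖)
    (hnt : ∃ t ∈ T, ‖t‖ ≠ 1) (U : Submodule F Q) (hUM : ∀ u ∈ U, u ∈ M)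
    (hU : ∀ u ∈ U, Θ u ∈ U) {ε : ℝ} (hε : 0 < ε) (hUε : ∀ u ∈ U, u ≠ 0 → ε ≤ ‖u‖) {g : Q}
    (hgU : g ∈ U) (hg : IsAlgebraic (Subfield.closure ((F : Set Q) ∪ T)) g) :
    g ∈ Submodule.span F T := by
  set κ : Subfield Q := (algebraicClosure F Q).toSubfield with hκdef
  have hκ : ∀ y, y ∈ κ ↔ IsAlgebraic F y := fun y => mem_algebraicClosure_iff
  have hFκ : F ≤ κ := fun c hc => (hκ c).2 (isAlgebraic_algebraMap (⟨c, hc⟩ : F))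
  have hκ1 : ∀ c ∈ κ, c ≠ 0 → ‖c‖ = 1 := fun c hc h0 =>
    norm_eq_one_of_isAlgebraic hF1 h0 ((hκ c).1 hc)
  have hΘκ : ∀ c ∈ κ, Θ c ∈ κ := fun c hc => by
    have hfd := IntermediateField.adjoin.finiteDimensional ((hκ c).1 hc).isIntegral
    have h1 := derivation_mem_adjoin Θ hΘF ((hκ c).1 hc)
    exact (hκ _).2 (Algebra.IsAlgebraic.isAlgebraic (R := F)
      (⟨_, h1⟩ : IntermediateField.adjoin F {c})).algebraMap
  set W : Set Q := {y | ∃ c ∈ κ, c ≠ 0 ∧ ∃ t ∈ T, y = c * t} with hW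
  have hTW : ∀ t ∈ T, t ∈ W := fun t ht => ⟨1, κ.one_mem, one_ne_zero, t, ht, (one_mul t).symm⟩
  have hW' : IsTermGroup κ W :=
    { ne_zero := by
        rintro w ⟨c, hc, hc0, t, ht, rfl⟩
        exact mul_ne_zero hc0 (hT0 t ht)
      mul_mem := by
        rintro w ⟨c, hc, hc0, t, ht, rfl⟩ w' ⟨c', hc', hc0', t', ht', rfl⟩
        exact ⟨c * c', κ.mul_mem hc hc', mul_ne_zero hc0 hc0', t * t', hTmul t ht t' ht', by ring⟩
      inv_mem := by
        rintro w ⟨c, hc, hc0, t, ht, rfl⟩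
        exact ⟨c⁻¹, κ.inv_mem hc, inv_ne_zero hc0, t⁻¹, hTinv t ht, by rw [mul_inv]⟩
      const_mem := fun c hc hc0 => ⟨c, hc, hc0, 1, hT1, (mul_one c).symm⟩
      mem_const := by
        rintro w ⟨c, hc, hc0, t, ht, rfl⟩ h1
        rw [norm_mul, hκ1 c hc hc0, one_mul] at h1
        exact κ.mul_mem hc (hFκ (hTF t ht h1))
      norm_const := hκ1 }
  have hconst : ∀ h, Θ h = 0 → h ≠ 0 → ‖h‖ = 1 := by
    intro h hh h0
    by_contra h1
    obtain ⟨m, hm, hlt⟩ := exists_mem_norm_sub_lt hM h0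
    have hmh := norm_eq_of_norm_sub_lt hlt
    have h2 := hΘM m hm (hmh ▸ h1)
    have h3 := hΘ (m - h)
    rw [map_sub, hh, sub_zero, h2, hmh] at h3
    exact absurd hlt h3.not_gt
  have hdivW : ∀ y : Q, y ≠ 0 → ∀ n : ℕ, 0 < n → ∀ w ∈ W, ‖y‖ ^ n = ‖w‖ →
      ∃ w' ∈ W, ‖w'‖ = ‖y‖ := by
    rintro y hy n hn w ⟨c, hc, hc0, t, ht, rfl⟩ h1
    rw [norm_mul, hκ1 c hc hc0, one_mul] at h1
    obtain ⟨m, hm, hlt⟩ := exists_mem_norm_sub_lt hM hy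
    have hmh := norm_eq_of_norm_sub_lt hlt
    obtain ⟨t', ht', h2⟩ := hdiv m hm (norm_ne_zero_iff.1 (hmh ▸ norm_ne_zero_iff.2 hy)) n hn t ht
      (hmh ▸ h1)
    exact ⟨t', hTW t' ht', h2.trans hmh⟩
  have hle : Subfield.closure ((F : Set Q) ∪ T) ≤ hW'.subfield := by
    refine Subfield.closure_le.2 (Set.union_subset (fun c hc => ?_) fun t ht => ?_)
    · by_cases h0 : c = 0
      · rw [h0]; exact zero_mem _
      · exact hW'.subset_subfield (hW'.const_mem c (hFκ hc) h0)
    · exact hW'.subset_subfield (hTW t ht)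
  have hgA : g ∈ hW'.subfield := by
    refine hW'.mem_subfield_of_isAlgebraic
      (fun y hy => (hκ y).2 (isAlgebraic_of_isAlgebraic_algebraicClosure hκ hy)) hdivW ?_
      (hg.mono_subfield hle)
    obtain ⟨t, ht, h1⟩ := hnt
    exact ⟨t, hTW t ht, h1⟩
  have hgcl : g ∈ AddSubgroup.closure W := by
    refine hW'.mem_closure_of_mem_stable hΘ hconst hFκ ?_ ?_ U hU hε hUε hgA hgU
    · rintro w ⟨c, hc, hc0, t, ht, rfl⟩
      obtain ⟨f, hf, hft⟩ := hTΘ t ht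
      refine ⟨f + Θ c / c, κ.add_mem (hFκ hf) (κ.div_mem (hΘκ c hc) hc), ?_⟩
      rw [Derivation.leibniz, hft, smul_eq_mul, smul_eq_mul]
      field_simp
    · rintro w ⟨c, hc, hc0, t, ht, rfl⟩
      obtain ⟨f, hf, hft⟩ := hTΘ t ht
      have hfd := IntermediateField.adjoin.finiteDimensional ((hκ c).1 hc).isIntegral
      let L := IntermediateField.adjoin F {c}
      refine ⟨(Subalgebra.toSubmodule L.toSubalgebra).map (LinearMap.mulRight F t), ?_, ?_, ?_⟩
      · have : FiniteDimensional F (Subalgebra.toSubmodule L.toSubalgebra) := hfd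
        infer_instance
      · exact ⟨c, IntermediateField.mem_adjoin_simple_self F c, rfl⟩
      · rintro _ ⟨x, hx, rfl⟩
        have hx' : x ∈ L := hx
        refine ⟨Θ x + f * x, L.add_mem (derivation_mem_adjoin_of_mem Θ hΘF ((hκ c).1 hc) hx')
          (L.mul_mem (L.algebraMap_mem ⟨f, hf⟩) hx'), ?_⟩
        simp only [LinearMap.mulRight_apply]
        rw [Derivation.leibniz, hft, smul_eq_mul, smul_eq_mul]
        ring
  refine mem_of_mem_closure_mul hFM hcl (Submodule.span F T) ?_ (hUM g hgU) ?_
  · intro s hs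
    induction hs using Submodule.span_induction with
    | mem x hx => exact hTM x hx
    | zero => exact M.zero_mem
    | add x y _ _ hx hy => exact M.add_mem hx hy
    | smul a x _ hx => exact M.mul_mem (hFM a.2) hx
  · refine AddSubgroup.closure_mono ?_ hgcl
    rintro w ⟨c, hc, _, t, ht, rfl⟩
    exact ⟨c, (hκ c).1 hc, t, Submodule.subset_span ht, rfl⟩

end DenseSubfield

section Completion

theorem isAlgebraic_map_subfield_iff {M Q : Type*} [Field M] [Field Q] (ι : M →+* Q)
    (A : Subfield M) (y : M) : IsAlgebraic (A.map ι) (ι y) ↔ IsAlgebraic A y := by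
  let f : A →+* A.map ι :=
    (ι.comp A.subtype).codRestrict (A.map ι) fun x => ⟨x, x.2, rfl⟩
  have hf : Function.Surjective f := by
    rintro ⟨_, x, hx, rfl⟩
    exact ⟨⟨x, hx⟩, rfl⟩
  have hc : (algebraMap (A.map ι) Q).comp f = ι.comp (algebraMap A M) := rfl
  exact ⟨fun h => h.of_ringHom_of_comp_eq f ι hf ι.injective hc,
    fun h => h.ringHom_of_comp_eq f ι f.injective hc⟩

variable {M : Type*} [NormedField M]

theorem isUltrametricDist_completion [IsUltrametricDist M] :
    IsUltrametricDist (UniformSpace.Completion M) := by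
  refine IsUltrametricDist.isUltrametricDist_of_forall_norm_add_le_max_norm fun x y => ?_
  refine UniformSpace.Completion.induction_on₂ x y (isClosed_le (by fun_prop) (by fun_prop))
    fun a b => ?_
  rw [← UniformSpace.Completion.coe_add]
  simp only [UniformSpace.Completion.norm_coe]
  exact IsUltrametricDist.norm_add_le_max a b

/-- Derivations of a field `Q`, with the canonical `ℤ`-algebra structure on `Q`. -/
abbrev IntDerivation (Q : Type*) [Field Q] := Derivation ℤ Q Q

/-- The derivation given by an additive map satisfying the Leibniz rule. -/
def IntDerivation.ofAddMonoidHom {Q : Type*} [Field Q] (D : Q →+ Q)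
    (h : ∀ a b, D (a * b) = a * D b + b * D a) : IntDerivation Q :=
  Derivation.mk' D.toIntLinearMap h

theorem continuous_of_norm_derivation_le {Θ : Derivation ℤ M M} (hΘ : ∀ h, ‖Θ h‖ ≤ ‖h‖) :
    Continuous Θ.toLinearMap.toAddMonoidHom :=
  AddMonoidHomClass.continuous_of_bound _ 1 fun x => by rw [one_mul]; exact hΘ x

/-- The continuous extension of a norm-nonincreasing derivation to the completion. -/
noncomputable def completionDerivation (Θ : Derivation ℤ M M) (hΘ : ∀ h, ‖Θ h‖ ≤ ‖h‖) :
    IntDerivation (UniformSpace.Completion M) :=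
  IntDerivation.ofAddMonoidHom
    (Θ.toLinearMap.toAddMonoidHom.completion (continuous_of_norm_derivation_le hΘ)) fun a b => by
    have hc' := Θ.toLinearMap.toAddMonoidHom.continuous_completion
      (continuous_of_norm_derivation_le hΘ)
    refine UniformSpace.Completion.induction_on₂ a b
      (isClosed_eq (by fun_prop) (by fun_prop)) fun a b => ?_
    rw [← UniformSpace.Completion.coe_mul]
    simp only [AddMonoidHom.completion_coe]
    rw [← UniformSpace.Completion.coe_mul, ← UniformSpace.Completion.coe_mul,
      ← UniformSpace.Completion.coe_add]
    exact congrArg _ (Θ.leibniz a b)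

theorem completionDerivation_coe (Θ : Derivation ℤ M M) (hΘ : ∀ h, ‖Θ h‖ ≤ ‖h‖) (m : M) :
    completionDerivation Θ hΘ (m : UniformSpace.Completion M) = (Θ m : M) :=
  AddMonoidHom.completion_coe Θ.toLinearMap.toAddMonoidHom (continuous_of_norm_derivation_le hΘ) m

theorem norm_completionDerivation_le (Θ : Derivation ℤ M M) (hΘ : ∀ h, ‖Θ h‖ ≤ ‖h‖)
    (q : UniformSpace.Completion M) : ‖completionDerivation Θ hΘ q‖ ≤ ‖q‖ := by
  have hc : Continuous (completionDerivation Θ hΘ) :=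
    AddMonoidHom.continuous_completion Θ.toLinearMap.toAddMonoidHom
      (continuous_of_norm_derivation_le hΘ)
  refine UniformSpace.Completion.induction_on q (isClosed_le (by fun_prop) (by fun_prop))
    fun a => ?_
  rw [completionDerivation_coe, UniformSpace.Completion.norm_coe, UniformSpace.Completion.norm_coe]
  exact hΘ a

variable [IsUltrametricDist M] [CharZero M]

theorem mem_span_of_isAlgebraic_closure (Θ : Derivation ℤ M M)
    (hΘ : ∀ h, ‖Θ h‖ ≤ ‖h‖) (hΘM : ∀ h, ‖h‖ ≠ 1 → ‖Θ h‖ = ‖h‖) {F : Subfield M}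
    (hF1 : ∀ c ∈ F, c ≠ 0 → ‖c‖ = 1)
    (hΘF : ∀ c ∈ F, Θ c ∈ F) (hcl : ∀ y, IsAlgebraic F y → y ∈ F) {T : Set M}
    (hT0 : ∀ t ∈ T, t ≠ 0) (hT1 : 1 ∈ T)
    (hTmul : ∀ t ∈ T, ∀ t' ∈ T, t * t' ∈ T) (hTinv : ∀ t ∈ T, t⁻¹ ∈ T)
    (hTΘ : ∀ t ∈ T, ∃ c ∈ F, Θ t = c * t) (hTF : ∀ t ∈ T, ‖t‖ = 1 → t ∈ F)
    (hdiv : ∀ y : M, y ≠ 0 → ∀ n : ℕ, 0 < n → ∀ t ∈ T, ‖y‖ ^ n = ‖t‖ → ∃ t' ∈ T, ‖t'‖ = ‖y‖)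
    (hnt : ∃ t ∈ T, ‖t‖ ≠ 1) (U : Submodule F M)
    (hU : ∀ u ∈ U, Θ u ∈ U) {ε : ℝ} (hε : 0 < ε) (hUε : ∀ u ∈ U, u ≠ 0 → ε ≤ ‖u‖) {g : M}
    (hgU : g ∈ U) (hg : IsAlgebraic (Subfield.closure ((F : Set M) ∪ T)) g) :
    g ∈ Submodule.span F T := by
  let Q := UniformSpace.Completion M
  let ι : M →+* Q := UniformSpace.Completion.coeRingHom
  have hι : ∀ m, ‖ι m‖ = ‖m‖ := UniformSpace.Completion.norm_coe
  have hιΘ : ∀ m, completionDerivation Θ hΘ (ι m) = ι (Θ m) := completionDerivation_coe Θ hΘ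
  have : IsUltrametricDist Q := isUltrametricDist_completion
  have : CharZero Q := charZero_of_injective_ringHom ι.injective
  let S : Submodule (F.map ι) Q :=
    { (Submodule.toAddSubgroup U).map ι.toAddMonoidHom with
      smul_mem' := by
        rintro ⟨_, c, hc, rfl⟩ _ ⟨u, hu, rfl⟩
        exact ⟨c * u, U.smul_mem ⟨c, hc⟩ hu, map_mul ι c u⟩ }
  have hS : ∀ x, x ∈ S ↔ ∃ u ∈ U, ι u = x := fun x => Iff.rfl
  have main : ι g ∈ Submodule.span (F.map ι) (ι '' T) := by
    refine mem_span_of_isAlgebraic_of_dense (completionDerivation Θ hΘ)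
      (norm_completionDerivation_le Θ hΘ) (M := ι.fieldRange) (F := F.map ι) ?_ ?_ ?_ ?_ ?_ ?_
      ?_ ?_ ?_ ?_ ?_ ?_ ?_ ?_ ?_ S ?_ ?_ hε ?_ ⟨g, hgU, rfl⟩ ?_
    · exact UniformSpace.Completion.denseRange_coe
    · rintro _ ⟨m, rfl⟩ h1
      rw [hιΘ, hι, hι]
      exact hΘM m (hι m ▸ h1)
    · rintro _ ⟨m, _, rfl⟩
      exact ⟨m, rfl⟩
    · rintro _ ⟨m, hm, rfl⟩ h0
      rw [hι]
      exact hF1 m hm fun h => h0 (by rw [h, map_zero])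
    · rintro _ ⟨m, hm, rfl⟩
      rw [hιΘ]
      exact ⟨_, hΘF m hm, rfl⟩
    · rintro _ ⟨m, rfl⟩ h
      exact ⟨m, hcl m ((isAlgebraic_map_subfield_iff ι F m).1 h), rfl⟩
    · rintro _ ⟨m, _, rfl⟩
      exact ⟨m, rfl⟩
    · rintro _ ⟨m, hm, rfl⟩
      exact (map_ne_zero ι).2 (hT0 m hm)
    · exact ⟨1, hT1, map_one ι⟩
    · rintro _ ⟨m, hm, rfl⟩ _ ⟨m', hm', rfl⟩
      exact ⟨m * m', hTmul m hm m' hm', map_mul ι m m'⟩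
    · rintro _ ⟨m, hm, rfl⟩
      exact ⟨m⁻¹, hTinv m hm, map_inv₀ ι m⟩
    · rintro _ ⟨m, hm, rfl⟩
      obtain ⟨c, hc, h⟩ := hTΘ m hm
      exact ⟨ι c, ⟨c, hc, rfl⟩, by rw [hιΘ, h, map_mul]⟩
    · rintro _ ⟨m, hm, rfl⟩ h
      exact ⟨m, hTF m hm (hι m ▸ h), rfl⟩
    · rintro _ ⟨y, rfl⟩ h0 n hn _ ⟨t, ht, rfl⟩ h
      rw [hι, hι] at h
      obtain ⟨t', ht', h'⟩ := hdiv y (fun h => h0 (by rw [h, map_zero])) n hn t ht h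
      exact ⟨ι t', ⟨t', ht', rfl⟩, by rw [hι, hι, h']⟩
    · obtain ⟨t, ht, h⟩ := hnt
      exact ⟨ι t, ⟨t, ht, rfl⟩, by rwa [hι]⟩
    · rintro _ ⟨u, _, rfl⟩
      exact ⟨u, rfl⟩
    · rintro _ ⟨u, hu, rfl⟩
      exact ⟨Θ u, hU u hu, (hιΘ u).symm⟩
    · rintro _ ⟨u, hu, rfl⟩ h0
      exact (hUε u hu fun h => h0 (by rw [h, map_zero])).trans_eq (hι u).symm
    · have e : Subfield.closure (((F.map ι : Subfield Q) : Set Q) ∪ ι '' T) =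
          (Subfield.closure ((F : Set M) ∪ T)).map ι := by
        rw [ι.map_field_closure, Set.image_union, Subfield.coe_map]
      rw [e]
      exact (isAlgebraic_map_subfield_iff ι _ g).2 hg
  have key : ∀ x ∈ Submodule.span (F.map ι) (ι '' T), ∃ s ∈ Submodule.span F T, ι s = x := by
    intro x hx
    induction hx using Submodule.span_induction with
    | mem x hx =>
      obtain ⟨t, ht, rfl⟩ := hx
      exact ⟨t, Submodule.subset_span ht, rfl⟩
    | zero => exact ⟨0, zero_mem _, map_zero ι⟩
    | add x y _ _ hx hy =>
      obtain ⟨s, hs, rfl⟩ := hx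
      obtain ⟨s', hs', rfl⟩ := hy
      exact ⟨s + s', add_mem hs hs', map_add ι s s'⟩
    | smul a x _ hx =>
      obtain ⟨s, hs, rfl⟩ := hx
      obtain ⟨_, c, hc, rfl⟩ := a
      exact ⟨c * s, Submodule.smul_mem _ (⟨c, hc⟩ : F) hs, map_mul ι c s⟩
  obtain ⟨s, hs, h⟩ := key _ main
  rwa [← ι.injective h]

end Completion

section SubfieldAbsoluteValue

theorem mem_span_of_isAlgebraic_subfield {E : Type*} [Field E] [CharZero E] (Θ : Derivation ℤ E E)
    (M : Subfield E) (v : E → ℝ) (hv0 : v 0 = 0) (hvpos : ∀ h ∈ M, h ≠ 0 → 0 < v h)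
    (hvmul : ∀ a ∈ M, ∀ b ∈ M, v (a * b) = v a * v b)
    (hvadd : ∀ a ∈ M, ∀ b ∈ M, v (a + b) ≤ max (v a) (v b))
    (hΘM : ∀ h ∈ M, Θ h ∈ M) (hΘ : ∀ h ∈ M, v (Θ h) ≤ v h)
    (hΘ' : ∀ h ∈ M, v h ≠ 1 → v (Θ h) = v h) {F : Subfield E} (hFM : F ≤ M)
    (hF1 : ∀ c ∈ F, c ≠ 0 → v c = 1) (hΘF : ∀ c ∈ F, Θ c ∈ F)
    (hcl : ∀ y ∈ M, IsAlgebraic F y → y ∈ F) {T : Set E} (hTM : ∀ t ∈ T, t ∈ M)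
    (hT0 : ∀ t ∈ T, t ≠ 0) (hT1 : 1 ∈ T)
    (hTmul : ∀ t ∈ T, ∀ t' ∈ T, t * t' ∈ T) (hTinv : ∀ t ∈ T, t⁻¹ ∈ T)
    (hTΘ : ∀ t ∈ T, ∃ c ∈ F, Θ t = c * t) (hTF : ∀ t ∈ T, v t = 1 → t ∈ F)
    (hdiv : ∀ y ∈ M, y ≠ 0 → ∀ n : ℕ, 0 < n → ∀ t ∈ T, v y ^ n = v t → ∃ t' ∈ T, v t' = v y)
    (hnt : ∃ t ∈ T, v t ≠ 1) (U : Submodule F E) (hUM : ∀ u ∈ U, u ∈ M)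
    (hU : ∀ u ∈ U, Θ u ∈ U) {ε : ℝ} (hε : 0 < ε) (hUε : ∀ u ∈ U, u ≠ 0 → ε ≤ v u) {g : E}
    (hgU : g ∈ U) (hg : IsAlgebraic (Subfield.closure ((F : Set E) ∪ T)) g) :
    g ∈ Submodule.span F T := by
  let w : AbsoluteValue M ℝ :=
    { toFun := fun m => v m
      map_mul' := fun a b => hvmul a a.2 b b.2
      nonneg' := fun a => by
        by_cases h : (a : E) = 0
        · simp only [h, hv0, le_refl]
        · exact (hvpos a a.2 h).le
      eq_zero' := fun a => by
        refine ⟨fun h => ?_, fun h => by simp only [h, ZeroMemClass.coe_zero, hv0]⟩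
        by_contra h0
        exact (hvpos a a.2 fun h1 => h0 (Subtype.ext h1)).ne' h
      add_le' := fun a b => by
        have nn : ∀ a : M, 0 ≤ v a := fun a => by
          by_cases h : (a : E) = 0
          · simp only [h, hv0, le_refl]
          · exact (hvpos a a.2 h).le
        exact (hvadd a a.2 b b.2).trans (max_le_add_of_nonneg (nn a) (nn b)) }
  let _ := w.toNormedField
  have hnorm : ∀ m : M, ‖m‖ = v m := fun m => rfl
  have : IsUltrametricDist M :=
    IsUltrametricDist.isUltrametricDist_of_forall_norm_add_le_max_norm
      fun a b => hvadd a a.2 b b.2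
  let Θ' : IntDerivation M := IntDerivation.ofAddMonoidHom
    { toFun := fun m => ⟨Θ m, hΘM m m.2⟩
      map_zero' := Subtype.ext (map_zero Θ)
      map_add' := fun a b => Subtype.ext (map_add Θ (a : E) b) }
    fun a b => Subtype.ext (Θ.leibniz (a : E) b)
  have hΘ'c : ∀ m : M, (Θ' m : E) = Θ m := fun m => rfl
  have hFmap : (F.comap M.subtype).map M.subtype = F := by
    ext x
    exact ⟨by rintro ⟨m, hm, rfl⟩; exact hm, fun hx => ⟨⟨x, hFM hx⟩, hx, rfl⟩⟩
  let U' : Submodule (F.comap M.subtype) M :=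
    { (Submodule.toAddSubgroup U).comap M.subtype.toAddMonoidHom with
      smul_mem' := fun c x hx => U.smul_mem (⟨c, c.2⟩ : F) hx }
  have hgM := hUM g hgU
  have main : (⟨g, hgM⟩ : M) ∈ Submodule.span (F.comap M.subtype) (M.subtype ⁻¹' T) := by
    refine mem_span_of_isAlgebraic_closure Θ' ?_ ?_ ?_ ?_ ?_ ?_ ?_ ?_ ?_ ?_ ?_ ?_ ?_ U' ?_ hε ?_
      hgU ?_
    · exact fun h => hΘ h h.2
    · exact fun h => hΘ' h h.2
    · exact fun c hc h0 => hF1 c hc fun h => h0 (Subtype.ext h)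
    · exact fun c hc => hΘF c hc
    · intro y hy
      refine hcl y y.2 ?_
      have h1 := (isAlgebraic_map_subfield_iff M.subtype _ y).2 hy
      rwa [hFmap] at h1
    · exact fun t ht h => hT0 t ht (congrArg Subtype.val h)
    · exact hT1
    · exact fun t ht t' ht' => hTmul t ht t' ht'
    · exact fun t ht => hTinv t ht
    · intro t ht
      obtain ⟨c, hc, h⟩ := hTΘ t ht
      exact ⟨⟨c, hFM hc⟩, hc, Subtype.ext h⟩
    · exact fun t ht h => hTF t ht h
    · intro y h0 n hn t ht h
      obtain ⟨t', ht', h'⟩ := hdiv y y.2 (fun h => h0 (Subtype.ext h)) n hn t ht h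
      exact ⟨⟨t', hTM t' ht'⟩, ht', h'⟩
    · obtain ⟨t, ht, h⟩ := hnt
      exact ⟨⟨t, hTM t ht⟩, ht, h⟩
    · exact fun u hu => hU u hu
    · exact fun u hu h0 => hUε u hu fun h => h0 (Subtype.ext h)
    · refine (isAlgebraic_map_subfield_iff M.subtype _ _).1 ?_
      have e : (Subfield.closure (((F.comap M.subtype : Subfield M) : Set M) ∪
          M.subtype ⁻¹' T)).map M.subtype = Subfield.closure ((F : Set E) ∪ T) := by
        rw [M.subtype.map_field_closure, Set.image_union, ← Subfield.coe_map, hFmap]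
        congr 2
        ext t
        exact ⟨by rintro ⟨m, hm, rfl⟩; exact hm, fun ht => ⟨⟨t, hTM t ht⟩, ht, rfl⟩⟩
      rw [e]
      exact hg
  have key : ∀ x ∈ Submodule.span (F.comap M.subtype) (M.subtype ⁻¹' T),
      (x : E) ∈ Submodule.span F T := by
    intro x hx
    induction hx using Submodule.span_induction with
    | mem x hx => exact Submodule.subset_span hx
    | zero => exact zero_mem _
    | add x y _ _ hx hy => exact add_mem hx hy
    | smul a x _ hx => exact Submodule.smul_mem _ (⟨a, a.2⟩ : F) hx
  exact key _ main

end SubfieldAbsoluteValue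

section RatFuncEuler

theorem IntDerivation.zpow_of_eq_self {Q : Type*} [Field Q] (D : IntDerivation Q) {x : Q}
    (hx : x ≠ 0) (h : D x = x) (k : ℤ) : D (x ^ k) = k * x ^ k := by
  rw [Derivation.leibniz_zpow, h, smul_eq_mul, ← zpow_add_one₀ hx, sub_add_cancel, zsmul_eq_mul]

variable {K : Type*} [Field K]

/-- The Euler operator `X d/dX` on rational functions, as a function. -/
noncomputable def ratFuncEulerFun (f : RatFunc K) : RatFunc K :=
  algebraMap K[X] (RatFunc K) (X * (derivative f.num * f.denom - f.num * derivative f.denom)) /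
    algebraMap K[X] (RatFunc K) (f.denom ^ 2)

theorem ratFuncEulerFun_div (p : K[X]) {q : K[X]} (hq : q ≠ 0) :
    ratFuncEulerFun (algebraMap K[X] (RatFunc K) p / algebraMap K[X] (RatFunc K) q) =
      algebraMap K[X] (RatFunc K) (X * (derivative p * q - p * derivative q)) /
        algebraMap K[X] (RatFunc K) (q ^ 2) := by
  generalize hf : algebraMap K[X] (RatFunc K) p / algebraMap K[X] (RatFunc K) q = f
  have hq' : algebraMap K[X] (RatFunc K) q ≠ 0 := RatFunc.algebraMap_ne_zero hq
  have hd := f.denom_ne_zero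
  have hd' : algebraMap K[X] (RatFunc K) f.denom ≠ 0 := RatFunc.algebraMap_ne_zero hd
  have h1 : f.num * q = p * f.denom := by
    apply RatFunc.algebraMap_injective K
    have h3 := f.num_div_denom.trans hf.symm
    rw [div_eq_div_iff hd' hq'] at h3
    rwa [map_mul, map_mul]
  have h2 := congrArg derivative h1
  rw [derivative_mul, derivative_mul] at h2
  have h4 : X * (derivative f.num * f.denom - f.num * derivative f.denom) * q ^ 2 =
      X * (derivative p * q - p * derivative q) * f.denom ^ 2 := by
    linear_combination
      X * q * f.denom * h2 - X * (q * derivative f.denom + f.denom * derivative q) * h1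
  rw [ratFuncEulerFun, div_eq_div_iff (RatFunc.algebraMap_ne_zero (pow_ne_zero 2 hd))
    (RatFunc.algebraMap_ne_zero (pow_ne_zero 2 hq)), ← map_mul, ← map_mul, h4]

theorem ratFuncEulerFun_add (f g : RatFunc K) :
    ratFuncEulerFun (f + g) = ratFuncEulerFun f + ratFuncEulerFun g := by
  have hf := RatFunc.algebraMap_ne_zero f.denom_ne_zero
  have hg := RatFunc.algebraMap_ne_zero g.denom_ne_zero
  have e : f + g = algebraMap K[X] (RatFunc K) (f.num * g.denom + g.num * f.denom) /
      algebraMap K[X] (RatFunc K) (f.denom * g.denom) := by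
    conv_lhs => rw [← f.num_div_denom, ← g.num_div_denom]
    simp only [map_mul, map_add]
    field_simp
  rw [e, ratFuncEulerFun_div _ (mul_ne_zero f.denom_ne_zero g.denom_ne_zero)]
  simp only [ratFuncEulerFun, map_mul, map_add, map_sub, map_pow, derivative_mul]
  field_simp
  ring

theorem ratFuncEulerFun_mul (f g : RatFunc K) :
    ratFuncEulerFun (f * g) = f * ratFuncEulerFun g + g * ratFuncEulerFun f := by
  have hf := RatFunc.algebraMap_ne_zero f.denom_ne_zero
  have hg := RatFunc.algebraMap_ne_zero g.denom_ne_zero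
  have e : f * g = algebraMap K[X] (RatFunc K) (f.num * g.num) /
      algebraMap K[X] (RatFunc K) (f.denom * g.denom) := by
    conv_lhs => rw [← f.num_div_denom, ← g.num_div_denom]
    simp only [map_mul]
    field_simp
  have e1 : f * ratFuncEulerFun g + g * ratFuncEulerFun f =
      algebraMap K[X] (RatFunc K) f.num / algebraMap K[X] (RatFunc K) f.denom *
        ratFuncEulerFun g +
      algebraMap K[X] (RatFunc K) g.num / algebraMap K[X] (RatFunc K) g.denom *
        ratFuncEulerFun f := by
    rw [f.num_div_denom, g.num_div_denom]
  rw [e, ratFuncEulerFun_div _ (mul_ne_zero f.denom_ne_zero g.denom_ne_zero), e1]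
  simp only [ratFuncEulerFun, map_mul, map_add, map_sub, map_pow, derivative_mul]
  field_simp
  ring

/-- The Euler derivation `X d/dX` on rational functions. -/
noncomputable def ratFuncEuler : IntDerivation (RatFunc K) :=
  IntDerivation.ofAddMonoidHom (AddMonoidHom.mk' ratFuncEulerFun ratFuncEulerFun_add)
    ratFuncEulerFun_mul

theorem ratFuncEuler_div (p : K[X]) {q : K[X]} (hq : q ≠ 0) :
    ratFuncEuler (algebraMap K[X] (RatFunc K) p / algebraMap K[X] (RatFunc K) q) =
      algebraMap K[X] (RatFunc K) (X * (derivative p * q - p * derivative q)) /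
        algebraMap K[X] (RatFunc K) (q ^ 2) := ratFuncEulerFun_div p hq

theorem ratFuncEuler_algebraMap (p : K[X]) :
    ratFuncEuler (algebraMap K[X] (RatFunc K) p) =
      algebraMap K[X] (RatFunc K) (X * derivative p) := by
  have := ratFuncEuler_div p (one_ne_zero (α := K[X]))
  simpa using this

theorem ratFuncEuler_X : ratFuncEuler (RatFunc.X : RatFunc K) = RatFunc.X := by
  rw [← RatFunc.algebraMap_X, ratFuncEuler_algebraMap, derivative_X, mul_one]

theorem ratFuncEuler_C (c : K) : ratFuncEuler (RatFunc.C c) = 0 := by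
  rw [← RatFunc.algebraMap_C, ratFuncEuler_algebraMap, derivative_C, mul_zero, map_zero]

theorem ratFuncEuler_X_zpow (k : ℤ) :
    ratFuncEuler (RatFunc.X ^ k : RatFunc K) = k * (RatFunc.X : RatFunc K) ^ k :=
  ratFuncEuler.zpow_of_eq_self RatFunc.X_ne_zero ratFuncEuler_X k

theorem coeff_X_mul_derivative (p : K[X]) (i : ℕ) :
    (X * derivative p).coeff i = i * p.coeff i := by
  cases i with
  | zero => simp
  | succ i => rw [coeff_X_mul, coeff_derivative]; push_cast; ring

theorem natDegree_X_mul_derivative_le (p : K[X]) : (X * derivative p).natDegree ≤ p.natDegree := by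
  rw [natDegree_le_iff_coeff_eq_zero]
  intro i hi
  rw [coeff_X_mul_derivative, coeff_eq_zero_of_natDegree_lt hi, mul_zero]

theorem natDegree_eulerNum_le (p q : K[X]) :
    (X * (derivative p * q - p * derivative q)).natDegree ≤ p.natDegree + q.natDegree := by
  have e : X * (derivative p * q - p * derivative q) =
      X * derivative p * q - p * (X * derivative q) := by ring
  rw [e]
  refine (natDegree_sub_le _ _).trans (max_le ?_ ?_)
  · exact natDegree_mul_le.trans (Nat.add_le_add_right (natDegree_X_mul_derivative_le p) _)
  · exact natDegree_mul_le.trans (Nat.add_le_add_left (natDegree_X_mul_derivative_le q) _)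

theorem coeff_eulerNum (p q : K[X]) :
    (X * (derivative p * q - p * derivative q)).coeff (p.natDegree + q.natDegree) =
      ((p.natDegree : K) - q.natDegree) * (p.leadingCoeff * q.leadingCoeff) := by
  have e : X * (derivative p * q - p * derivative q) =
      X * derivative p * q - p * (X * derivative q) := by ring
  rw [e, coeff_sub, coeff_mul_add_eq_of_natDegree_le (natDegree_X_mul_derivative_le p) le_rfl,
    coeff_mul_add_eq_of_natDegree_le le_rfl (natDegree_X_mul_derivative_le q),
    coeff_X_mul_derivative, coeff_X_mul_derivative]
  simp only [leadingCoeff]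
  ring

theorem intDegree_algebraMap_div {p q : K[X]} (hp : p ≠ 0) (hq : q ≠ 0) :
    (algebraMap K[X] (RatFunc K) p / algebraMap K[X] (RatFunc K) q).intDegree =
      (p.natDegree : ℤ) - q.natDegree := by
  rw [RatFunc.intDegree_div (RatFunc.algebraMap_ne_zero hp) (RatFunc.algebraMap_ne_zero hq),
    RatFunc.intDegree_polynomial, RatFunc.intDegree_polynomial]

theorem intDegree_ratFuncEuler_le {f : RatFunc K} (hf : ratFuncEuler f ≠ 0) :
    (ratFuncEuler f).intDegree ≤ f.intDegree := by
  have hq := f.denom_ne_zero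
  have e := ratFuncEuler_div f.num hq
  rw [f.num_div_denom] at e
  have hn : X * (derivative f.num * f.denom - f.num * derivative f.denom) ≠ 0 := by
    intro h
    rw [h, map_zero, zero_div] at e
    exact hf e
  rw [e, intDegree_algebraMap_div hn (pow_ne_zero 2 hq), natDegree_pow, RatFunc.intDegree]
  have := natDegree_eulerNum_le f.num f.denom
  push_cast
  omega

theorem intDegree_ratFuncEuler_eq [CharZero K] {f : RatFunc K} (hf : f.intDegree ≠ 0) :
    ratFuncEuler f ≠ 0 ∧ (ratFuncEuler f).intDegree = f.intDegree := by
  have hf0 : f ≠ 0 := by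
    rintro rfl
    exact hf RatFunc.intDegree_zero
  have hq := f.denom_ne_zero
  have hp : f.num ≠ 0 := RatFunc.num_ne_zero hf0
  have hc := coeff_eulerNum f.num f.denom
  have hc0 : (X * (derivative f.num * f.denom - f.num * derivative f.denom)).coeff
      (f.num.natDegree + f.denom.natDegree) ≠ 0 := by
    rw [hc]
    refine mul_ne_zero (sub_ne_zero.2 fun h => hf ?_)
      (mul_ne_zero (leadingCoeff_ne_zero.2 hp) (leadingCoeff_ne_zero.2 hq))
    rw [RatFunc.intDegree, Nat.cast_injective h, sub_self]
  have hn : X * (derivative f.num * f.denom - f.num * derivative f.denom) ≠ 0 := by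
    intro h
    rw [h, coeff_zero] at hc0
    exact hc0 rfl
  have e := ratFuncEuler_div f.num hq
  rw [f.num_div_denom] at e
  have hd := le_antisymm (natDegree_eulerNum_le f.num f.denom) (le_natDegree_of_ne_zero hc0)
  rw [e]
  refine ⟨div_ne_zero (RatFunc.algebraMap_ne_zero hn)
    (RatFunc.algebraMap_ne_zero (pow_ne_zero 2 hq)), ?_⟩
  rw [intDegree_algebraMap_div hn (pow_ne_zero 2 hq), natDegree_pow, RatFunc.intDegree, hd]
  push_cast
  ring

end RatFuncEuler

section Height

variable {K : Type*} [Field K]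

/-- The height of a rational function: its degree as a map to the projective line. -/
noncomputable def ratHeight (f : RatFunc K) : ℕ := max f.num.natDegree f.denom.natDegree

theorem ratHeight_div_le (p : K[X]) {q : K[X]} (hq : q ≠ 0) :
    ratHeight (algebraMap K[X] (RatFunc K) p / algebraMap K[X] (RatFunc K) q) ≤
      max p.natDegree q.natDegree := by
  refine max_le_max ?_ (natDegree_le_of_dvd (RatFunc.denom_div_dvd p q) hq)
  by_cases hp : p = 0
  · simp [hp]
  · exact natDegree_le_of_dvd (RatFunc.num_div_dvd p hq) hp

theorem ratHeight_add_le (f g : RatFunc K) : ratHeight (f + g) ≤ ratHeight f + ratHeight g := by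
  have hf := RatFunc.algebraMap_ne_zero f.denom_ne_zero
  have hg := RatFunc.algebraMap_ne_zero g.denom_ne_zero
  have e : f + g = algebraMap K[X] (RatFunc K) (f.num * g.denom + g.num * f.denom) /
      algebraMap K[X] (RatFunc K) (f.denom * g.denom) := by
    conv_lhs => rw [← f.num_div_denom, ← g.num_div_denom]
    simp only [map_mul, map_add]
    field_simp
  rw [e]
  refine (ratHeight_div_le _ (mul_ne_zero f.denom_ne_zero g.denom_ne_zero)).trans ?_
  have h1 := natDegree_add_le (f.num * g.denom) (g.num * f.denom)
  have h2 := natDegree_mul_le (p := f.num) (q := g.denom)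
  have h3 := natDegree_mul_le (p := g.num) (q := f.denom)
  have h4 := natDegree_mul_le (p := f.denom) (q := g.denom)
  simp only [ratHeight]
  omega

theorem ratHeight_mul_le (f g : RatFunc K) : ratHeight (f * g) ≤ ratHeight f + ratHeight g := by
  have hf := RatFunc.algebraMap_ne_zero f.denom_ne_zero
  have hg := RatFunc.algebraMap_ne_zero g.denom_ne_zero
  have e : f * g = algebraMap K[X] (RatFunc K) (f.num * g.num) /
      algebraMap K[X] (RatFunc K) (f.denom * g.denom) := by
    conv_lhs => rw [← f.num_div_denom, ← g.num_div_denom]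
    simp only [map_mul]
    field_simp
  rw [e]
  refine (ratHeight_div_le _ (mul_ne_zero f.denom_ne_zero g.denom_ne_zero)).trans ?_
  have h2 := natDegree_mul_le (p := f.num) (q := g.num)
  have h4 := natDegree_mul_le (p := f.denom) (q := g.denom)
  simp only [ratHeight]
  omega

theorem ratHeight_C (c : K) : ratHeight (RatFunc.C c) = 0 := by
  simp [ratHeight]

theorem ratHeight_inv_le (f : RatFunc K) : ratHeight f⁻¹ ≤ ratHeight f := by
  by_cases hf : f = 0
  · rw [hf, inv_zero]
  have e : f⁻¹ = algebraMap K[X] (RatFunc K) f.denom / algebraMap K[X] (RatFunc K) f.num := by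
    conv_lhs => rw [← f.num_div_denom]
    rw [inv_div]
  rw [e]
  exact (ratHeight_div_le _ (RatFunc.num_ne_zero hf)).trans (max_comm _ _).le

theorem ratHeight_neg_le (f : RatFunc K) : ratHeight (-f) ≤ ratHeight f := by
  have e : -f = RatFunc.C (-1) * f := by simp
  rw [e]
  exact (ratHeight_mul_le _ _).trans (by rw [ratHeight_C, zero_add])

theorem ratHeight_X_pow_le (n : ℕ) : ratHeight (RatFunc.X ^ n : RatFunc K) ≤ n := by
  have e : (RatFunc.X ^ n : RatFunc K) =
      algebraMap K[X] (RatFunc K) (X ^ n) / algebraMap K[X] (RatFunc K) 1 := by simp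
  rw [e]
  exact (ratHeight_div_le _ one_ne_zero).trans (by simp)

theorem ratHeight_X_zpow_le (k : ℤ) : ratHeight (RatFunc.X ^ k : RatFunc K) ≤ k.natAbs := by
  obtain ⟨n, rfl | rfl⟩ := k.eq_nat_or_neg
  · simpa using ratHeight_X_pow_le n
  · rw [zpow_neg, zpow_natCast]
    refine (ratHeight_inv_le _).trans ?_
    simpa using ratHeight_X_pow_le n

theorem natAbs_intDegree_le (f : RatFunc K) : f.intDegree.natAbs ≤ ratHeight f := by
  simp only [RatFunc.intDegree, ratHeight]
  omega

theorem ratHeight_ratFuncEuler_le (f : RatFunc K) :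
    ratHeight (ratFuncEuler f) ≤ ratHeight f + ratHeight f := by
  have hq := f.denom_ne_zero
  have e := ratFuncEuler_div f.num hq
  rw [f.num_div_denom] at e
  rw [e]
  refine (ratHeight_div_le _ (pow_ne_zero 2 hq)).trans ?_
  have := natDegree_eulerNum_le f.num f.denom
  rw [natDegree_pow]
  simp only [ratHeight]
  omega

theorem exists_eq_C_of_ratHeight_eq_zero {f : RatFunc K} (hf : ratHeight f = 0) :
    ∃ c, f = RatFunc.C c := by
  have h1 : f.num.natDegree = 0 := by simp only [ratHeight] at hf; omega
  have h2 : f.denom.natDegree = 0 := by simp only [ratHeight] at hf; omega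
  refine ⟨f.num.coeff 0 / f.denom.coeff 0, ?_⟩
  conv_lhs => rw [← f.num_div_denom, eq_C_of_natDegree_eq_zero h1, eq_C_of_natDegree_eq_zero h2]
  rw [RatFunc.algebraMap_C, RatFunc.algebraMap_C, map_div₀]

theorem natDegree_denom_le_of_aeval_eq_zero {P : K[X][X]} (hP : P ≠ 0) {g : RatFunc K}
    (hg : aeval g P = 0) : g.denom.natDegree ≤ P.leadingCoeff.natDegree := by
  have hlc := leadingCoeff_ne_zero.2 hP
  have hint := isIntegral_leadingCoeff_smul P g hg
  obtain ⟨p, hp⟩ := IsIntegrallyClosed.isIntegral_iff.1 hint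
  refine natDegree_le_of_dvd ((RatFunc.denom_dvd hlc).2 ⟨p, ?_⟩) hlc
  rw [hp, Algebra.smul_def, mul_div_cancel_left₀ _ (RatFunc.algebraMap_ne_zero hlc)]

theorem ratHeight_le_of_aeval_eq_zero {P : K[X][X]} (hP : P ≠ 0) {g : RatFunc K}
    (hg : aeval g P = 0) {B : ℕ} (hB : ∀ i, (P.coeff i).natDegree ≤ B) : ratHeight g ≤ B := by
  by_cases hg0 : g = 0
  · simp [hg0, ratHeight]
  refine max_le ?_ ((natDegree_denom_le_of_aeval_eq_zero hP hg).trans (hB _))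
  have h1 : aeval g⁻¹ P.reverse = 0 := by
    let _ : Invertible g := invertibleOfNonzero hg0
    rw [← invOf_eq_inv]
    exact (eval₂_reverse_eq_zero_iff _ g P).2 hg
  have h2 := natDegree_denom_le_of_aeval_eq_zero (by simpa using hP) h1
  have h3 : g.num.natDegree ≤ g⁻¹.denom.natDegree := by
    refine natDegree_le_of_dvd ?_ g⁻¹.denom_ne_zero
    have e : g = algebraMap K[X] (RatFunc K) g⁻¹.denom / algebraMap K[X] (RatFunc K) g⁻¹.num := by
      rw [← inv_div, g⁻¹.num_div_denom, inv_inv]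
    conv_lhs => rw [e]
    exact RatFunc.num_div_dvd _ (RatFunc.num_ne_zero (inv_ne_zero hg0))
  refine h3.trans (h2.trans ?_)
  rw [reverse_leadingCoeff, trailingCoeff]
  exact hB _

theorem ratHeight_le_of_sum_eq_zero {d : ℕ} {a : ℕ → RatFunc K} {g : RatFunc K}
    (ha : ∃ i ∈ Finset.range d, a i ≠ 0) (hg : ∑ i ∈ Finset.range d, a i * g ^ i = 0) :
    ratHeight g ≤ ∑ i ∈ Finset.range d, ratHeight (a i) := by
  classical
  let b : ℕ → K[X] := fun i => (a i).num * ∏ j ∈ (Finset.range d).erase i, (a j).denom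
  let q : K[X] := ∏ j ∈ Finset.range d, (a j).denom
  have hq : q ≠ 0 := Finset.prod_ne_zero_iff.2 fun i _ => (a i).denom_ne_zero
  have hb : ∀ i ∈ Finset.range d, algebraMap K[X] (RatFunc K) (b i) =
      a i * algebraMap K[X] (RatFunc K) q := by
    intro i hi
    have hi' := RatFunc.algebraMap_ne_zero (a i).denom_ne_zero
    simp only [b, q]
    rw [← Finset.mul_prod_erase _ _ hi]
    have hn : algebraMap K[X] (RatFunc K) (a i).num =
        a i * algebraMap K[X] (RatFunc K) (a i).denom :=
      (div_eq_iff hi').1 (a i).num_div_denom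
    rw [map_mul, map_mul, hn, mul_assoc]
  let P : K[X][X] := ∑ i ∈ Finset.range d, C (b i) * X ^ i
  have hPc : ∀ i, P.coeff i = if i ∈ Finset.range d then b i else 0 := by
    intro i
    simp only [P, finsetSum_coeff, coeff_C_mul, coeff_X_pow, mul_ite, mul_one, mul_zero]
    rw [Finset.sum_ite_eq]
  refine ratHeight_le_of_aeval_eq_zero (P := P) ?_ ?_ ?_
  · obtain ⟨i, hi, h0⟩ := ha
    intro hP
    have h1 := hPc i
    rw [hP, coeff_zero, if_pos hi] at h1
    have h2 := hb i hi
    rw [← h1, map_zero] at h2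
    exact mul_ne_zero h0 (RatFunc.algebraMap_ne_zero hq) h2.symm
  · simp only [P, map_sum, map_mul, map_pow, aeval_C, aeval_X]
    have : ∀ i ∈ Finset.range d, algebraMap K[X] (RatFunc K) (b i) * g ^ i =
        algebraMap K[X] (RatFunc K) q * (a i * g ^ i) := fun i hi => by
      rw [hb i hi]; ring
    rw [Finset.sum_congr rfl this, ← Finset.mul_sum, hg, mul_zero]
  · intro i
    rw [hPc]
    split_ifs with hi
    · refine natDegree_mul_le.trans ?_
      rw [← Finset.add_sum_erase _ _ hi]
      refine Nat.add_le_add (le_max_left _ _) ((natDegree_prod_le _ _).trans ?_)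
      exact Finset.sum_le_sum fun j _ => le_max_right _ _
    · simp

end Height

theorem IntDerivation.map_mul {Q : Type*} [Field Q] (D : IntDerivation Q) (a b : Q) :
    D (a * b) = a * D b + b * D a := by
  simp [D.leibniz]

section Laurent

variable {K : Type*} [Field K]

/-- `f` has at most `D` poles at the origin, away from the origin it has at most `e` poles, and its
degree at infinity is at most `D`, with an error of `e`. -/
def LaurentBound (D e : ℕ) (f : RatFunc K) : Prop :=
  ∃ v p : K[X], v ≠ 0 ∧ v.natDegree ≤ e ∧ p.natDegree ≤ 2 * D + e ∧
    algebraMap K[X] (RatFunc K) v * f * RatFunc.X ^ D = algebraMap K[X] (RatFunc K) p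

theorem LaurentBound.zero (D : ℕ) : LaurentBound D 0 (0 : RatFunc K) :=
  ⟨1, 0, one_ne_zero, by simp, by simp, by simp⟩

theorem LaurentBound.add {D e₁ e₂ : ℕ} {f g : RatFunc K} (hf : LaurentBound D e₁ f)
    (hg : LaurentBound D e₂ g) : LaurentBound D (e₁ + e₂) (f + g) := by
  obtain ⟨v, p, hv, hve, hp, h⟩ := hf
  obtain ⟨w, q, hw, hwe, hq, h'⟩ := hg
  refine ⟨v * w, w * p + v * q, mul_ne_zero hv hw, natDegree_mul_le.trans (by lia),
    natDegree_add_le_of_degree_le (natDegree_mul_le.trans (by lia))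
      (natDegree_mul_le.trans (by lia)), ?_⟩
  rw [map_add, map_mul, map_mul, map_mul, ← h, ← h']
  ring

theorem LaurentBound.mul {D e : ℕ} {f : RatFunc K} (c : RatFunc K) (hf : LaurentBound D e f) :
    LaurentBound D (e + ratHeight c) (c * f) := by
  obtain ⟨v, p, hv, hve, hp, h⟩ := hf
  have h₁ : c.num.natDegree ≤ ratHeight c := le_max_left _ _
  have h₂ : c.denom.natDegree ≤ ratHeight c := le_max_right _ _
  refine ⟨v * c.denom, c.num * p, mul_ne_zero hv c.denom_ne_zero, natDegree_mul_le.trans (by lia),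
    natDegree_mul_le.trans (by lia), ?_⟩
  have h₃ : algebraMap K[X] (RatFunc K) c.denom * c = algebraMap K[X] (RatFunc K) c.num := by
    rw [mul_comm]
    exact (eq_div_iff (RatFunc.algebraMap_ne_zero c.denom_ne_zero)).1
      (RatFunc.num_div_denom c).symm
  rw [map_mul, map_mul, ← h, ← h₃]
  ring

theorem LaurentBound.euler {D e : ℕ} {f : RatFunc K} (hf : LaurentBound D e f) :
    LaurentBound D (2 * e) (ratFuncEuler f) := by
  obtain ⟨v, p, hv, hve, hp, h⟩ := hf
  have hv' := (natDegree_X_mul_derivative_le v).trans hve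
  have hp' := (natDegree_X_mul_derivative_le p).trans hp
  have hv'' : (X * derivative v + (D : K[X]) * v).natDegree ≤ e :=
    natDegree_add_le_of_degree_le hv' (natDegree_mul_le.trans (by simpa using hve))
  have h₁ : (v * (X * derivative p)).natDegree ≤ 2 * D + 2 * e :=
    natDegree_mul_le.trans (by lia)
  have h₂ : (p * (X * derivative v + (D : K[X]) * v)).natDegree ≤ 2 * D + 2 * e :=
    natDegree_mul_le.trans (by lia)
  refine ⟨v * v, v * (X * derivative p) - p * (X * derivative v + (D : K[X]) * v),
    mul_ne_zero hv hv, natDegree_mul_le.trans (by lia), (natDegree_sub_le_of_le h₁ h₂).trans (max_self _).le, ?_⟩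
  · clear h₁ h₂
    have h₁ := congrArg ratFuncEuler h
    rw [IntDerivation.map_mul, IntDerivation.map_mul, ratFuncEuler_algebraMap, ratFuncEuler_algebraMap,
      ← zpow_natCast, ratFuncEuler_X_zpow, zpow_natCast] at h₁
    simp only [Int.cast_natCast] at h₁
    simp only [map_sub, map_mul, map_add, map_natCast] at h₁ ⊢
    linear_combination (algebraMap K[X] (RatFunc K) v) * h₁ -
      (algebraMap K[X] (RatFunc K) X * algebraMap K[X] (RatFunc K) (derivative v) +
        D * algebraMap K[X] (RatFunc K) v) * h

theorem LaurentBound.le_intDegree {D e : ℕ} {f : RatFunc K} (hf : LaurentBound D e f)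
    (hf0 : f ≠ 0) : -((D : ℤ) + e) ≤ f.intDegree := by
  obtain ⟨v, p, hv, hve, hp, h⟩ := hf
  have hv0 := RatFunc.algebraMap_ne_zero hv
  have hX : (RatFunc.X ^ D : RatFunc K) ≠ 0 := pow_ne_zero _ RatFunc.X_ne_zero
  have h₁ := congrArg RatFunc.intDegree h
  rw [RatFunc.intDegree_mul (mul_ne_zero hv0 hf0) hX, RatFunc.intDegree_mul hv0 hf0,
    RatFunc.intDegree_polynomial, RatFunc.intDegree_polynomial, ← RatFunc.algebraMap_X, ← map_pow,
    RatFunc.intDegree_polynomial, natDegree_X_pow] at h₁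
  lia

variable (K) in
theorem powers_X_le_nonZeroDivisors : Submonoid.powers (X : K[X]) ≤ nonZeroDivisors K[X] :=
  powers_le_nonZeroDivisors_of_noZeroDivisors X_ne_zero

variable (K) in
/-- The Laurent polynomials, as a subring of the rational functions. -/
noncomputable def laurentSubalgebra : Subalgebra K[X] (RatFunc K) :=
  Localization.subalgebra.ofField (RatFunc K) _ (powers_X_le_nonZeroDivisors K)

theorem mem_laurentSubalgebra_iff {f : RatFunc K} : f ∈ laurentSubalgebra K ↔
    ∃ (p : K[X]) (k : ℕ), RatFunc.X ^ k * f = algebraMap K[X] (RatFunc K) p := by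
  have hX : ∀ k, (RatFunc.X ^ k : RatFunc K) ≠ 0 := fun k => pow_ne_zero _ RatFunc.X_ne_zero
  constructor
  · rintro ⟨p, _, ⟨k, rfl⟩, rfl⟩
    refine ⟨p, k, ?_⟩
    have := hX k
    simp only [map_pow, RatFunc.algebraMap_X]
    field_simp
  · rintro ⟨p, k, h⟩
    refine ⟨p, _, ⟨k, rfl⟩, ?_⟩
    have := hX k
    rw [← h]
    simp only [map_pow, RatFunc.algebraMap_X]
    field_simp

theorem C_mem_laurentSubalgebra (c : K) : RatFunc.C c ∈ laurentSubalgebra K := by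
  rw [← RatFunc.algebraMap_C]
  exact (laurentSubalgebra K).algebraMap_mem _

theorem X_zpow_mem_laurentSubalgebra (k : ℤ) :
    (RatFunc.X ^ k : RatFunc K) ∈ laurentSubalgebra K := by
  obtain ⟨n, rfl | rfl⟩ := k.eq_nat_or_neg
  · rw [zpow_natCast, ← RatFunc.algebraMap_X, ← map_pow]
    exact (laurentSubalgebra K).algebraMap_mem _
  · refine mem_laurentSubalgebra_iff.2 ⟨1, n, ?_⟩
    rw [zpow_neg, zpow_natCast, map_one, mul_inv_cancel₀ (pow_ne_zero _ RatFunc.X_ne_zero)]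

theorem mem_laurentSubalgebra_of_pow_add_sum_eq_zero {n : ℕ} {a : ℕ → RatFunc K}
    (ha : ∀ i < n, a i ∈ laurentSubalgebra K) {s : RatFunc K}
    (hs : s ^ n + ∑ i ∈ Finset.range n, a i * s ^ i = 0) : s ∈ laurentSubalgebra K := by
  classical
  have h₁ : IsLocalization (Submonoid.powers (X : K[X])) (laurentSubalgebra K) :=
    Localization.subalgebra.isLocalization_ofField ..
  have h₂ : IsFractionRing (laurentSubalgebra K) (RatFunc K) :=
    IsFractionRing.isFractionRing_of_isLocalization (Submonoid.powers (X : K[X])) _ _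
      (powers_X_le_nonZeroDivisors K)
  have h₃ : IsIntegrallyClosed (laurentSubalgebra K) :=
    isIntegrallyClosed_of_isLocalization _ _ (powers_X_le_nonZeroDivisors K)
  let b : ℕ → laurentSubalgebra K := fun i => if h : i < n then ⟨a i, ha i h⟩ else 0
  have hb : ∀ i ∈ Finset.range n, ((b i : laurentSubalgebra K) : RatFunc K) = a i := by
    intro i hi
    simp [b, Finset.mem_range.1 hi]
  have hint : IsIntegral (laurentSubalgebra K) s := by
    refine ⟨X ^ n + ∑ i ∈ Finset.range n, C (b i) * X ^ i, ?_, ?_⟩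
    · refine monic_X_pow_add ?_
      refine (degree_sum_le _ _).trans_lt ((Finset.sup_lt_iff (by simp)).2 fun i hi => ?_)
      refine (degree_C_mul_X_pow_le _ _).trans_lt ?_
      exact_mod_cast Finset.mem_range.1 hi
    · rw [eval₂_add, eval₂_X_pow, eval₂_finsetSum]
      refine Eq.trans ?_ hs
      congr 1
      refine Finset.sum_congr rfl fun i hi => ?_
      rw [eval₂_mul, eval₂_C, eval₂_X_pow, ← hb i hi]
      rfl
  obtain ⟨y, hy⟩ := IsIntegrallyClosed.isIntegral_iff.1 hint
  rw [← hy]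
  exact y.2

theorem LaurentBound.of_mem_laurentSubalgebra {s : RatFunc K} (hs : s ∈ laurentSubalgebra K) :
    LaurentBound (ratHeight s) 0 s := by
  obtain ⟨p, k, h⟩ := mem_laurentSubalgebra_iff.1 hs
  have hX : (RatFunc.X ^ k : RatFunc K) ≠ 0 := pow_ne_zero _ RatFunc.X_ne_zero
  have hd : s.denom ∣ X ^ k := by
    refine (RatFunc.denom_dvd (pow_ne_zero _ X_ne_zero)).2 ⟨p, ?_⟩
    rw [← h, map_pow, RatFunc.algebraMap_X, mul_div_cancel_left₀ _ hX]
  obtain ⟨j, -, hj⟩ := (dvd_prime_pow prime_X k).1 hd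
  have hj := eq_of_monic_of_associated s.monic_denom (monic_X_pow j) hj
  have h₁ : s.num.natDegree ≤ ratHeight s := le_max_left _ _
  have h₂ : j ≤ ratHeight s := by
    have : s.denom.natDegree ≤ ratHeight s := le_max_right _ _
    rwa [hj, natDegree_X_pow] at this
  refine ⟨1, s.num * X ^ (ratHeight s - j), one_ne_zero, by simp,
    natDegree_mul_le.trans (by rw [natDegree_X_pow]; lia), ?_⟩
  obtain ⟨r, hr⟩ := Nat.exists_eq_add_of_le h₂
  have hsr : s = algebraMap K[X] (RatFunc K) s.num / RatFunc.X ^ j := by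
    conv_lhs => rw [← RatFunc.num_div_denom s, hj, map_pow, RatFunc.algebraMap_X]
  have hXj : (RatFunc.X ^ j : RatFunc K) ≠ 0 := pow_ne_zero _ RatFunc.X_ne_zero
  generalize ratHeight s = H at *
  generalize s.num = u at *
  subst hsr hr
  rw [map_one, one_mul, map_mul, map_pow, RatFunc.algebraMap_X, pow_add, Nat.add_sub_cancel_left]
  field_simp

end Laurent

theorem Nsharp_div_le (p : ℂ[X]) {q : ℂ[X]} (hq : q ≠ 0) :
    Nsharp (algebraMap ℂ[X] (RatFunc ℂ) p / algebraMap ℂ[X] (RatFunc ℂ) q) ≤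
      p.support.card + q.support.card :=
  Nat.sInf_le ⟨p, q, hq, rfl, rfl⟩

theorem exists_eq_div_Nsharp_eq (g : RatFunc ℂ) : ∃ p q : ℂ[X], q ≠ 0 ∧
    g = algebraMap ℂ[X] (RatFunc ℂ) p / algebraMap ℂ[X] (RatFunc ℂ) q ∧
    Nsharp g = p.support.card + q.support.card :=
  Nat.sInf_mem (s := {n : ℕ | ∃ p q : Polynomial ℂ, q ≠ 0 ∧
    g = algebraMap (Polynomial ℂ) (RatFunc ℂ) p / algebraMap (Polynomial ℂ) (RatFunc ℂ) q ∧
    n = p.support.card + q.support.card})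
    ⟨_, g.num, g.denom, g.denom_ne_zero, (RatFunc.num_div_denom g).symm, rfl⟩

theorem Nsharp_add_le (f g : RatFunc ℂ) : Nsharp (f + g) ≤ 3 * (Nsharp f * Nsharp g) := by
  obtain ⟨p, q, hq, hf, hpq⟩ := exists_eq_div_Nsharp_eq f
  obtain ⟨r, s, hs, hg, hrs⟩ := exists_eq_div_Nsharp_eq g
  have h : f + g = algebraMap ℂ[X] (RatFunc ℂ) (p * s + q * r) /
      algebraMap ℂ[X] (RatFunc ℂ) (q * s) := by
    rw [hf, hg, div_add_div _ _ (RatFunc.algebraMap_ne_zero hq) (RatFunc.algebraMap_ne_zero hs)]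
    simp only [map_add, map_mul]
  have h₁ : (p * s + q * r).support.card ≤ (p * s).support.card + (q * r).support.card :=
    (Finset.card_le_card support_add).trans (Finset.card_union_le _ _)
  have h₂ := card_support_mul_le (p := p) (q := s)
  have h₃ := card_support_mul_le (p := q) (q := r)
  have h₄ := card_support_mul_le (p := q) (q := s)
  rw [hpq, hrs, h]
  refine (Nsharp_div_le _ (mul_ne_zero hq hs)).trans ?_
  nlinarith

theorem Nsharp_mul_le (f g : RatFunc ℂ) : Nsharp (f * g) ≤ 2 * (Nsharp f * Nsharp g) := by
  obtain ⟨p, q, hq, hf, hpq⟩ := exists_eq_div_Nsharp_eq f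
  obtain ⟨r, s, hs, hg, hrs⟩ := exists_eq_div_Nsharp_eq g
  have h : f * g = algebraMap ℂ[X] (RatFunc ℂ) (p * r) / algebraMap ℂ[X] (RatFunc ℂ) (q * s) := by
    rw [hf, hg, div_mul_div_comm, map_mul, map_mul]
  have h₂ := card_support_mul_le (p := p) (q := r)
  have h₄ := card_support_mul_le (p := q) (q := s)
  rw [hpq, hrs, h]
  refine (Nsharp_div_le _ (mul_ne_zero hq hs)).trans ?_
  nlinarith

theorem Nsharp_inv_le (f : RatFunc ℂ) : Nsharp f⁻¹ ≤ Nsharp f := by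
  by_cases hf0 : f = 0
  · rw [hf0, inv_zero]
  obtain ⟨p, q, hq, hf, hpq⟩ := exists_eq_div_Nsharp_eq f
  have hp : p ≠ 0 := by
    rintro rfl
    exact hf0 (by rw [hf, map_zero, zero_div])
  rw [hpq, hf, inv_div, add_comm]
  exact Nsharp_div_le _ hp

theorem card_support_C_le_one (c : ℂ) : (C c : ℂ[X]).support.card ≤ 1 := by
  simpa using card_support_C_mul_X_pow_le_one (c := c) (n := 0)

theorem Nsharp_C_le (c : ℂ) : Nsharp (RatFunc.C c) ≤ 2 := by
  have := Nsharp_div_le (C c) one_ne_zero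
  rw [map_one, div_one, RatFunc.algebraMap_C] at this
  refine this.trans (add_le_add (b := 1) (d := 1) (card_support_C_le_one c) ?_)
  rw [← C_1]
  exact card_support_C_le_one 1

theorem Nsharp_X_zpow_le (k : ℤ) : Nsharp (RatFunc.X ^ k) ≤ 2 := by
  have h : ∀ n : ℕ, Nsharp (RatFunc.X ^ n) ≤ 2 := by
    intro n
    have := Nsharp_div_le (X ^ n) one_ne_zero
    rw [map_one, div_one, map_pow, RatFunc.algebraMap_X] at this
    refine this.trans (add_le_add (b := 1) (d := 1) ?_ ?_)
    · rw [support_X_pow, Finset.card_singleton]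
    · rw [← C_1]
      exact card_support_C_le_one 1
  obtain ⟨n, rfl | rfl⟩ := k.eq_nat_or_neg
  · rw [zpow_natCast]
    exact h n
  · rw [zpow_neg, zpow_natCast]
    exact (Nsharp_inv_le _).trans (h n)

/-- Sequences of rational functions, modulo a nonprincipal ultrafilter. -/
def RatGerm : Type :=
  Filter.Germ (Filter.hyperfilter ℕ : Filter ℕ) (RatFunc ℂ)

namespace RatGerm

noncomputable instance : Field RatGerm :=
  inferInstanceAs (Field (Filter.Germ _ _))

/-- The germ of a sequence. -/
noncomputable def ofSeq : (ℕ → RatFunc ℂ) →+* RatGerm :=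
  Filter.Germ.coeRingHom (R := RatFunc ℂ) (Filter.hyperfilter ℕ : Filter ℕ)

theorem ofSeq_surjective : Function.Surjective ofSeq := Quot.exists_rep

theorem ofSeq_eq_ofSeq {f g : ℕ → RatFunc ℂ} :
    ofSeq f = ofSeq g ↔ ∀ᶠ n in Filter.hyperfilter ℕ, f n = g n :=
  Filter.Germ.coe_eq

theorem ofSeq_eq_zero {f : ℕ → RatFunc ℂ} :
    ofSeq f = 0 ↔ ∀ᶠ n in Filter.hyperfilter ℕ, f n = 0 :=
  ofSeq_eq_ofSeq (g := fun _ => 0)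

theorem ofSeq_ne_zero {f : ℕ → RatFunc ℂ} :
    ofSeq f ≠ 0 ↔ ∀ᶠ n in Filter.hyperfilter ℕ, f n ≠ 0 := by
  rw [Ne, ofSeq_eq_zero, Ultrafilter.eventually_not]

theorem ofSeq_inv (f : ℕ → RatFunc ℂ) : (ofSeq f)⁻¹ = ofSeq fun n => (f n)⁻¹ := rfl

instance : CharZero RatGerm :=
  charZero_of_injective_ringHom
    (f := ofSeq.comp ((Pi.constRingHom ℕ (RatFunc ℂ)).comp RatFunc.C)) (RingHom.injective _)

/-- The degree at infinity. -/
noncomputable def deg : RatGerm → Hyperreal :=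
  Filter.Germ.map fun f => (f.intDegree : ℝ)

theorem deg_ofSeq (f : ℕ → RatFunc ℂ) :
    deg (ofSeq f) = Hyperreal.ofSeq fun n => ((f n).intDegree : ℝ) := rfl

/-- The degree as a map to the projective line. -/
noncomputable def height : RatGerm → Hyperreal :=
  Filter.Germ.map fun f => (ratHeight f : ℝ)

theorem height_ofSeq (f : ℕ → RatFunc ℂ) :
    height (ofSeq f) = Hyperreal.ofSeq fun n => (ratHeight (f n) : ℝ) := rfl

theorem deg_mul {a b : RatGerm} (ha : a ≠ 0) (hb : b ≠ 0) : deg (a * b) = deg a + deg b := by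
  obtain ⟨f, rfl⟩ := ofSeq_surjective a
  obtain ⟨g, rfl⟩ := ofSeq_surjective b
  rw [← map_mul, deg_ofSeq, deg_ofSeq, deg_ofSeq]
  refine Filter.Germ.coe_eq.2 ?_
  filter_upwards [ofSeq_ne_zero.1 ha, ofSeq_ne_zero.1 hb] with n hf hg
  rw [Pi.mul_apply, RatFunc.intDegree_mul hf hg, Int.cast_add]

theorem deg_one : deg 1 = 0 := by
  rw [← map_one ofSeq, deg_ofSeq]
  refine Filter.Germ.coe_eq.2 (Filter.Eventually.of_forall fun n => ?_)
  simp [RatFunc.intDegree_one]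

theorem deg_pow {a : RatGerm} (ha : a ≠ 0) (n : ℕ) : deg (a ^ n) = n * deg a := by
  induction n with
  | zero => rw [pow_zero, deg_one, Nat.cast_zero, zero_mul]
  | succ n ih => rw [pow_succ, deg_mul (pow_ne_zero n ha) ha, ih, Nat.cast_succ, add_one_mul]

theorem deg_add_le {a b : RatGerm} (hb : b ≠ 0) (hab : a + b ≠ 0) :
    deg (a + b) ≤ max (deg a) (deg b) := by
  obtain ⟨f, rfl⟩ := ofSeq_surjective a
  obtain ⟨g, rfl⟩ := ofSeq_surjective b
  rw [← map_add] at hab ⊢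
  rw [deg_ofSeq, deg_ofSeq, deg_ofSeq, le_max_iff, Hyperreal.ofSeq_le_ofSeq,
    Hyperreal.ofSeq_le_ofSeq, ← Ultrafilter.eventually_or]
  filter_upwards [ofSeq_ne_zero.1 hab, ofSeq_ne_zero.1 hb] with n hf hg
  have := RatFunc.intDegree_add_le hg hf
  rw [le_max_iff] at this
  exact_mod_cast this

/-- The derivation `x d/dx`. -/
noncomputable def euler : IntDerivation RatGerm :=
  IntDerivation.ofAddMonoidHom
    { toFun := Filter.Germ.map ratFuncEuler
      map_zero' := congrArg ofSeq (funext fun _ => map_zero (ratFuncEuler (K := ℂ)))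
      map_add' := fun a b => by
        obtain ⟨f, rfl⟩ := ofSeq_surjective a
        obtain ⟨g, rfl⟩ := ofSeq_surjective b
        exact congrArg ofSeq (funext fun n => map_add (ratFuncEuler (K := ℂ)) (f n) (g n)) }
    fun a b => by
      obtain ⟨f, rfl⟩ := ofSeq_surjective a
      obtain ⟨g, rfl⟩ := ofSeq_surjective b
      exact congrArg ofSeq (funext fun n => IntDerivation.map_mul ratFuncEuler (f n) (g n))

theorem euler_ofSeq (f : ℕ → RatFunc ℂ) :
    euler (ofSeq f) = ofSeq fun n => ratFuncEuler (f n) := rfl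

theorem deg_euler_le {a : RatGerm} (ha : euler a ≠ 0) : deg (euler a) ≤ deg a := by
  obtain ⟨f, rfl⟩ := ofSeq_surjective a
  rw [euler_ofSeq] at ha ⊢
  rw [deg_ofSeq, deg_ofSeq, Hyperreal.ofSeq_le_ofSeq]
  filter_upwards [ofSeq_ne_zero.1 ha] with n hn
  exact_mod_cast intDegree_ratFuncEuler_le hn

theorem deg_euler_eq {a : RatGerm} (ha : deg a ≠ 0) : euler a ≠ 0 ∧ deg (euler a) = deg a := by
  obtain ⟨f, rfl⟩ := ofSeq_surjective a
  have h : ∀ᶠ n in Filter.hyperfilter ℕ, (f n).intDegree ≠ 0 := by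
    rw [Ultrafilter.eventually_not]
    refine fun h => ha ?_
    refine Filter.Germ.coe_eq.2 ?_
    filter_upwards [h] with n hn
    change ((f n).intDegree : ℝ) = 0
    rw [hn, Int.cast_zero]
  rw [euler_ofSeq]
  constructor
  · rw [ofSeq_ne_zero]
    filter_upwards [h] with n hn using (intDegree_ratFuncEuler_eq hn).1
  · rw [deg_ofSeq]
    refine Filter.Germ.coe_eq.2 ?_
    filter_upwards [h] with n hn
    rw [(intDegree_ratFuncEuler_eq hn).2]
    rfl

theorem height_nonneg (a : RatGerm) : 0 ≤ height a := by
  obtain ⟨f, rfl⟩ := ofSeq_surjective a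
  exact Hyperreal.ofSeq_le_ofSeq.2 (Filter.Eventually.of_forall fun n => Nat.cast_nonneg _)

theorem height_add_le (a b : RatGerm) : height (a + b) ≤ height a + height b := by
  obtain ⟨f, rfl⟩ := ofSeq_surjective a
  obtain ⟨g, rfl⟩ := ofSeq_surjective b
  exact Hyperreal.ofSeq_le_ofSeq.2 (Filter.Eventually.of_forall fun n => by
    have h : (ratHeight (f n + g n) : ℝ) ≤ ratHeight (f n) + ratHeight (g n) := by
      exact_mod_cast ratHeight_add_le (f n) (g n)
    exact h)

theorem height_mul_le (a b : RatGerm) : height (a * b) ≤ height a + height b := by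
  obtain ⟨f, rfl⟩ := ofSeq_surjective a
  obtain ⟨g, rfl⟩ := ofSeq_surjective b
  exact Hyperreal.ofSeq_le_ofSeq.2 (Filter.Eventually.of_forall fun n => by
    have h : (ratHeight (f n * g n) : ℝ) ≤ ratHeight (f n) + ratHeight (g n) := by
      exact_mod_cast ratHeight_mul_le (f n) (g n)
    exact h)

theorem height_inv_le (a : RatGerm) : height a⁻¹ ≤ height a := by
  obtain ⟨f, rfl⟩ := ofSeq_surjective a
  exact Hyperreal.ofSeq_le_ofSeq.2 (Filter.Eventually.of_forall fun n => by
    have h : (ratHeight (f n)⁻¹ : ℝ) ≤ ratHeight (f n) := by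
      exact_mod_cast ratHeight_inv_le (f n)
    exact h)

theorem height_neg_le (a : RatGerm) : height (-a) ≤ height a := by
  obtain ⟨f, rfl⟩ := ofSeq_surjective a
  exact Hyperreal.ofSeq_le_ofSeq.2 (Filter.Eventually.of_forall fun n => by
    have h : (ratHeight (-f n) : ℝ) ≤ ratHeight (f n) := by
      exact_mod_cast ratHeight_neg_le (f n)
    exact h)

theorem height_euler_le (a : RatGerm) : height (euler a) ≤ height a + height a := by
  obtain ⟨f, rfl⟩ := ofSeq_surjective a
  exact Hyperreal.ofSeq_le_ofSeq.2 (Filter.Eventually.of_forall fun n => by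
    have h : (ratHeight (ratFuncEuler (f n)) : ℝ) ≤ ratHeight (f n) + ratHeight (f n) := by
      exact_mod_cast ratHeight_ratFuncEuler_le (f n)
    exact h)

theorem abs_deg_le (a : RatGerm) : |deg a| ≤ height a := by
  obtain ⟨f, rfl⟩ := ofSeq_surjective a
  refine abs_le'.2 ⟨?_, ?_⟩ <;>
  refine Hyperreal.ofSeq_le_ofSeq.2 (Filter.Eventually.of_forall fun n => ?_) <;>
  have := natAbs_intDegree_le (f n)
  · have h : (f n).intDegree ≤ (ratHeight (f n) : ℤ) := by lia
    have h' : ((f n).intDegree : ℝ) ≤ ratHeight (f n) := by exact_mod_cast h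
    exact h'
  · have h : -(f n).intDegree ≤ (ratHeight (f n) : ℤ) := by lia
    have hh : -((f n).intDegree : ℝ) ≤ ratHeight (f n) := by exact_mod_cast h
    exact hh

/-- The germ of a sequence of constants. -/
noncomputable def const : (ℕ → ℂ) →+* RatGerm :=
  ofSeq.comp (RingHom.pi fun n => RatFunc.C.comp (Pi.evalRingHom _ n))

theorem const_eq (c : ℕ → ℂ) : const c = ofSeq fun n => RatFunc.C (c n) := rfl

theorem height_const (c : ℕ → ℂ) : height (const c) = 0 := by
  refine Filter.Germ.coe_eq.2 (Filter.Eventually.of_forall fun n => ?_)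
  change ((ratHeight (RatFunc.C (c n)) : ℕ) : ℝ) = 0
  rw [ratHeight_C, Nat.cast_zero]

theorem exists_eq_const_of_height_eq_zero {a : RatGerm} (ha : height a = 0) :
    ∃ c, a = const c := by
  obtain ⟨f, rfl⟩ := ofSeq_surjective a
  have h : ∀ᶠ n in Filter.hyperfilter ℕ, (ratHeight (f n) : ℝ) = 0 := Filter.Germ.coe_eq.1 ha
  have h' : ∀ᶠ n in Filter.hyperfilter ℕ, ∃ c, f n = RatFunc.C c := by
    filter_upwards [h] with n hn
    exact exists_eq_C_of_ratHeight_eq_zero (by exact_mod_cast hn)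
  choose c hc using h'.choice
  exact ⟨c, ofSeq_eq_ofSeq.2 hc⟩

theorem euler_const (c : ℕ → ℂ) : euler (const c) = 0 := by
  rw [const_eq, euler_ofSeq, ofSeq_eq_zero]
  exact Filter.Eventually.of_forall fun n => ratFuncEuler_C _

/-- The germ of a sequence of Laurent monomials. -/
noncomputable def monomial (γ : ℕ → ℤ) : RatGerm := ofSeq fun n => RatFunc.X ^ γ n

theorem monomial_add (γ δ : ℕ → ℤ) : monomial (γ + δ) = monomial γ * monomial δ := by
  rw [monomial, monomial, monomial, ← map_mul]
  congr 1
  funext n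
  exact zpow_add₀ RatFunc.X_ne_zero _ _

theorem monomial_neg (γ : ℕ → ℤ) : monomial (-γ) = (monomial γ)⁻¹ := by
  rw [monomial, monomial, ofSeq_inv]
  congr 1
  funext n
  exact zpow_neg _ _

theorem monomial_zero : monomial 0 = 1 := by
  rw [monomial, ← map_one ofSeq]
  congr 1

theorem monomial_ne_zero (γ : ℕ → ℤ) : monomial γ ≠ 0 :=
  ofSeq_ne_zero.2 (Filter.Eventually.of_forall fun _ => zpow_ne_zero _ RatFunc.X_ne_zero)

theorem euler_monomial (γ : ℕ → ℤ) : euler (monomial γ) = const (fun n => γ n) * monomial γ := by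
  rw [monomial, euler_ofSeq, const_eq, ← map_mul]
  congr 1
  funext n
  rw [ratFuncEuler_X_zpow, Pi.mul_apply, map_intCast]

theorem deg_monomial (γ : ℕ → ℤ) : deg (monomial γ) = Hyperreal.ofSeq fun n => (γ n : ℝ) := by
  refine Filter.Germ.coe_eq.2 (Filter.Eventually.of_forall fun n => ?_)
  change ((RatFunc.intDegree ((RatFunc.X : RatFunc ℂ) ^ γ n) : ℤ) : ℝ) = γ n
  norm_cast
  obtain ⟨k, hk | hk⟩ := (γ n).eq_nat_or_neg <;> rw [hk]
  · rw [zpow_natCast, ← RatFunc.algebraMap_X, ← map_pow, RatFunc.intDegree_polynomial,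
      natDegree_X_pow]
  · rw [zpow_neg, zpow_natCast, RatFunc.intDegree_inv, ← RatFunc.algebraMap_X, ← map_pow,
      RatFunc.intDegree_polynomial, natDegree_X_pow]

theorem height_monomial_le (γ : ℕ → ℤ) :
    height (monomial γ) ≤ |Hyperreal.ofSeq fun n => (γ n : ℝ)| := by
  have h : |Hyperreal.ofSeq fun n => (γ n : ℝ)| = Hyperreal.ofSeq fun n => |(γ n : ℝ)| :=
    Filter.Germ.abs_def _
  rw [h]
  refine Hyperreal.ofSeq_le_ofSeq.2 (Filter.Eventually.of_forall fun n => ?_)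
  have := ratHeight_X_zpow_le (K := ℂ) (γ n)
  rw [← Int.cast_abs, Int.abs_eq_natAbs]
  have h' : (ratHeight ((RatFunc.X : RatFunc ℂ) ^ γ n) : ℝ) ≤ ((γ n).natAbs : ℤ) := by
    exact_mod_cast this
  exact h'

theorem height_le_of_sum_eq_zero {d : ℕ} {a : ℕ → RatGerm}
    (ha : ∃ i ∈ Finset.range d, a i ≠ 0) {g : RatGerm}
    (hg : ∑ i ∈ Finset.range d, a i * g ^ i = 0) :
    height g ≤ ∑ i ∈ Finset.range d, height (a i) := by
  choose f hf using fun i => ofSeq_surjective (a i)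
  obtain rfl : a = fun i => ofSeq (f i) := funext fun i => (hf i).symm
  obtain ⟨u, rfl⟩ := ofSeq_surjective g
  obtain ⟨i, hi, hi0⟩ := ha
  simp only [← map_pow, ← map_mul, ← map_sum] at hg
  have h : ∑ i ∈ Finset.range d, height (ofSeq (f i)) =
      Hyperreal.ofSeq fun n => ((∑ i ∈ Finset.range d, ratHeight (f i n) : ℕ) : ℝ) := by
    clear hg hi hi0 hf
    induction d with
    | zero =>
      simp only [Finset.range_zero, Finset.sum_empty, Nat.cast_zero]
      rfl
    | succ d ih =>
      rw [Finset.sum_range_succ, ih]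
      simp only [Finset.sum_range_succ, Nat.cast_add]
      rfl
  rw [h]
  refine Hyperreal.ofSeq_le_ofSeq.2 ?_
  filter_upwards [ofSeq_ne_zero.1 hi0, ofSeq_eq_zero.1 hg] with n hn hn'
  rw [Finset.sum_apply] at hn'
  exact (Nat.cast_le (α := ℝ)).2
    (ratHeight_le_of_sum_eq_zero (a := fun i => f i n) ⟨i, hi, hn⟩ hn')

end RatGerm

namespace ArchimedeanClass

variable {R : Type*} [Field R] [LinearOrder R] [IsStrictOrderedRing R]

theorem mk_div_nonneg_iff {x N : R} (hN : N ≠ 0) : 0 ≤ mk (x / N) ↔ mk N ≤ mk x := by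
  have hN' : 0 < |N| := abs_pos.2 hN
  rw [← mk_one, mk_le_mk, mk_le_mk]
  refine exists_congr fun n => ?_
  rw [abs_div, div_le_iff₀ hN', abs_one, nsmul_eq_mul, nsmul_eq_mul, mul_one]

theorem mk_div_pos_iff {x N : R} (hN : N ≠ 0) : 0 < mk (x / N) ↔ mk N < mk x := by
  have hN' : 0 < |N| := abs_pos.2 hN
  rw [← mk_one, mk_lt_mk, mk_lt_mk]
  refine forall_congr' fun n => ?_
  rw [abs_div, abs_one, nsmul_eq_mul, nsmul_eq_mul, mul_div_assoc', div_lt_one hN']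

end ArchimedeanClass

namespace RatGerm

open ArchimedeanClass

theorem mk_height_le_mk_of_height_le {a : RatGerm} {x : Hyperreal} (h : height a ≤ x) :
    mk x ≤ mk (height a) := by
  refine mk_le_mk_of_abs ?_
  rw [abs_of_nonneg (height_nonneg a)]
  exact h.trans (le_abs_self x)

theorem mk_height_le_mk_deg (a : RatGerm) : mk (height a) ≤ mk (deg a) := by
  refine mk_le_mk_of_abs ?_
  rw [abs_of_nonneg (height_nonneg a)]
  exact abs_deg_le a

theorem min_le_of_height_le_add {a b c : RatGerm} (h : height c ≤ height a + height b) :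
    min (mk (height a)) (mk (height b)) ≤ mk (height c) :=
  (min_le_mk_add _ _).trans (mk_height_le_mk_of_height_le h)

/-- The germs whose height has archimedean class in an upper set. -/
def heightSubfield (s : Set (ArchimedeanClass Hyperreal)) (hs : IsUpperSet s) (hs' : ⊤ ∈ s) :
    Subfield RatGerm where
  carrier := {a | mk (height a) ∈ s}
  zero_mem' := by
    change mk (height 0) ∈ s
    rwa [← map_zero const, height_const, mk_zero]
  one_mem' := by
    change mk (height 1) ∈ s
    rwa [← map_one const, height_const, mk_zero]
  add_mem' {a b} ha hb := by
    refine hs (min_le_of_height_le_add (height_add_le a b)) ?_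
    rcases min_choice (mk (height a)) (mk (height b)) with h | h <;> rwa [h]
  mul_mem' {a b} ha hb := by
    refine hs (min_le_of_height_le_add (height_mul_le a b)) ?_
    rcases min_choice (mk (height a)) (mk (height b)) with h | h <;> rwa [h]
  neg_mem' {a} ha := hs (mk_height_le_mk_of_height_le (height_neg_le a)) ha
  inv_mem' a ha := hs (mk_height_le_mk_of_height_le (height_inv_le a)) ha

variable {s : Set (ArchimedeanClass Hyperreal)} {hs : IsUpperSet s} {hs' : ⊤ ∈ s}

theorem mem_heightSubfield {a : RatGerm} : a ∈ heightSubfield s hs hs' ↔ mk (height a) ∈ s :=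
  Iff.rfl

theorem const_mem_heightSubfield (c : ℕ → ℂ) : const c ∈ heightSubfield s hs hs' := by
  rwa [mem_heightSubfield, height_const, mk_zero]

theorem monomial_mem_heightSubfield {γ : ℕ → ℤ}
    (hγ : mk (Hyperreal.ofSeq fun n => (γ n : ℝ)) ∈ s) : monomial γ ∈ heightSubfield s hs hs' := by
  refine hs ?_ hγ
  rw [← mk_abs]
  exact mk_height_le_mk_of_height_le (height_monomial_le γ)

theorem euler_mem_heightSubfield {a : RatGerm} (ha : a ∈ heightSubfield s hs hs') :
    euler a ∈ heightSubfield s hs hs' := by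
  refine hs (min_le_of_height_le_add (height_euler_le a)) ?_
  rwa [min_self]

theorem mem_heightSubfield_of_isAlgebraic {g : RatGerm}
    (hg : IsAlgebraic (heightSubfield s hs hs') g) : g ∈ heightSubfield s hs hs' := by
  obtain ⟨p, hp, hpg⟩ := hg
  rw [aeval_eq_sum_range] at hpg
  have h := height_le_of_sum_eq_zero (a := fun i => (p.coeff i : RatGerm)) (g := g)
    (d := p.natDegree + 1) ⟨p.natDegree, by simp, fun h0 => hp <| by
      rw [← leadingCoeff_eq_zero]
      exact Subtype.ext h0⟩ hpg
  refine hs (mk_height_le_mk_of_height_le h) ?_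
  have : ∀ d, mk (∑ i ∈ Finset.range d, height (p.coeff i : RatGerm)) ∈ s := by
    intro d
    induction d with
    | zero => rwa [Finset.sum_range_zero, mk_zero]
    | succ d ih =>
      rw [Finset.sum_range_succ]
      refine hs (min_le_mk_add _ _) ?_
      rcases min_choice (mk (∑ i ∈ Finset.range d, height (p.coeff i : RatGerm)))
        (mk (height (p.coeff d : RatGerm))) with h | h <;> rw [h]
      · exact ih
      · exact (p.coeff d).2
  exact this _

/-- The exponential of the degree at infinity, on the scale given by `N`. -/
noncomputable def degreeValuation (N : Hyperreal) (a : RatGerm) : ℝ :=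
  open Classical in if a = 0 then 0 else Real.exp (stdPart (deg a / N))

variable {N : Hyperreal}

theorem degreeValuation_zero : degreeValuation N 0 = 0 := if_pos rfl

theorem degreeValuation_of_ne_zero {a : RatGerm} (ha : a ≠ 0) :
    degreeValuation N a = Real.exp (stdPart (deg a / N)) := if_neg ha

theorem degreeValuation_pos {a : RatGerm} (ha : a ≠ 0) : 0 < degreeValuation N a := by
  rw [degreeValuation_of_ne_zero ha]
  exact Real.exp_pos _

theorem degreeValuation_nonneg (a : RatGerm) : 0 ≤ degreeValuation N a := by
  by_cases ha : a = 0
  · rw [ha, degreeValuation_zero]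
  · exact (degreeValuation_pos ha).le

theorem degreeValuation_mul (hN : 0 < N) {a b : RatGerm} (ha : mk N ≤ mk (deg a))
    (hb : mk N ≤ mk (deg b)) :
    degreeValuation N (a * b) = degreeValuation N a * degreeValuation N b := by
  by_cases ha0 : a = 0
  · rw [ha0, zero_mul, degreeValuation_zero, zero_mul]
  by_cases hb0 : b = 0
  · rw [hb0, mul_zero, degreeValuation_zero, mul_zero]
  rw [degreeValuation_of_ne_zero ha0, degreeValuation_of_ne_zero hb0,
    degreeValuation_of_ne_zero (mul_ne_zero ha0 hb0), ← Real.exp_add, deg_mul ha0 hb0, add_div,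
    stdPart_add ((mk_div_nonneg_iff hN.ne').2 ha) ((mk_div_nonneg_iff hN.ne').2 hb)]

theorem degreeValuation_le_of_deg_le (hN : 0 < N) {a b : RatGerm} (hb0 : b ≠ 0)
    (ha : mk N ≤ mk (deg a)) (hb : mk N ≤ mk (deg b)) (h : deg a ≤ deg b) :
    degreeValuation N a ≤ degreeValuation N b := by
  by_cases ha0 : a = 0
  · rw [ha0, degreeValuation_zero]
    exact degreeValuation_nonneg b
  rw [degreeValuation_of_ne_zero ha0, degreeValuation_of_ne_zero hb0, Real.exp_le_exp]
  exact stdPart_monotoneOn ((mk_div_nonneg_iff hN.ne').2 ha) ((mk_div_nonneg_iff hN.ne').2 hb)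
    (div_le_div_of_nonneg_right h hN.le)

theorem degreeValuation_add (hN : 0 < N) {a b : RatGerm} (ha : mk N ≤ mk (deg a))
    (hb : mk N ≤ mk (deg b)) (hab : mk N ≤ mk (deg (a + b))) :
    degreeValuation N (a + b) ≤ max (degreeValuation N a) (degreeValuation N b) := by
  by_cases ha0 : a = 0
  · rw [ha0, zero_add]
    exact le_max_right _ _
  by_cases hb0 : b = 0
  · rw [hb0, add_zero]
    exact le_max_left _ _
  by_cases hab0 : a + b = 0
  · rw [hab0, degreeValuation_zero]
    exact (degreeValuation_nonneg a).trans (le_max_left _ _)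
  rcases le_max_iff.1 (deg_add_le hb0 hab0) with h | h
  · exact (degreeValuation_le_of_deg_le hN ha0 hab ha h).trans (le_max_left _ _)
  · exact (degreeValuation_le_of_deg_le hN hb0 hab hb h).trans (le_max_right _ _)

theorem degreeValuation_euler_le (hN : 0 < N) {a : RatGerm} (ha : mk N ≤ mk (deg a))
    (ha' : mk N ≤ mk (deg (euler a))) :
    degreeValuation N (euler a) ≤ degreeValuation N a := by
  by_cases h : euler a = 0
  · rw [h, degreeValuation_zero]
    exact degreeValuation_nonneg a
  · refine degreeValuation_le_of_deg_le hN ?_ ha' ha (deg_euler_le h)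
    rintro rfl
    exact h (map_zero euler)

theorem degreeValuation_euler_eq {a : RatGerm} (ha : degreeValuation N a ≠ 1) :
    degreeValuation N (euler a) = degreeValuation N a := by
  by_cases h0 : a = 0
  · rw [h0, map_zero]
  have h : deg a ≠ 0 := by
    intro h
    rw [degreeValuation_of_ne_zero h0, h, zero_div, stdPart_zero, Real.exp_zero] at ha
    exact ha rfl
  rw [degreeValuation_of_ne_zero h0, degreeValuation_of_ne_zero (deg_euler_eq h).1,
    (deg_euler_eq h).2]

theorem degreeValuation_eq_one_iff (hN : 0 < N) {a : RatGerm} (ha0 : a ≠ 0)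
    (ha : mk N ≤ mk (deg a)) : degreeValuation N a = 1 ↔ mk N < mk (deg a) := by
  rw [degreeValuation_of_ne_zero ha0, Real.exp_eq_one_iff, stdPart_eq_zero,
    ← mk_div_pos_iff hN.ne', ne_comm, lt_iff_le_and_ne,
    and_iff_right ((mk_div_nonneg_iff hN.ne').2 ha)]

end RatGerm

theorem Subring.exists_isIntegral_mul_of_isAlgebraic {E : Type*} [Field E] {A : Subring E}
    {k : Subfield E} (hle : A ≤ k.toSubring) (hk : ∀ z ∈ k, ∃ x ∈ A, ∃ y ∈ A, x / y = z) {g : E}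
    (hg : IsAlgebraic k g) : ∃ y ∈ A, y ≠ 0 ∧ IsIntegral A (y * g) := by
  let := (Subring.inclusion hle).toAlgebra
  have : IsScalarTower A k E := IsScalarTower.of_algebraMap_eq fun _ => rfl
  have : FaithfulSMul A k :=
    (faithfulSMul_iff_algebraMap_injective _ _).2 (Subring.inclusion_injective hle)
  have : IsFractionRing A k := by
    refine IsFractionRing.of_field _ _ fun z => ?_
    obtain ⟨x, hx, y, hy, h⟩ := hk z z.2
    exact ⟨⟨x, hx⟩, ⟨y, hy⟩, Subtype.ext h.symm⟩
  obtain ⟨y, hy0, hy⟩ := ((IsFractionRing.isAlgebraic_iff A k E).2 hg).exists_integral_multiple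
  exact ⟨y, y.2, fun h => hy0 (Subtype.ext h), hy⟩

theorem exists_isIntegral_mul_of_isAlgebraic_closure {E : Type*} [Field E] {S : Set E} {g : E}
    (hg : IsAlgebraic (Subfield.closure S) g) :
    ∃ y ∈ Subring.closure S, y ≠ 0 ∧ IsIntegral (Subring.closure S) (y * g) :=
  Subring.exists_isIntegral_mul_of_isAlgebraic (Subring.closure_le.2 Subfield.subset_closure)
    (fun _ hz => Subfield.mem_closure_iff.1 hz) hg

namespace RatGerm

/-- The germs of sequences of bounded lacunary complexity. -/
def lacunarySubfield : Subfield RatGerm where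
  carrier := {a | ∃ (B : ℕ) (f : ℕ → RatFunc ℂ), a = ofSeq f ∧ ∀ n, Nsharp (f n) ≤ B}
  zero_mem' := ⟨2, fun _ => RatFunc.C 0, by rw [← map_zero const, const_eq]; rfl,
    fun _ => Nsharp_C_le 0⟩
  one_mem' := ⟨2, fun _ => RatFunc.C 1, by rw [← map_one const, const_eq]; rfl,
    fun _ => Nsharp_C_le 1⟩
  add_mem' := by
    rintro _ _ ⟨B, f, rfl, hf⟩ ⟨B', g, rfl, hg⟩
    exact ⟨3 * (B * B'), f + g, (map_add ofSeq f g).symm, fun n => (Nsharp_add_le _ _).trans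
      (Nat.mul_le_mul_left _ (Nat.mul_le_mul (hf n) (hg n)))⟩
  mul_mem' := by
    rintro _ _ ⟨B, f, rfl, hf⟩ ⟨B', g, rfl, hg⟩
    exact ⟨2 * (B * B'), f * g, (map_mul ofSeq f g).symm, fun n => (Nsharp_mul_le _ _).trans
      (Nat.mul_le_mul_left _ (Nat.mul_le_mul (hf n) (hg n)))⟩
  neg_mem' := by
    rintro _ ⟨B, f, rfl, hf⟩
    refine ⟨2 * (2 * B), fun n => RatFunc.C (-1) * f n, ?_, fun n => (Nsharp_mul_le _ _).trans
      (Nat.mul_le_mul_left _ (Nat.mul_le_mul (Nsharp_C_le _) (hf n)))⟩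
    rw [← map_neg]
    congr 1
    funext n
    rw [map_neg, map_one, neg_one_mul, Pi.neg_apply]
  inv_mem' := by
    rintro _ ⟨B, f, rfl, hf⟩
    exact ⟨B, fun n => (f n)⁻¹, ofSeq_inv f, fun n => (Nsharp_inv_le _).trans (hf n)⟩

theorem const_mem_lacunarySubfield (c : ℕ → ℂ) : const c ∈ lacunarySubfield :=
  ⟨2, _, const_eq c, fun _ => Nsharp_C_le _⟩

theorem monomial_mem_lacunarySubfield (γ : ℕ → ℤ) : monomial γ ∈ lacunarySubfield :=
  ⟨2, _, rfl, fun _ => Nsharp_X_zpow_le _⟩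

/-- The germs of sequences of Laurent polynomials. -/
def laurentSubring : Subring RatGerm where
  carrier := {a | ∃ f : ℕ → RatFunc ℂ, a = ofSeq f ∧ ∀ n, f n ∈ laurentSubalgebra ℂ}
  zero_mem' := ⟨0, (map_zero ofSeq).symm, fun _ => zero_mem _⟩
  one_mem' := ⟨1, (map_one ofSeq).symm, fun _ => one_mem _⟩
  add_mem' := by
    rintro _ _ ⟨f, rfl, hf⟩ ⟨g, rfl, hg⟩
    exact ⟨f + g, (map_add ofSeq f g).symm, fun n => add_mem (hf n) (hg n)⟩
  mul_mem' := by
    rintro _ _ ⟨f, rfl, hf⟩ ⟨g, rfl, hg⟩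
    exact ⟨f * g, (map_mul ofSeq f g).symm, fun n => mul_mem (hf n) (hg n)⟩
  neg_mem' := by
    rintro _ ⟨f, rfl, hf⟩
    exact ⟨-f, (map_neg ofSeq f).symm, fun n => neg_mem (hf n)⟩

theorem const_mem_laurentSubring (c : ℕ → ℂ) : const c ∈ laurentSubring :=
  ⟨_, const_eq c, fun _ => C_mem_laurentSubalgebra _⟩

theorem monomial_mem_laurentSubring (γ : ℕ → ℤ) : monomial γ ∈ laurentSubring :=
  ⟨_, rfl, fun _ => X_zpow_mem_laurentSubalgebra _⟩

theorem mem_laurentSubring_of_isIntegral {A : Subring RatGerm} (hA : A ≤ laurentSubring)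
    {a : RatGerm} (ha : IsIntegral A a) : a ∈ laurentSubring := by
  obtain ⟨p, hp, hpa⟩ := ha
  choose f hf hf' using fun i => hA (p.coeff i).2
  obtain ⟨u, rfl⟩ := ofSeq_surjective a
  rw [hp.as_sum, eval₂_add, eval₂_X_pow, eval₂_finsetSum] at hpa
  have h : ofSeq (u ^ p.natDegree + ∑ i ∈ Finset.range p.natDegree, f i * u ^ i) = 0 := by
    rw [← hpa, map_add, map_pow, map_sum]
    congr 1
    refine Finset.sum_congr rfl fun i _ => ?_
    rw [eval₂_mul, eval₂_C, eval₂_X_pow, map_mul, ← hf, map_pow]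
    rfl
  have h' : ∀ᶠ n in Filter.hyperfilter ℕ, ∃ w ∈ laurentSubalgebra ℂ, u n = w := by
    filter_upwards [ofSeq_eq_zero.1 h] with n hn
    refine ⟨u n, ?_, rfl⟩
    refine mem_laurentSubalgebra_of_pow_add_sum_eq_zero (a := fun i => f i n)
      (fun i _ => hf' i n) (n := p.natDegree) ?_
    simpa [Finset.sum_apply] using hn
  have h'' : ∀ᶠ n in Filter.hyperfilter ℕ, ∃ w : laurentSubalgebra ℂ, u n = w := by
    filter_upwards [h'] with n ⟨w, hw, hn⟩
    exact ⟨⟨w, hw⟩, hn⟩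
  choose w hw using h''.choice
  exact ⟨fun n => w n, ofSeq_eq_ofSeq.2 hw, fun n => (w n).2⟩

end RatGerm

theorem LaurentBound.ratHeight_le {K : Type*} [Field K] {D e : ℕ} {f : RatFunc K}
    (hf : LaurentBound D e f) : ratHeight f ≤ 2 * D + e := by
  obtain ⟨v, p, hv, hve, hp, h⟩ := hf
  have hvX : v * X ^ D ≠ 0 := mul_ne_zero hv (pow_ne_zero _ X_ne_zero)
  have hf' : f = algebraMap K[X] (RatFunc K) p / algebraMap K[X] (RatFunc K) (v * X ^ D) := by
    rw [eq_div_iff (RatFunc.algebraMap_ne_zero hvX), ← h, map_mul, map_pow, RatFunc.algebraMap_X]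
    ring
  rw [hf']
  refine (ratHeight_div_le p hvX).trans (max_le hp ?_)
  rw [natDegree_mul hv (pow_ne_zero _ X_ne_zero), natDegree_X_pow]
  lia

theorem Subfield.map_mem_closure {E : Type*} [Field E] (Θ : Derivation ℤ E E) {S : Set E}
    (hS : ∀ s ∈ S, Θ s ∈ Subfield.closure S) {x : E} (hx : x ∈ Subfield.closure S) :
    Θ x ∈ Subfield.closure S := by
  refine Subfield.closure_induction (p := fun x _ => Θ x ∈ Subfield.closure S) hS ?_ ?_ ?_ ?_ ?_ hx
  · rw [Derivation.map_one_eq_zero]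
    exact zero_mem _
  · intro x y _ _ hx hy
    rw [map_add]
    exact add_mem hx hy
  · intro x _ hx
    rw [map_neg]
    exact neg_mem hx
  · intro x hx' hx
    rw [Derivation.leibniz_inv, smul_eq_mul]
    exact mul_mem (neg_mem (pow_mem (inv_mem hx') 2)) hx
  · intro x y hx' hy' hx hy
    rw [Derivation.leibniz, smul_eq_mul, smul_eq_mul]
    exact add_mem (mul_mem hx' hy) (mul_mem hy' hx)

namespace RatGerm

open ArchimedeanClass

/-- The hyperreal number given by a sequence of integers. -/
noncomputable def intGerm : (ℕ → ℤ) →+* Hyperreal where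
  toFun γ := Hyperreal.ofSeq fun n => (γ n : ℝ)
  map_zero' := Filter.Germ.coe_eq.2 (Filter.Eventually.of_forall fun _ => Int.cast_zero)
  map_one' := Filter.Germ.coe_eq.2 (Filter.Eventually.of_forall fun _ => Int.cast_one)
  map_add' _ _ := Filter.Germ.coe_eq.2 (Filter.Eventually.of_forall fun _ => Int.cast_add _ _)
  map_mul' _ _ := Filter.Germ.coe_eq.2 (Filter.Eventually.of_forall fun _ => Int.cast_mul _ _)

theorem intGerm_apply (γ : ℕ → ℤ) : intGerm γ = Hyperreal.ofSeq fun n => (γ n : ℝ) := rfl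

/-- The monomials whose exponent lies in `H`. -/
def monomials (H : Submodule ℚ Hyperreal) : Set RatGerm :=
  {t | ∃ γ : ℕ → ℤ, intGerm γ ∈ H ∧ t = monomial γ}

/-- The field generated by the constants and by the monomials whose exponent lies in `H`. -/
noncomputable def monomialField (H : Submodule ℚ Hyperreal) : Subfield RatGerm :=
  Subfield.closure (Set.range const ∪ monomials H)

variable {H : Submodule ℚ Hyperreal} {N : Hyperreal}

theorem const_mem_monomialField (c : ℕ → ℂ) : const c ∈ monomialField H :=
  Subfield.subset_closure (Or.inl ⟨c, rfl⟩)

theorem monomial_mem_monomialField {γ : ℕ → ℤ} (hγ : intGerm γ ∈ H) :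
    monomial γ ∈ monomialField H :=
  Subfield.subset_closure (Or.inr ⟨γ, hγ, rfl⟩)

theorem monomialField_le {F : Subfield RatGerm} (hc : ∀ c, const c ∈ F)
    (hm : ∀ γ, intGerm γ ∈ H → monomial γ ∈ F) : monomialField H ≤ F := by
  refine Subfield.closure_le.2 ?_
  rintro _ (⟨c, rfl⟩ | ⟨γ, hγ, rfl⟩)
  · exact hc c
  · exact hm γ hγ

theorem euler_mem_monomialField {a : RatGerm} (ha : a ∈ monomialField H) :
    euler a ∈ monomialField H := by
  refine Subfield.map_mem_closure euler ?_ ha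
  rintro _ (⟨c, rfl⟩ | ⟨γ, hγ, rfl⟩)
  · rw [euler_const]
    exact zero_mem _
  · rw [euler_monomial]
    exact mul_mem (const_mem_monomialField _) (monomial_mem_monomialField hγ)

theorem mk_ofSeq_nat_zero : mk (Hyperreal.ofSeq fun _ => ((0 : ℕ) : ℝ)) = ⊤ := by
  rw [mk_eq_top_iff]
  exact Filter.Germ.coe_eq.2 (Filter.Eventually.of_forall fun _ => Nat.cast_zero)

theorem ofSeq_nat_add (e e' : ℕ → ℕ) : (Hyperreal.ofSeq fun n => ((e n + e' n : ℕ) : ℝ)) =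
    (Hyperreal.ofSeq fun n => (e n : ℝ)) + Hyperreal.ofSeq fun n => (e' n : ℝ) :=
  Filter.Germ.coe_eq.2 (Filter.Eventually.of_forall fun _ => Nat.cast_add _ _)

theorem lt_mk_ofSeq_nat_add {e e' : ℕ → ℕ} (he : mk N < mk (Hyperreal.ofSeq fun n => (e n : ℝ)))
    (he' : mk N < mk (Hyperreal.ofSeq fun n => (e' n : ℝ))) :
    mk N < mk (Hyperreal.ofSeq fun n => ((e n + e' n : ℕ) : ℝ)) := by
  rw [ofSeq_nat_add]
  exact (lt_min he he').trans_le (min_le_mk_add _ _)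

/-- The germs of sequences with at most `D` poles at the origin, and degree at most `D`, up to an
error that is infinitesimal on the scale of `N`. -/
noncomputable def laurentBoundSubmodule {F : Subfield RatGerm} (hF : ∀ c ∈ F, mk N < mk (height c))
    (D : ℕ → ℕ) : Submodule F RatGerm where
  carrier := {h | ∃ e : ℕ → ℕ, mk N < mk (Hyperreal.ofSeq fun n => (e n : ℝ)) ∧
    ∃ f, h = ofSeq f ∧ ∀ n, LaurentBound (D n) (e n) (f n)}
  zero_mem' := by
    refine ⟨fun _ => 0, ?_, 0, (map_zero ofSeq).symm, fun n => LaurentBound.zero _⟩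
    rw [mk_ofSeq_nat_zero, ← mk_zero (M := Hyperreal), ← height_const 0, map_zero]
    exact hF 0 (zero_mem F)
  add_mem' := by
    rintro _ _ ⟨e, he, f, rfl, hf⟩ ⟨e', he', f', rfl, hf'⟩
    exact ⟨fun n => e n + e' n, lt_mk_ofSeq_nat_add he he', f + f', (map_add ofSeq f f').symm,
      fun n => (hf n).add (hf' n)⟩
  smul_mem' := by
    rintro ⟨c, hc⟩ _ ⟨e, he, f, rfl, hf⟩
    obtain ⟨u, rfl⟩ := ofSeq_surjective c
    exact ⟨fun n => e n + ratHeight (u n), lt_mk_ofSeq_nat_add he (hF _ hc), u * f,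
      (map_mul ofSeq u f).symm, fun n => (hf n).mul (u n)⟩

section laurentBoundSubmodule

variable {F : Subfield RatGerm} {hF : ∀ c ∈ F, mk N < mk (height c)} {D : ℕ → ℕ}

theorem euler_mem_laurentBoundSubmodule {a : RatGerm} (ha : a ∈ laurentBoundSubmodule hF D) :
    euler a ∈ laurentBoundSubmodule hF D := by
  obtain ⟨e, he, f, rfl, hf⟩ := ha
  refine ⟨fun n => e n + e n, lt_mk_ofSeq_nat_add he he, _, euler_ofSeq f, fun n => ?_⟩
  have h := (hf n).euler
  rwa [two_mul] at h

theorem mem_heightSubfield_of_mem_laurentBoundSubmodule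
    (hD : mk N ≤ mk (Hyperreal.ofSeq fun n => (D n : ℝ))) {a : RatGerm}
    (ha : a ∈ laurentBoundSubmodule hF D) :
    a ∈ heightSubfield (Set.Ici (mk N)) (isUpperSet_Ici _)
      (Set.mem_Ici.2 le_top) := by
  obtain ⟨e, he, f, rfl, hf⟩ := ha
  have h : height (ofSeq f) ≤ (Hyperreal.ofSeq fun n => (D n : ℝ)) +
      (Hyperreal.ofSeq fun n => (D n : ℝ)) + Hyperreal.ofSeq fun n => (e n : ℝ) := by
    rw [← ofSeq_nat_add, ← ofSeq_nat_add, height_ofSeq]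
    refine Hyperreal.ofSeq_le_ofSeq.2 (Filter.Eventually.of_forall fun n => ?_)
    rw [← two_mul]
    exact Nat.cast_le.2 (hf n).ratHeight_le
  refine mem_heightSubfield.2 (Set.mem_Ici.2 (le_trans ?_ (mk_height_le_mk_of_height_le h)))
  exact (le_min ((le_min hD hD).trans (min_le_mk_add _ _)) he.le).trans (min_le_mk_add _ _)

theorem le_degreeValuation_of_mem_laurentBoundSubmodule (hN : 0 < N)
    (hD : mk N ≤ mk (Hyperreal.ofSeq fun n => (D n : ℝ))) {a : RatGerm}
    (ha : a ∈ laurentBoundSubmodule hF D) (ha0 : a ≠ 0) :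
    Real.exp (-stdPart ((Hyperreal.ofSeq fun n => (D n : ℝ)) / N)) ≤ degreeValuation N a := by
  have hda := (Set.mem_Ici.1 (mem_heightSubfield.1
    (mem_heightSubfield_of_mem_laurentBoundSubmodule hD ha))).trans
    (mk_height_le_mk_deg a)
  obtain ⟨e, he, f, rfl, hf⟩ := ha
  rw [degreeValuation_of_ne_zero ha0, Real.exp_le_exp]
  have h : -((Hyperreal.ofSeq fun n => (D n : ℝ)) + Hyperreal.ofSeq fun n => (e n : ℝ)) ≤
      deg (ofSeq f) := by
    rw [deg_ofSeq]
    refine Hyperreal.ofSeq_le_ofSeq.2 ?_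
    filter_upwards [ofSeq_ne_zero.1 ha0] with n hn
    have h := (Int.cast_le (R := ℝ)).2 ((hf n).le_intDegree hn)
    push_cast at h
    exact h
  have hD' := (mk_div_nonneg_iff hN.ne').2 hD
  have he' := (mk_div_pos_iff hN.ne').2 he
  have h' := stdPart_add_eq_left (x := (Hyperreal.ofSeq fun n => (D n : ℝ)) / N) he'
  rw [← h', ← stdPart_neg, ← add_div, ← neg_div]
  refine stdPart_monotoneOn ?_ ((mk_div_nonneg_iff hN.ne').2 hda)
    (div_le_div_of_nonneg_right h hN.le)
  change 0 ≤ mk (_ : Hyperreal)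
  rw [neg_div, mk_neg, add_div]
  exact (le_min hD' he'.le).trans (min_le_mk_add _ _)

end laurentBoundSubmodule

theorem degreeValuation_eq_iff (hN : 0 < N) {a b : RatGerm} (ha0 : a ≠ 0) (hb0 : b ≠ 0)
    (ha : mk N ≤ mk (deg a)) (hb : mk N ≤ mk (deg b)) :
    degreeValuation N a = degreeValuation N b ↔ mk N < mk (deg a - deg b) := by
  have ha' := (mk_div_nonneg_iff hN.ne').2 ha
  have hb' := (mk_div_nonneg_iff hN.ne').2 hb
  have hab : 0 ≤ mk (deg a / N - deg b / N) := (le_min ha' hb').trans (min_le_mk_sub _ _)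
  rw [degreeValuation_of_ne_zero ha0, degreeValuation_of_ne_zero hb0, Real.exp_eq_exp,
    ← sub_eq_zero, ← stdPart_sub ha' hb', stdPart_eq_zero, ← mk_div_pos_iff hN.ne', sub_div,
    lt_iff_le_and_ne, and_iff_right hab, ne_comm]

variable {Δ : Submodule ℚ Hyperreal}

theorem exists_monomials_degreeValuation_eq (hN : 0 < N) (hH : ∀ h ∈ H, mk N ≤ mk h)
    (hdiv : ∀ (γ δ : ℕ → ℤ) (n : ℕ), 0 < n → intGerm δ ∈ H →
      mk N < mk (n * intGerm γ - intGerm δ) →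
      ∃ γ', intGerm γ' ∈ H ∧ mk N < mk (intGerm γ' - intGerm γ))
    {y : RatGerm} (hy : mk N ≤ mk (deg y)) (hy0 : y ≠ 0) {n : ℕ} (hn : 0 < n) {t : RatGerm}
    (ht : t ∈ monomials H) (h : degreeValuation N y ^ n = degreeValuation N t) :
    ∃ t' ∈ monomials H, degreeValuation N t' = degreeValuation N y := by
  obtain ⟨δ, hδ, rfl⟩ := ht
  have hpow : ∀ n : ℕ, degreeValuation N (y ^ n) = degreeValuation N y ^ n ∧
      mk N ≤ mk (deg (y ^ n)) := by
    intro n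
    induction n with
    | zero =>
      rw [pow_zero, pow_zero, degreeValuation_of_ne_zero one_ne_zero, deg_one, zero_div,
        stdPart_zero, Real.exp_zero, mk_zero]
      exact ⟨rfl, le_top⟩
    | succ n ih =>
      rw [pow_succ, degreeValuation_mul hN ih.2 hy, ih.1, pow_succ, deg_mul (pow_ne_zero n hy0) hy0]
      exact ⟨rfl, (le_min ih.2 hy).trans (min_le_mk_add _ _)⟩
  have hmk : ∀ γ, intGerm γ ∈ H → mk N ≤ mk (deg (monomial γ)) := by
    intro γ hγ
    rw [deg_monomial]
    exact hH _ hγ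
  rw [← (hpow n).1, degreeValuation_eq_iff hN (pow_ne_zero n hy0) (monomial_ne_zero δ) (hpow n).2
    (hmk δ hδ), deg_pow hy0, deg_monomial] at h
  obtain ⟨f, rfl⟩ := ofSeq_surjective y
  obtain ⟨γ', hγ', h'⟩ := hdiv (fun n => (f n).intDegree) δ n hn hδ h
  refine ⟨monomial γ', ⟨γ', hγ', rfl⟩, ?_⟩
  rw [degreeValuation_eq_iff hN (monomial_ne_zero γ') hy0 (hmk γ' hγ') hy, deg_monomial]
  exact h'

theorem mem_lacunarySubfield_of_isAlgebraic_of_forall (hN : 0 < N) (hH : ∀ h ∈ H, mk N ≤ mk h)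
    (hΔ : ∀ h, h ∈ Δ ↔ h ∈ H ∧ mk N < mk h) (hNtop : mk N < ⊤)
    (hne : ∃ γ, intGerm γ ∈ H ∧ ¬ mk N < mk (intGerm γ))
    (hdiv : ∀ (γ δ : ℕ → ℤ) (n : ℕ), 0 < n → intGerm δ ∈ H →
      mk N < mk (n * intGerm γ - intGerm δ) →
      ∃ γ', intGerm γ' ∈ H ∧ mk N < mk (intGerm γ' - intGerm γ))
    (hlac : ∀ g, IsAlgebraic (monomialField Δ) g → g ∈ lacunarySubfield)
    {g : RatGerm} (hg : IsAlgebraic (monomialField H) g) : g ∈ lacunarySubfield := by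
  have hs' : (⊤ : ArchimedeanClass Hyperreal) ∈ Set.Ici (mk N) := Set.mem_Ici.2 le_top
  have hs'' : (⊤ : ArchimedeanClass Hyperreal) ∈ Set.Ioi (mk N) := Set.mem_Ioi.2 hNtop
  set M := heightSubfield (Set.Ici (mk N)) (isUpperSet_Ici _) hs' with hM
  set M' := heightSubfield (Set.Ioi (mk N)) (isUpperSet_Ioi _) hs'' with hM'
  have hMd : ∀ a ∈ M, mk N ≤ mk (deg a) := fun a ha =>
    (Set.mem_Ici.1 (mem_heightSubfield.1 ha)).trans (mk_height_le_mk_deg a)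
  have hHM : monomialField H ≤ M := monomialField_le const_mem_heightSubfield
    fun γ hγ => monomial_mem_heightSubfield (Set.mem_Ici.2 (hH _ hγ))
  have hΔM' : monomialField Δ ≤ M' := monomialField_le const_mem_heightSubfield
    fun γ hγ => monomial_mem_heightSubfield (Set.mem_Ioi.2 ((hΔ _).1 hγ).2)
  have hΘ₀ : ∀ c ∈ monomialField Δ, euler c ∈ monomialField Δ := fun c hc =>
    euler_mem_monomialField hc
  have hcΔ : ∀ c, const c ∈ monomialField Δ := const_mem_monomialField
  have hmΔ : ∀ γ, intGerm γ ∈ Δ → monomial γ ∈ monomialField Δ :=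
    fun γ hγ => monomial_mem_monomialField hγ
  generalize hk : monomialField Δ = k at *
  set F := (algebraicClosure k RatGerm).toSubfield with hFdef
  have hF : ∀ y, y ∈ F ↔ IsAlgebraic k y := fun y => mem_algebraicClosure_iff
  have hkF : k ≤ F := fun c hc => (hF c).2 (isAlgebraic_algebraMap (⟨c, hc⟩ : k))
  have hFM' : ∀ c ∈ F, mk N < mk (height c) := fun c hc =>
    Set.mem_Ioi.1 (mem_heightSubfield.1
      (mem_heightSubfield_of_isAlgebraic (((hF c).1 hc).mono_subfield hΔM')))
  have hΘF : ∀ c ∈ F, euler c ∈ F := by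
    intro c hc
    have hfd := IntermediateField.adjoin.finiteDimensional ((hF c).1 hc).isIntegral
    have h1 := derivation_mem_adjoin euler hΘ₀ ((hF c).1 hc)
    exact (hF _).2 (Algebra.IsAlgebraic.isAlgebraic (R := k)
      (⟨_, h1⟩ : IntermediateField.adjoin k {c})).algebraMap
  have hconstF : ∀ c, const c ∈ F := fun c => hkF (hcΔ c)
  have hTM : ∀ t ∈ monomials H, t ∈ M := by
    rintro _ ⟨γ, hγ, rfl⟩
    exact hHM (monomial_mem_monomialField hγ)
  have hHFT : monomialField H ≤ Subfield.closure ((F : Set RatGerm) ∪ monomials H) :=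
    monomialField_le (fun c => Subfield.subset_closure (Or.inl (hconstF c)))
      fun γ hγ => Subfield.subset_closure (Or.inr ⟨γ, hγ, rfl⟩)
  obtain ⟨y, hy, hy0, hyint⟩ := exists_isIntegral_mul_of_isAlgebraic_closure hg
  have hylac : y ∈ lacunarySubfield := by
    refine Subring.closure_le (t := lacunarySubfield.toSubring).2 ?_ hy
    rintro _ (⟨c, rfl⟩ | ⟨γ, hγ, rfl⟩)
    · exact const_mem_lacunarySubfield c
    · exact monomial_mem_lacunarySubfield γ
  have hyH : y ∈ monomialField H :=
    Subring.closure_le (t := (monomialField H).toSubring).2 Subfield.subset_closure hy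
  have hsL : y * g ∈ laurentSubring := by
    refine mem_laurentSubring_of_isIntegral (Subring.closure_le.2 ?_) hyint
    rintro _ (⟨c, rfl⟩ | ⟨γ, hγ, rfl⟩)
    · exact const_mem_laurentSubring c
    · exact monomial_mem_laurentSubring γ
  have hsalg : IsAlgebraic (monomialField H) (y * g) :=
    (isAlgebraic_algebraMap (⟨y, hyH⟩ : monomialField H)).mul hg
  generalize hkH : monomialField H = kH at *
  have hsM : y * g ∈ M := mem_heightSubfield_of_isAlgebraic (hsalg.mono_subfield hHM)
  obtain ⟨s, hs, hsl⟩ := hsL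
  have hD : mk N ≤ mk (Hyperreal.ofSeq fun n => (ratHeight (s n) : ℝ)) := by
    rw [hs] at hsM
    exact hsM
  have hspan : y * g ∈ Submodule.span F (monomials H) := by
    refine mem_span_of_isAlgebraic_subfield euler M (degreeValuation N) degreeValuation_zero
      (fun h _ => degreeValuation_pos) (fun a ha b hb => degreeValuation_mul hN (hMd a ha) (hMd b hb))
      (fun a ha b hb => degreeValuation_add hN (hMd a ha) (hMd b hb) (hMd _ (add_mem ha hb)))
      (fun a ha => euler_mem_heightSubfield ha)
      (fun a ha => degreeValuation_euler_le hN (hMd a ha) (hMd _ (euler_mem_heightSubfield ha)))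
      (fun a _ => degreeValuation_euler_eq) (F := F)
      (fun c hc => mem_heightSubfield.2 (Set.mem_Ici.2 (hFM' c hc).le)) ?_ hΘF ?_ hTM ?_ ?_ ?_ ?_ ?_
      ?_ ?_ ?_ (laurentBoundSubmodule hFM' fun n => ratHeight (s n))
      (fun u hu => mem_heightSubfield_of_mem_laurentBoundSubmodule hD hu)
      (fun u hu => euler_mem_laurentBoundSubmodule hu) (Real.exp_pos _)
      (fun u hu hu0 => le_degreeValuation_of_mem_laurentBoundSubmodule hN hD hu hu0) ?_
      (hsalg.mono_subfield hHFT)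
    · intro c hc hc0
      have h := hFM' c hc
      rw [degreeValuation_eq_one_iff hN hc0 (h.le.trans (mk_height_le_mk_deg c))]
      exact h.trans_le (mk_height_le_mk_deg c)
    · exact fun y _ hy => (hF y).2 (isAlgebraic_of_isAlgebraic_algebraicClosure hF hy)
    · rintro _ ⟨γ, hγ, rfl⟩
      exact monomial_ne_zero γ
    · refine ⟨0, ?_, monomial_zero.symm⟩
      rw [map_zero]
      exact zero_mem H
    · rintro _ ⟨γ, hγ, rfl⟩ _ ⟨γ', hγ', rfl⟩
      refine ⟨γ + γ', ?_, (monomial_add γ γ').symm⟩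
      rw [map_add]
      exact add_mem hγ hγ'
    · rintro _ ⟨γ, hγ, rfl⟩
      refine ⟨-γ, ?_, (monomial_neg γ).symm⟩
      rw [map_neg]
      exact neg_mem hγ
    · rintro _ ⟨γ, hγ, rfl⟩
      exact ⟨_, hconstF _, euler_monomial γ⟩
    · rintro t ht h
      have ht' := hMd t (hTM t ht)
      obtain ⟨γ, hγ, rfl⟩ := ht
      rw [degreeValuation_eq_one_iff hN (monomial_ne_zero γ) ht', deg_monomial] at h
      exact hkF (hmΔ γ ((hΔ _).2 ⟨hγ, h⟩))
    · intro y hy hy0 n hn t ht h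
      exact exists_monomials_degreeValuation_eq hN hH hdiv (hMd y hy) hy0 hn ht h
    · obtain ⟨γ, hγ, h⟩ := hne
      refine ⟨monomial γ, ⟨γ, hγ, rfl⟩, fun h1 => h ?_⟩
      rw [degreeValuation_eq_one_iff hN (monomial_ne_zero γ) (hMd _ (hTM _ ⟨γ, hγ, rfl⟩)),
        deg_monomial] at h1
      exact h1
    · refine ⟨fun _ => 0, ?_, s, hs, fun n => .of_mem_laurentSubalgebra (hsl n)⟩
      rwa [mk_ofSeq_nat_zero]
  have hslac : y * g ∈ lacunarySubfield := by
    refine Submodule.span_induction (p := fun x _ => x ∈ lacunarySubfield) ?_ (zero_mem _)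
      (fun a b _ _ ha hb => add_mem ha hb) (fun (c : F) a _ ha => mul_mem (hlac c ((hF c).1 c.2)) ha) hspan
    rintro _ ⟨γ, hγ, rfl⟩
    exact monomial_mem_lacunarySubfield γ
  rw [← inv_mul_cancel_left₀ hy0 g]
  exact mul_mem (inv_mem hylac) hslac

end RatGerm

theorem Submodule.FG.exists_mk_le {R : Type*} [Field R] [LinearOrder R] [IsStrictOrderedRing R]
    {H : Submodule ℚ R} (hH : H.FG) :
    ∃ N ∈ H, ∀ h ∈ H, ArchimedeanClass.mk N ≤ ArchimedeanClass.mk h := by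
  induction H, hH using Submodule.fg_induction with
  | singleton x =>
    refine ⟨x, Submodule.mem_span_singleton_self x, fun h hh => ?_⟩
    obtain ⟨q, rfl⟩ := Submodule.mem_span_singleton.1 hh
    exact ArchimedeanClass.mk_le_mk_smul x q
  | sup H₁ H₂ _ _ ih₁ ih₂ =>
    obtain ⟨N₁, hN₁, h₁⟩ := ih₁
    obtain ⟨N₂, hN₂, h₂⟩ := ih₂
    have key : ∀ h ∈ H₁ ⊔ H₂, min (ArchimedeanClass.mk N₁) (ArchimedeanClass.mk N₂) ≤
        ArchimedeanClass.mk h := by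
      intro h hh
      obtain ⟨a, ha, b, hb, rfl⟩ := Submodule.mem_sup.1 hh
      exact (min_le_min (h₁ a ha) (h₂ b hb)).trans (ArchimedeanClass.min_le_mk_add _ _)
    rcases min_choice (ArchimedeanClass.mk N₁) (ArchimedeanClass.mk N₂) with h | h <;>
      rw [h] at key
    · exact ⟨N₁, le_sup_left (a := H₁) hN₁, key⟩
    · exact ⟨N₂, le_sup_right (a := H₁) hN₂, key⟩

namespace RatGerm

open ArchimedeanClass

variable {H : Submodule ℚ Hyperreal} {N : Hyperreal}

theorem intGerm_eq_zero_of_pos_mk {γ : ℕ → ℤ} (h : 0 < mk (intGerm γ)) : intGerm γ = 0 := by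
  rw [← mk_one, mk_lt_mk] at h
  have h1 := h 1
  rw [one_smul, abs_one, intGerm_apply] at h1
  have h2 : |Hyperreal.ofSeq fun n => (γ n : ℝ)| = Hyperreal.ofSeq fun n => |(γ n : ℝ)| :=
    Filter.Germ.abs_def _
  rw [h2] at h1
  have h1' : (Hyperreal.ofSeq fun n => |(γ n : ℝ)|) < Hyperreal.ofSeq fun _ => 1 := h1
  refine Filter.Germ.coe_eq.2 ?_
  filter_upwards [Hyperreal.ofSeq_lt_ofSeq.1 h1'] with n hn
  have h3 : |γ n| < 1 := by
    have h4 : ((|γ n| : ℤ) : ℝ) < ((1 : ℤ) : ℝ) := by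
      rw [Int.cast_abs, Int.cast_one]
      exact hn
    exact Int.cast_lt.1 h4
  rw [Int.abs_lt_one_iff.1 h3, Int.cast_zero]

theorem exists_intGerm_eq_of_bounded {r : ℕ → ℤ} {k : ℕ} (h0 : ∀ n, 0 ≤ r n)
    (hk : ∀ n, r n < k) : ∃ j : ℕ, intGerm r = j := by
  have h : ∀ᶠ n in (Filter.hyperfilter ℕ : Filter ℕ), ∃ j ∈ Finset.range k, r n = j :=
    Filter.Eventually.of_forall fun n => ⟨(r n).toNat, Finset.mem_range.2 (by
      have := hk n; have := h0 n; lia), by have := h0 n; lia⟩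
  have h' : ∃ j ∈ Finset.range k, ∀ᶠ n in (Filter.hyperfilter ℕ : Filter ℕ), r n = j :=
    (Ultrafilter.eventually_exists_mem_iff (Finset.finite_toSet (Finset.range k))).1 h
  obtain ⟨j, -, hj⟩ := h'
  refine ⟨j, Filter.Germ.coe_eq.2 ?_⟩
  filter_upwards [hj] with n hn
  rw [hn, Int.cast_natCast, Pi.natCast_apply]

theorem exists_intGerm_mem (hN : mk N ≤ 0) (h1 : 1 ∈ H) {γ δ : ℕ → ℤ} {n : ℕ} (hn : 0 < n)
    (hδ : intGerm δ ∈ H) (h : mk N < mk (n * intGerm γ - intGerm δ)) :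
    ∃ γ', intGerm γ' ∈ H ∧ mk N < mk (intGerm γ' - intGerm γ) := by
  have hn0 : (n : ℚ) ≠ 0 := by positivity
  have hnR : (n : Hyperreal) ≠ 0 := by positivity
  have hmem : ∀ x, (n : Hyperreal) * x ∈ H → x ∈ H := by
    intro x hx
    have := H.smul_mem (n : ℚ)⁻¹ hx
    rwa [Rat.smul_def, Rat.cast_inv, Rat.cast_natCast, inv_mul_cancel_left₀ hnR] at this
  have hnat : ∀ j : ℕ, (j : Hyperreal) ∈ H := by
    intro j
    rw [← nsmul_one]
    exact nsmul_mem h1 j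
  rcases hN.lt_or_eq with hN | hN
  · obtain ⟨j, hj⟩ := exists_intGerm_eq_of_bounded (r := fun i => δ i % n) (k := n)
      (fun i => Int.emod_nonneg _ (by lia)) (fun i => Int.emod_lt_of_pos _ (by lia))
    have h2 : (n : Hyperreal) * intGerm (fun i => δ i / n) = intGerm δ - j := by
      rw [← hj, ← map_sub, ← map_natCast intGerm, ← map_mul]
      congr 1
      funext i
      simp only [Pi.mul_apply, Pi.natCast_apply, Pi.sub_apply]
      have := Int.mul_ediv_add_emod (δ i) n
      lia
    refine ⟨fun i => δ i / n, hmem _ ?_, ?_⟩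
    · rw [h2]
      exact sub_mem hδ (hnat j)
    · have h3 : mk ((n : Hyperreal) * (intGerm (fun i => δ i / n) - intGerm γ)) =
          mk (intGerm (fun i => δ i / n) - intGerm γ) := by
        rw [mk_mul, mk_natCast hn.ne', zero_add]
      rw [← h3, mul_sub, h2, ← mk_neg (intGerm δ - _ - _)]
      have h4 : -(intGerm δ - j - n * intGerm γ) = (n * intGerm γ - intGerm δ) + j := by ring
      rw [h4]
      refine (lt_min h (hN.trans_le ?_)).trans_le (min_le_mk_add _ _)
      by_cases hj0 : j = 0
      · rw [hj0, Nat.cast_zero, mk_zero]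
        exact le_top
      · rw [mk_natCast hj0]
  · have h2 : (n : Hyperreal) * intGerm γ - intGerm δ = intGerm (n * γ - δ) := by
      rw [map_sub, map_mul, map_natCast]
    rw [hN, h2] at h
    have h3 := intGerm_eq_zero_of_pos_mk h
    rw [← h2, sub_eq_zero] at h3
    refine ⟨γ, hmem _ (by rwa [h3]), ?_⟩
    rw [sub_self, mk_zero, hN, ← mk_one]
    exact lt_top_iff_ne_top.2 fun h => one_ne_zero (mk_eq_top_iff.1 h)

theorem mem_lacunarySubfield_of_forall_eq_zero (hH : ∀ γ, intGerm γ ∈ H → intGerm γ = 0)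
    {g : RatGerm} (hg : IsAlgebraic (monomialField H) g) : g ∈ lacunarySubfield := by
  have hM := monomialField_le (H := H)
    (F := heightSubfield (Set.Ici ⊤) (isUpperSet_Ici _) (Set.mem_Ici.2 le_rfl))
    const_mem_heightSubfield fun γ hγ => monomial_mem_heightSubfield (Set.mem_Ici.2 (by
      rw [← intGerm_apply, hH γ hγ, mk_zero]))
  have h := mem_heightSubfield.1 (mem_heightSubfield_of_isAlgebraic (hg.mono_subfield hM))
  obtain ⟨c, rfl⟩ := exists_eq_const_of_height_eq_zero
    (mk_eq_top_iff.1 (top_le_iff.1 (Set.mem_Ici.1 h)))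
  exact const_mem_lacunarySubfield c

theorem mem_lacunarySubfield_of_finrank_eq (k : ℕ) : ∀ H : Submodule ℚ Hyperreal,
    FiniteDimensional ℚ H → Module.finrank ℚ H = k →
    (1 ∈ H ∨ ∀ γ, intGerm γ ∈ H → intGerm γ = 0) →
    ∀ g, IsAlgebraic (monomialField H) g → g ∈ lacunarySubfield := by
  induction k using Nat.strong_induction_on with
  | h k ih =>
    intro H hfd hk hH g hg
    rcases hH with h1 | hH
    swap
    · exact mem_lacunarySubfield_of_forall_eq_zero hH hg
    obtain ⟨N, hNH, hN⟩ := (Module.Finite.iff_fg.1 hfd).exists_mk_le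
    have hmk1 : mk N ≤ 0 := by
      rw [← mk_one]
      exact hN 1 h1
    have hNtop : mk N < ⊤ := hmk1.trans_lt (by
      rw [← mk_one]
      exact lt_top_iff_ne_top.2 fun h => one_ne_zero (mk_eq_top_iff.1 h))
    let Δ : Submodule ℚ Hyperreal :=
      { carrier := {h | h ∈ H ∧ mk N < mk h}
        zero_mem' := ⟨zero_mem H, by rwa [mk_zero]⟩
        add_mem' := fun ha hb =>
          ⟨add_mem ha.1 hb.1, (lt_min ha.2 hb.2).trans_le (min_le_mk_add _ _)⟩
        smul_mem' := fun q a ha => ⟨H.smul_mem q ha.1, ha.2.trans_le (mk_le_mk_smul a q)⟩ }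
    have hΔ : ∀ h, h ∈ Δ ↔ h ∈ H ∧ mk N < mk h := fun h => Iff.rfl
    have hlt : Δ < H := lt_of_le_of_ne (fun h hh => hh.1) fun h => by
      rw [← h] at hNH
      exact lt_irrefl _ hNH.2
    have hlac := ih _ (hk ▸ Submodule.finrank_lt_finrank_of_lt hlt) Δ
      (Submodule.finiteDimensional_of_le hlt.le) rfl (by
        by_cases h : mk N < 0
        · exact Or.inl ⟨h1, by rwa [mk_one]⟩
        · exact Or.inr fun γ hγ => intGerm_eq_zero_of_pos_mk ((not_lt.1 h).trans_lt hγ.2))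
    by_cases hne : ∃ γ, intGerm γ ∈ H ∧ ¬ mk N < mk (intGerm γ)
    · have hN0 : 0 < |N| := abs_pos.2 fun h => by
        rw [h, mk_zero] at hNtop
        exact lt_irrefl _ hNtop
      rw [← mk_abs] at hmk1 hNtop
      simp only [← mk_abs N] at hN hΔ hne
      exact mem_lacunarySubfield_of_isAlgebraic_of_forall hN0 hN hΔ hNtop hne
        (fun γ δ n hn hδ h => exists_intGerm_mem hmk1 h1 hn hδ h) hlac hg
    · push Not at hne
      exact hlac g (hg.mono_subfield (monomialField_le const_mem_monomialField
        fun γ hγ => monomial_mem_monomialField ((hΔ _).2 ⟨hγ, hne γ hγ⟩)))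

end RatGerm

theorem Subfield.isAlgebraic_of_sum_eq_zero {E : Type*} [Field E] {k : Subfield E} {d : ℕ}
    {a : ℕ → E} (ha : ∀ j, a j ∈ k) (ha' : ∃ j ∈ Finset.range d, a j ≠ 0) {g : E}
    (hg : ∑ j ∈ Finset.range d, a j * g ^ j = 0) : IsAlgebraic k g := by
  refine ⟨∑ j ∈ Finset.range d, C (⟨a j, ha j⟩ : k) * X ^ j, fun h => ?_, ?_⟩
  · obtain ⟨j, hj, hj'⟩ := ha'
    have h1 := congrArg (fun p => p.coeff j) h
    simp only [finsetSum_coeff, coeff_C_mul_X_pow, coeff_zero, Finset.sum_ite_eq, hj, if_true] at h1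
    exact hj' (congrArg Subtype.val h1)
  · rw [map_sum, ← hg]
    refine Finset.sum_congr rfl fun j _ => ?_
    rw [map_mul, aeval_C, map_pow, aeval_X]
    rfl

namespace RatGerm

theorem mem_lacunarySubfield_of_eval₂_eq_zero {d ℓ : ℕ} {f : ℕ → ℂ[X][X]} {g : ℕ → RatFunc ℂ}
    (hf : ∀ n, f n ≠ 0) (hℓ : ∀ n, (f n).support.card ≤ ℓ)
    (hd : ∀ n i, ((f n).coeff i).natDegree ≤ d)
    (hfg : ∀ n, (f n).eval₂ (eval₂RingHom RatFunc.C (g n)) RatFunc.X = 0) :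
    ofSeq g ∈ lacunarySubfield := by
  choose t ht ht' using fun n => Infinite.exists_superset_card_eq (f n).support ℓ (hℓ n)
  let e : ℕ → Fin ℓ → ℕ := fun n => (t n).orderEmbOfFin (ht' n)
  let u : ℕ → ℕ → RatFunc ℂ := fun j n =>
    ∑ i, RatFunc.C (((f n).coeff (e n i)).coeff j) * RatFunc.X ^ ((e n i : ℕ) : ℤ)
  have hu : ∀ j n, u j n = algebraMap ℂ[X] (RatFunc ℂ)
      (∑ m ∈ t n, C (((f n).coeff m).coeff j) * X ^ m) := by
    intro j n
    rw [← Finset.map_orderEmbOfFin_univ (t n) (ht' n), Finset.sum_map, map_sum]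
    refine Finset.sum_congr rfl fun i _ => ?_
    rw [map_mul, map_pow, RatFunc.algebraMap_C, RatFunc.algebraMap_X, zpow_natCast]
    rfl
  have hsum : ∀ n, ∑ j ∈ Finset.range (d + 1), u j n * g n ^ j = 0 := by
    intro n
    rw [← hfg n, eval₂_eq_sum, Polynomial.sum, Finset.sum_subset (ht n) (fun m _ hm => by
      rw [notMem_support_iff.1 hm, map_zero, zero_mul])]
    simp only [hu, map_sum, Finset.sum_mul]
    rw [Finset.sum_comm]
    refine Finset.sum_congr rfl fun m _ => ?_
    rw [coe_eval₂RingHom, eval₂_eq_sum_range' _ (Nat.lt_succ_of_le (hd n m)), Finset.sum_mul]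
    refine Finset.sum_congr rfl fun j _ => ?_
    rw [map_mul, map_pow, RatFunc.algebraMap_C, RatFunc.algebraMap_X]
    ring
  have hne : ∀ n, ∃ j ∈ Finset.range (d + 1), u j n ≠ 0 := by
    intro n
    obtain ⟨m, hm⟩ := nonempty_support_iff.2 (hf n)
    have hm' := mem_support_iff.1 hm
    refine ⟨((f n).coeff m).natDegree, Finset.mem_range.2 (Nat.lt_succ_of_le (hd n m)), ?_⟩
    rw [hu]
    refine RatFunc.algebraMap_ne_zero fun h => hm' ?_
    have h1 := congrArg (fun p => p.coeff m) h
    simp only [finsetSum_coeff, coeff_C_mul_X_pow, coeff_zero, Finset.sum_ite_eq, ht n hm,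
      if_true] at h1
    exact leadingCoeff_eq_zero.1 h1
  let H : Submodule ℚ Hyperreal :=
    Submodule.span ℚ (insert 1 (Set.range fun i : Fin ℓ => intGerm fun n => (e n i : ℤ)))
  have hH : FiniteDimensional ℚ H := FiniteDimensional.span_of_finite ℚ ((Set.finite_range _).insert 1)
  refine mem_lacunarySubfield_of_finrank_eq _ H hH rfl
    (Or.inl (Submodule.subset_span (Set.mem_insert _ _))) _
    (Subfield.isAlgebraic_of_sum_eq_zero (a := fun j => ofSeq (u j)) (d := d + 1) ?_ ?_ ?_)
  · intro j
    have h : ofSeq (u j) = ∑ i, const (fun n => ((f n).coeff (e n i)).coeff j) *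
        monomial fun n => (e n i : ℤ) := by
      simp only [const_eq, monomial, ← map_mul, ← map_sum]
      congr 1
      funext n
      rw [Finset.sum_apply]
      rfl
    rw [h]
    exact sum_mem fun i _ => mul_mem (const_mem_monomialField _) (monomial_mem_monomialField
      (Submodule.subset_span (Set.mem_insert_of_mem _ ⟨i, rfl⟩)))
  · have h : ∃ j ∈ Finset.range (d + 1), ∀ᶠ n in (Filter.hyperfilter ℕ : Filter ℕ), u j n ≠ 0 :=
      (Ultrafilter.eventually_exists_mem_iff (Finset.finite_toSet _)).1
        (Filter.Eventually.of_forall hne)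
    obtain ⟨j, hj, hj'⟩ := h
    exact ⟨j, hj, ofSeq_ne_zero.2 hj'⟩
  · simp only [← map_pow, ← map_mul, ← map_sum]
    rw [ofSeq_eq_zero]
    refine Filter.Eventually.of_forall fun n => ?_
    rw [Finset.sum_apply]
    exact hsum n

end RatGerm

/-- Theorem 2(a) (Fuchs–Mantova–Zannier): rational roots of lacunary equations
are lacunary.  Here `f ∈ ℂ[x,y]` is encoded as a polynomial in `x` with
coefficients in `ℂ[y]`, i.e. as an element of `(ℂ[y])[x]`: its outer support
card is its number of nonzero coefficients as a polynomial in `x`, and the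
degrees of its coefficients are its degrees in `y`.  The substitution
`f(x, g(x))` maps the coefficients `c(y) ↦ c(g(x))` and `x ↦ X`. -/
theorem fuchs_mantova_zannier_thm2a :
    ∃ B₄ : ℕ × ℕ → ℕ, ∀ (d ℓ : ℕ) (f : Polynomial (Polynomial ℂ)) (g : RatFunc ℂ),
      f ≠ 0 →
      f.support.card ≤ ℓ →
      (∀ i, (f.coeff i).natDegree ≤ d) →
      Polynomial.eval₂ (Polynomial.eval₂RingHom RatFunc.C g) RatFunc.X f = 0 →
      Nsharp g ≤ B₄ (d, ℓ) := by
  suffices h : ∀ p : ℕ × ℕ, ∃ B, ∀ (f : Polynomial (Polynomial ℂ)) (g : RatFunc ℂ), f ≠ 0 →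
      f.support.card ≤ p.2 → (∀ i, (f.coeff i).natDegree ≤ p.1) →
      Polynomial.eval₂ (Polynomial.eval₂RingHom RatFunc.C g) RatFunc.X f = 0 → Nsharp g ≤ B by
    choose B hB using h
    exact ⟨B, fun d ℓ => hB (d, ℓ)⟩
  intro p
  by_contra! h
  choose f g hf hℓ hd hfg hB using h
  obtain ⟨B, g', hgg', hg'⟩ := RatGerm.mem_lacunarySubfield_of_eval₂_eq_zero hf hℓ hd hfg
  obtain ⟨n, hn, hn'⟩ := ((RatGerm.ofSeq_eq_ofSeq.1 hgg').and
    (Filter.Eventually.filter_mono Nat.hyperfilter_le_atTop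
      (Filter.eventually_ge_atTop B))).exists
  exact absurd (hn ▸ hg' n) (not_le.2 (hn'.trans_lt (hB n)))
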